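/- Let f : 𝔻 → ℝ be a minimal graph over the open unit disk. Then at the origin W(0,0)² · |K(0,0)| ≤ 16π²/27, i.e. |f_uu(0,0) f_vv(0,0) − f_uv(0,0)²| / (1 + f_u(0,0)² + f_v(0,0)²) ≤ 16π²/27. -/

import Mathlib

open Real

/-- The open unit disk in `ℝ × ℝ`. -/
def unitDisk : Set (ℝ × ℝ) := {p : ℝ × ℝ | p.1 ^ 2 + p.2 ^ 2 < 1}

/-- Partial derivative with respect to the first coordinate `u`. -/
noncomputable def pu (f : ℝ × ℝ → ℝ) (p : ℝ × ℝ) : ℝ :=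
  deriv (fun u : ℝ => f (u, p.2)) p.1

/-- Partial derivative with respect to the second coordinate `v`. -/
noncomputable def pv (f : ℝ × ℝ → ℝ) (p : ℝ × ℝ) : ℝ :=
  deriv (fun v : ℝ => f (p.1, v)) p.2

/-- `f : 𝔻 → ℝ` is a minimal graph over the open unit disk: it is `C²` there and
    satisfies the minimal surface equation. -/
def IsMinimalGraph (f : ℝ × ℝ → ℝ) : Prop :=
  ContDiffOn ℝ 2 f unitDisk ∧
    ∀ p ∈ unitDisk,
      (1 + (pv f p) ^ 2) * pu (pu f) p
        - 2 * pu f p * pv f p * pv (pu f) p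
        + (1 + (pu f p) ^ 2) * pv (pv f) p = 0

open MeasureTheory Set Filter Topology
open scoped ComplexConjugate

theorem sin_sq_half_add_le {x y : ℝ} (hx : 0 ≤ x) (hy : 0 ≤ y) (h : x + y ≤ π) :
    sin (x / 2) ^ 2 + sin (y / 2) ^ 2 ≤ sin ((x + y) / 2) ^ 2 := by
  have e : sin ((x + y) / 2) = sin (x / 2) * cos (y / 2) + cos (x / 2) * sin (y / 2) := by
    rw [← sin_add]; ring_nf
  have e2 : cos ((x + y) / 2) = cos (x / 2) * cos (y / 2) - sin (x / 2) * sin (y / 2) := by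
    rw [← cos_add]; ring_nf
  have h1 : 0 ≤ sin (x / 2) := sin_nonneg_of_nonneg_of_le_pi (by linarith) (by linarith)
  have h2 : 0 ≤ sin (y / 2) := sin_nonneg_of_nonneg_of_le_pi (by linarith) (by linarith)
  have h3 : 0 ≤ cos ((x + y) / 2) := cos_nonneg_of_neg_pi_div_two_le_of_le (by linarith) (by linarith)
  have h4 : 0 ≤ 2 * (sin (x / 2) * sin (y / 2)) * cos ((x + y) / 2) := by positivity
  rw [e2] at h4
  rw [e]
  have a1 := sin_sq_add_cos_sq (x / 2)
  have a2 := sin_sq_add_cos_sq (y / 2)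
  have : (sin (x / 2) * cos (y / 2) + cos (x / 2) * sin (y / 2)) ^ 2
      = sin (x / 2) ^ 2 + sin (y / 2) ^ 2 + 2 * (sin (x / 2) * sin (y / 2)) *
        (cos (x / 2) * cos (y / 2) - sin (x / 2) * sin (y / 2)) := by
    linear_combination (sin (y / 2)) ^ 2 * a1 + (sin (x / 2)) ^ 2 * a2
  linarith

theorem sum_sin_sq_half_three_le (x y z : ℝ) (h : x + y + z = 2 * π) :
    sin (x / 2) ^ 2 + sin (y / 2) ^ 2 + sin (z / 2) ^ 2 ≤ 9 / 4 := by
  have hz : cos z = cos x * cos y - sin x * sin y := by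
    rw [← cos_add, show z = 2 * π - (x + y) by linarith, cos_two_pi_sub]
  have f : ∀ t : ℝ, sin (t / 2) ^ 2 = (1 - cos t) / 2 := fun t => by
    rw [sin_sq_eq_half_sub]; ring_nf
  rw [f, f, f, hz]
  nlinarith [sq_nonneg (1 + cos x + cos y), sq_nonneg (sin x - sin y), sin_sq_add_cos_sq x,
    sin_sq_add_cos_sq y]

/-- The squared side lengths of a polygon inscribed in the unit circle add up to at most `9`. -/
theorem list_sum_sin_sq_half_le (l : List ℝ) (hl : ∀ x ∈ l, 0 ≤ x) (hs : l.sum = 2 * π) :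
    (l.map fun x => sin (x / 2) ^ 2).sum ≤ 9 / 4 := by
  induction h : l.length using Nat.strong_induction_on generalizing l with
  | _ n ih =>
  match l, hl, hs, h with
  | [], _, _, _ => norm_num
  | [a], _, hs, _ =>
    have := sum_sin_sq_half_three_le a 0 0 (by simpa using hs)
    simpa using this
  | [a, b], _, hs, _ =>
    have := sum_sin_sq_half_three_le a b 0 (by simpa using hs)
    simpa using this
  | [a, b, c], _, hs, _ =>
    have := sum_sin_sq_half_three_le a b c (by simpa [add_assoc] using hs)
    simpa [add_assoc] using this
  | a :: b :: c :: d :: l, hl, hs, h =>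
    simp only [List.mem_cons, forall_eq_or_imp, List.sum_cons, List.map_cons,
      List.length_cons] at *
    obtain ⟨ha, hb, hc, hd, hl⟩ := hl
    have hl0 : 0 ≤ l.sum := List.sum_nonneg hl
    rcases le_total (a + b) π with hab | hab
    · have := ih (l.length + 3) (by omega) ((a + b) :: c :: d :: l)
        (by simp only [List.mem_cons, forall_eq_or_imp]; exact ⟨by linarith, hc, hd, hl⟩)
        (by simp only [List.sum_cons]; linarith) (by simp)
      simp only [List.map_cons, List.sum_cons] at this
      linarith [sin_sq_half_add_le ha hb hab]
    · have := ih (l.length + 3) (by omega) (a :: b :: (c + d) :: l)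
        (by simp only [List.mem_cons, forall_eq_or_imp]; exact ⟨ha, hb, by linarith, hl⟩)
        (by simp only [List.sum_cons]; linarith) (by simp)
      simp only [List.map_cons, List.sum_cons] at this
      linarith [sin_sq_half_add_le hc hd (by linarith)]

/-- Halving trick: if `E s + E (L - s) ≥ 0` on `[0, L]` for all `L = 2 * π / N`, then `∫ r E ≥ 0`
for every nonnegative antitone weight `r`. -/
theorem neg_le_integral_mul_of_antitoneOn {E : ℝ → ℝ} (hE : Continuous E) {M : ℝ}
    (hM : ∀ s ∈ Icc 0 (2 * π), |E s| ≤ M)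
    (hsym : ∀ N : ℕ, 0 < N → ∀ s ∈ Icc 0 (2 * π / N), 0 ≤ E s + E (2 * π / N - s)) (k : ℕ) :
    ∀ N : ℕ, 0 < N → ∀ r : ℝ → ℝ, AntitoneOn r (Icc 0 (2 * π / N)) →
      (∀ s ∈ Icc 0 (2 * π / N), 0 ≤ r s) →
      -(r 0 * M * (2 * π / N)) / 2 ^ k ≤ ∫ s in (0 : ℝ)..(2 * π / N), r s * E s := by
  induction k with
  | zero =>
    intro N hN r hr hr0
    set L := 2 * π / N with hL
    have hL0 : 0 ≤ L := by positivity
    have hL1 : L ≤ 2 * π := div_le_self (by positivity) (by exact_mod_cast hN)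
    have hM0 : 0 ≤ M := (abs_nonneg _).trans (hM 0 ⟨le_rfl, by positivity⟩)
    have hb : ‖∫ s in (0 : ℝ)..L, r s * E s‖ ≤ (r 0 * M) * |L - 0| := by
      apply intervalIntegral.norm_integral_le_of_norm_le_const
      intro s hs
      rw [uIoc_of_le hL0] at hs
      have hs' : s ∈ Icc 0 L := ⟨hs.1.le, hs.2⟩
      rw [norm_mul, Real.norm_of_nonneg (hr0 s hs')]
      exact mul_le_mul (hr ⟨le_rfl, hL0⟩ hs' hs'.1) (hM s ⟨hs'.1, hs'.2.trans hL1⟩)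
        (abs_nonneg _) (hr0 0 ⟨le_rfl, hL0⟩)
    rw [sub_zero, abs_of_nonneg hL0] at hb
    have := neg_le_of_abs_le hb
    simp only [pow_zero, div_one]
    linarith
  | succ k ih =>
    intro N hN r hr hr0
    set L := 2 * π / N with hL
    have hL0 : 0 ≤ L := by positivity
    have hL2 : 2 * π / ((2 * N : ℕ) : ℝ) = L / 2 := by rw [hL]; push_cast; field_simp
    have hsub1 : Icc 0 (L / 2) ⊆ Icc 0 L := Icc_subset_Icc le_rfl (by linarith)
    have hrefl : ∀ s ∈ Icc 0 L, L - s ∈ Icc 0 L := fun s hs => ⟨by linarith [hs.2], by linarith [hs.1]⟩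
    have key := ih (2 * N) (by omega) (fun s => r s - r (L - s)) (by
        rw [hL2]
        intro s hs t ht hst
        have h1 := hr (hsub1 hs) (hsub1 ht) hst
        have h2 := hr (hrefl t (hsub1 ht)) (hrefl s (hsub1 hs)) (by linarith)
        linarith) (by
        rw [hL2]
        intro s hs
        have := hr (hsub1 hs) (hrefl s (hsub1 hs)) (by linarith [hs.2])
        linarith)
    have hanti : AntitoneOn r (uIcc 0 L) := by rwa [uIcc_of_le hL0]
    have hi : IntervalIntegrable (fun s => r s * E s) volume 0 L :=
      (hanti.intervalIntegrable).mul_continuousOn hE.continuousOn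
    have hh0 : L / 2 ∈ uIcc 0 L := by rw [uIcc_of_le hL0]; constructor <;> linarith
    have hi1 : IntervalIntegrable (fun s => r s * E s) volume 0 (L / 2) :=
      hi.mono_set (uIcc_subset_uIcc left_mem_uIcc hh0)
    have hi2 : IntervalIntegrable (fun s => r s * E s) volume (L / 2) L :=
      hi.mono_set (uIcc_subset_uIcc hh0 right_mem_uIcc)
    have hi3 : IntervalIntegrable (fun s => r (L - s) * E (L - s)) volume 0 (L / 2) := by
      have := hi2.comp_sub_left L
      simp only [sub_self] at this
      rw [show L - L / 2 = L / 2 by ring] at this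
      exact this.symm
    have e1 : ∫ s in (0 : ℝ)..L, r s * E s
        = ∫ s in (0 : ℝ)..(L / 2), (r s * E s + r (L - s) * E (L - s)) := by
      rw [intervalIntegral.integral_add hi1 hi3, intervalIntegral.integral_comp_sub_left (fun s => r s * E s) L, sub_zero,
        show L - L / 2 = L / 2 by ring, intervalIntegral.integral_add_adjacent_intervals hi1 hi2]
    have hrl : IntervalIntegrable (fun s => r (L - s)) volume 0 (L / 2) := by
      have : IntervalIntegrable r volume (L / 2) L :=
        hanti.intervalIntegrable.mono_set (uIcc_subset_uIcc hh0 right_mem_uIcc)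
      have := this.comp_sub_left L
      simp only [sub_self] at this
      rw [show L - L / 2 = L / 2 by ring] at this
      exact this.symm
    have hrr : IntervalIntegrable r volume 0 (L / 2) :=
        hanti.intervalIntegrable.mono_set (uIcc_subset_uIcc left_mem_uIcc hh0)
    have e2 : ∫ s in (0 : ℝ)..(L / 2), (r s - r (L - s)) * E s ≤ ∫ s in (0 : ℝ)..L, r s * E s := by
      rw [e1]
      apply intervalIntegral.integral_mono_on (by linarith)
        ((hrr.sub hrl).mul_continuousOn hE.continuousOn) (hi1.add hi3)
      intro s hs
      have h1 := hsym N hN s (hsub1 hs)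
      have h2 := hr0 (L - s) (hrefl s (hsub1 hs))
      nlinarith [mul_nonneg h2 h1]
    rw [hL2] at key
    refine le_trans ?_ (key.trans e2)
    have hM0 : 0 ≤ M := (abs_nonneg _).trans (hM 0 ⟨le_rfl, by positivity⟩)
    have hrL : 0 ≤ r L := hr0 L ⟨hL0, le_rfl⟩
    have h5 : 0 ≤ r L * M * L := by positivity
    rw [sub_zero, pow_succ, div_le_div_iff₀ (by positivity) (by positivity)]
    have : 0 < (2 : ℝ) ^ k := by positivity
    nlinarith [mul_nonneg h5 this.le]

/-- The `n`-th Fourier coefficient of `u` on `[0, 2π]`. -/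
noncomputable def fourierCoef (u : ℝ → ℂ) (n : ℤ) : ℂ :=
  (2 * π : ℂ)⁻¹ * ∫ x in (0:ℝ)..2 * π, Complex.exp (-(n * x * Complex.I)) * u x

theorem hasSum_norm_fourierCoef_sq {u : ℝ → ℂ} (hm : Measurable u) {C : ℝ} (hC : ∀ x, ‖u x‖ ≤ C) :
    HasSum (fun n => ‖fourierCoef u n‖ ^ 2) ((2 * π)⁻¹ * ∫ x in (0:ℝ)..2 * π, ‖u x‖ ^ 2) := by
  have hab : (0:ℝ) < 2 * π := by positivity
  have hL : MemLp u 2 (volume.restrict (Ioc 0 (2 * π))) :=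
    MemLp.of_bound hm.aestronglyMeasurable C (Eventually.of_forall hC)
  have h := hasSum_sq_fourierCoeffOn hab hL
  rw [sub_zero, smul_eq_mul] at h
  convert h using 3 with n
  rw [fourierCoeffOn_eq_integral, fourierCoef]
  have : ∀ x : ℝ, fourier (-n) (x : AddCircle (2 * π - 0)) • u x
      = Complex.exp (-(n * x * Complex.I)) * u x := by
    intro x
    rw [fourier_coe_apply, smul_eq_mul]
    congr 2
    have : (π : ℂ) ≠ 0 := by exact_mod_cast pi_ne_zero
    push_cast
    field_simp
    simp
    ring
  rw [intervalIntegral.integral_congr fun x _ => this x]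
  simp only [sub_zero, one_div, Complex.real_smul]
  push_cast
  rfl

theorem fourierCoef_comp_add {u : ℝ → ℂ} (hp : Function.Periodic u (2 * π)) (s : ℝ) (n : ℤ) :
    fourierCoef (fun x => u (x + s)) n = Complex.exp (n * s * Complex.I) * fourierCoef u n := by
  have hq : Function.Periodic (fun x : ℝ => Complex.exp (-(n * x * Complex.I)) * u x) (2 * π) := by
    intro x
    simp only [hp x]
    congr 1
    push_cast
    rw [show -(n * (x + 2 * π) * Complex.I) = -(n * x * Complex.I) + ((-n : ℤ) : ℂ) * (2 * π * Complex.I) by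
      push_cast; ring, Complex.exp_add, Complex.exp_int_mul_two_pi_mul_I, mul_one]
  have h1 : ∀ x : ℝ, Complex.exp (-(n * x * Complex.I)) * u (x + s) =
      Complex.exp (n * s * Complex.I) *
        (fun x : ℝ => Complex.exp (-(n * x * Complex.I)) * u x) (x + s) := by
    intro x
    simp only
    rw [← mul_assoc, ← Complex.exp_add]
    congr 2
    push_cast; ring
  rw [fourierCoef, intervalIntegral.integral_congr fun x _ => h1 x,
    intervalIntegral.integral_const_mul,
    intervalIntegral.integral_comp_add_right (fun x : ℝ => Complex.exp (-(n * x * Complex.I)) * u x),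
    zero_add, add_comm (2 * π) s, hq.intervalIntegral_add_eq s 0, zero_add, fourierCoef]
  ring

theorem intervalIntegrable_of_measurable_of_norm_le {E : Type*} [NormedAddCommGroup E]
    [MeasurableSpace E] [BorelSpace E] [SecondCountableTopology E]
    {u : ℝ → E} (hm : Measurable u) {C : ℝ} (hC : ∀ x, ‖u x‖ ≤ C) (a b : ℝ) :
    IntervalIntegrable u volume a b := by
  rw [intervalIntegrable_iff]
  exact Measure.integrableOn_of_bounded (M := C) (by simp) hm.aestronglyMeasurable
    (Eventually.of_forall hC)

theorem fourierCoef_sub {u v : ℝ → ℂ} (hu : Measurable u) (hv : Measurable v) {C D : ℝ}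
    (hC : ∀ x, ‖u x‖ ≤ C) (hD : ∀ x, ‖v x‖ ≤ D) (n : ℤ) :
    fourierCoef (fun x => u x - v x) n = fourierCoef u n - fourierCoef v n := by
  have key : ∀ {w : ℝ → ℂ} {C : ℝ}, Measurable w → (∀ x, ‖w x‖ ≤ C) → IntervalIntegrable
      (fun x : ℝ => Complex.exp (-(n * x * Complex.I)) * w x) volume 0 (2 * π) := by
    intro w C hw hC
    refine intervalIntegrable_of_measurable_of_norm_le (C := C) (by fun_prop) (fun x => ?_) _ _
    rw [norm_mul, show -(n * x * Complex.I) = ((-(n * x) : ℝ) : ℂ) * Complex.I by push_cast; ring,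
      Complex.norm_exp_ofReal_mul_I, one_mul]
    exact hC x
  simp only [fourierCoef, mul_sub]
  rw [intervalIntegral.integral_sub (key hu hC) (key hv hD), mul_sub]

/-- Mean squared half chord of the boundary correspondence `φ` under a shift by `s`. -/
noncomputable def meanSinSq (φ : ℝ → ℝ) (s : ℝ) : ℝ :=
  (2 * π)⁻¹ * ∫ x in (0:ℝ)..2 * π, sin ((φ (x + s) - φ x) / 2) ^ 2

theorem norm_exp_mul_I_sub_sq (a b : ℝ) :
    ‖Complex.exp (a * Complex.I) - Complex.exp (b * Complex.I)‖ ^ 2 = 4 * sin ((a - b) / 2) ^ 2 := by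
  have h : cos (a - b) = 1 - 2 * sin ((a - b) / 2) ^ 2 := by
    have := cos_sq_add_sin_sq ((a - b) / 2)
    have h2 := cos_two_mul ((a - b) / 2)
    rw [mul_div_cancel₀ _ two_ne_zero] at h2
    nlinarith
  rw [Complex.sq_norm, Complex.normSq_apply, Complex.sub_re, Complex.sub_im,
    Complex.exp_ofReal_mul_I_re, Complex.exp_ofReal_mul_I_re, Complex.exp_ofReal_mul_I_im,
    Complex.exp_ofReal_mul_I_im]
  rw [cos_sub] at h
  nlinarith [cos_sq_add_sin_sq a, cos_sq_add_sin_sq b]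

theorem hasSum_meanSinSq {φ : ℝ → ℝ} (hφ : Monotone φ)
    (hper : ∀ x, φ (x + 2 * π) = φ x + 2 * π) (s : ℝ) :
    HasSum (fun n : ℤ => ‖fourierCoef (fun x => Complex.exp (φ x * Complex.I)) n‖ ^ 2 *
      ((1 - cos (n * s)) / 2)) (meanSinSq φ s) := by
  set u : ℝ → ℂ := fun x => Complex.exp (φ x * Complex.I) with hu
  have hum : Measurable u := by
    have := hφ.measurable
    fun_prop
  have hub : ∀ x, ‖u x‖ ≤ 1 := fun x => (Complex.norm_exp_ofReal_mul_I _).le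
  have hup : Function.Periodic u (2 * π) := by
    intro x
    simp only [hu, hper]
    push_cast
    rw [add_mul, Complex.exp_add, Complex.exp_two_pi_mul_I, mul_one]
  have hum' : Measurable fun x => u (x + s) := by fun_prop
  have h := hasSum_norm_fourierCoef_sq (hum'.sub hum) (C := 2) (fun x => by
    refine (norm_sub_le _ _).trans ?_
    linarith [hub (x + s), hub x])
  have h4 := h.mul_left (1 / 4)
  suffices e : (∀ n : ℤ, ‖fourierCoef u n‖ ^ 2 * ((1 - cos (n * s)) / 2) =
      1 / 4 * ‖fourierCoef ((fun x => u (x + s)) - u) n‖ ^ 2) ∧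
      meanSinSq φ s = 1 / 4 * ((2 * π)⁻¹ * ∫ x in (0:ℝ)..2 * π,
        ‖((fun x => u (x + s)) - u) x‖ ^ 2) by
    simp only [e.1, e.2]; exact h4
  refine ⟨fun n => ?_, ?_⟩
  · rw [show ((fun x => u (x + s)) - u) = fun x => u (x + s) - u x from rfl,
      fourierCoef_sub hum' hum (fun x => hub _) hub, fourierCoef_comp_add hup]
    have h1 := norm_exp_mul_I_sub_sq (n * s) 0
    have h2 : Complex.exp (n * s * Complex.I) * fourierCoef u n - fourierCoef u n
      = (Complex.exp (((n * s : ℝ) : ℂ) * Complex.I) - Complex.exp ((0 : ℝ) * Complex.I)) *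
        fourierCoef u n := by
      simp; ring
    rw [h2, norm_mul, mul_pow, h1, sub_zero, sin_sq_eq_half_sub,
      mul_div_cancel₀ _ (two_ne_zero (α := ℝ))]
    ring
  · rw [meanSinSq, mul_left_comm, ← intervalIntegral.integral_const_mul (1 / 4 : ℝ)]
    congr 1
    refine intervalIntegral.integral_congr fun x _ => ?_
    simp only [Pi.sub_apply, hu, norm_exp_mul_I_sub_sq]
    ring

theorem hasSum_norm_fourierCoef_sq_one {φ : ℝ → ℝ} (hφ : Monotone φ) :
    HasSum (fun n : ℤ => ‖fourierCoef (fun x => Complex.exp (φ x * Complex.I)) n‖ ^ 2) 1 := by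
  have hum : Measurable fun x => Complex.exp (φ x * Complex.I) := by
    have := hφ.measurable
    fun_prop
  have h := hasSum_norm_fourierCoef_sq hum (C := 1)
    (fun x => (Complex.norm_exp_ofReal_mul_I _).le)
  simp only [Complex.norm_exp_ofReal_mul_I] at h
  convert h using 1
  simp
  field_simp

theorem continuous_meanSinSq {φ : ℝ → ℝ} (hφ : Monotone φ)
    (hper : ∀ x, φ (x + 2 * π) = φ x + 2 * π) : Continuous (meanSinSq φ) := by
  have h : meanSinSq φ = fun s => ∑' n : ℤ,
      ‖fourierCoef (fun x => Complex.exp (φ x * Complex.I)) n‖ ^ 2 * ((1 - cos (n * s)) / 2) :=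
    funext fun s => (hasSum_meanSinSq hφ hper s).tsum_eq.symm
  rw [h]
  refine continuous_tsum (fun n => by fun_prop)
    (hasSum_norm_fourierCoef_sq_one hφ).summable fun n x => ?_
  rw [norm_mul, norm_of_nonneg (sq_nonneg _)]
  refine mul_le_of_le_one_right (sq_nonneg _) ?_
  rw [norm_eq_abs, abs_le]
  constructor <;> linarith [cos_le_one (n * x), neg_one_le_cos (n * x)]

theorem meanSinSq_nonneg (φ : ℝ → ℝ) (s : ℝ) : 0 ≤ meanSinSq φ s :=
  mul_nonneg (by positivity) (intervalIntegral.integral_nonneg (by positivity) fun _ _ => sq_nonneg _)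

theorem meanSinSq_le_one {φ : ℝ → ℝ} (hφ : Monotone φ) (s : ℝ) : meanSinSq φ s ≤ 1 := by
  have hm := hφ.measurable
  have h : ∫ x in (0:ℝ)..2 * π, sin ((φ (x + s) - φ x) / 2) ^ 2 ≤ ∫ x in (0:ℝ)..2 * π, (1:ℝ) := by
    refine intervalIntegral.integral_mono_on (by positivity) ?_ (by simp) fun x _ => sin_sq_le_one _
    refine intervalIntegrable_of_measurable_of_norm_le (C := 1) (by fun_prop) (fun x => ?_) _ _
    rw [norm_of_nonneg (sq_nonneg _)]
    exact sin_sq_le_one _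
  rw [intervalIntegral.integral_const, smul_eq_mul, mul_one, sub_zero] at h
  rw [meanSinSq, inv_mul_le_iff₀ (by positivity)]
  linarith

theorem meanSinSq_add_meanSinSq_le {φ : ℝ → ℝ} (hφ : Monotone φ)
    (hper : ∀ x, φ (x + 2 * π) = φ x + 2 * π) {N : ℕ} (hN : 0 < N) {s : ℝ}
    (hs : s ∈ Icc 0 (2 * π / N)) :
    meanSinSq φ s + meanSinSq φ (2 * π / N - s) ≤ 9 / (4 * N) := by
  have hm := hφ.measurable
  have hN' : (N : ℝ) ≠ 0 := by positivity
  set L : ℝ := 2 * π / N with hL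
  set h : ℝ → ℝ → ℝ := fun t x => sin ((φ (x + t) - φ x) / 2) ^ 2 with hh
  have hint : ∀ t c a b, IntervalIntegrable (fun x => h t (x + c)) volume a b := by
    intro t c a b
    refine intervalIntegrable_of_measurable_of_norm_le (C := 1) (by fun_prop) (fun x => ?_) _ _
    rw [norm_of_nonneg (sq_nonneg _)]
    exact sin_sq_le_one _
  have hshift : ∀ t c, ∫ x in (0:ℝ)..2 * π, h t (x + c) = 2 * π * meanSinSq φ t := by
    intro t c
    have hp : Function.Periodic (h t) (2 * π) := by
      intro x
      simp only [hh]
      rw [add_right_comm, hper, hper]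
      ring_nf
    rw [intervalIntegral.integral_comp_add_right (h t), zero_add, add_comm (2 * π) c,
      hp.intervalIntegral_add_eq c 0, zero_add, meanSinSq, mul_inv_cancel_left₀ (by positivity)]
  have hpt : ∀ x, ∑ j ∈ Finset.range N, (h s (x + j * L) + h (L - s) (x + (j * L + s))) ≤ 9 / 4 := by
    intro x
    let l : List ℝ := (List.range N).flatMap fun j : ℕ =>
      [φ (x + j * L + s) - φ (x + j * L), φ (x + (j + 1 : ℕ) * L) - φ (x + j * L + s)]
    have hl : ∀ y ∈ l, 0 ≤ y := by
      intro y hy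
      simp only [l, List.mem_flatMap, List.mem_cons, List.not_mem_nil, or_false] at hy
      obtain ⟨j, -, rfl | rfl⟩ := hy <;> refine sub_nonneg.2 (hφ ?_)
      · linarith [hs.1]
      · push_cast; nlinarith [hs.2]
    have aux : ∀ (F : ℕ → List ℝ) (M : ℕ), ((List.range M).flatMap F).sum =
        ∑ j ∈ Finset.range M, (F j).sum := by
      intro F M
      induction M with
      | zero => simp
      | succ M ih => simp [List.range_succ, Finset.sum_range_succ, ih]
    have hsum : l.sum = 2 * π := by
      rw [aux]
      have : ∀ j ∈ Finset.range N, [φ (x + j * L + s) - φ (x + j * L),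
          φ (x + (j + 1 : ℕ) * L) - φ (x + j * L + s)].sum
          = (fun j : ℕ => φ (x + j * L)) (j + 1) - (fun j : ℕ => φ (x + j * L)) j := by
        intro j _; simp
      rw [Finset.sum_congr rfl this, Finset.sum_range_sub (fun j : ℕ => φ (x + j * L)), hL, mul_div_cancel₀ _ hN', hper]
      simp
    have := list_sum_sin_sq_half_le l hl hsum
    rw [List.map_flatMap, aux] at this
    refine le_trans (le_of_eq (Finset.sum_congr rfl fun j _ => ?_)) this
    simp only [hh, List.map_cons, List.map_nil, List.sum_cons, List.sum_nil, add_zero]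
    push_cast
    ring_nf
  have hI : ∫ x in (0:ℝ)..2 * π, ∑ j ∈ Finset.range N,
      (h s (x + j * L) + h (L - s) (x + (j * L + s))) ≤ ∫ x in (0:ℝ)..2 * π, (9 / 4 : ℝ) := by
    refine intervalIntegral.integral_mono_on (by positivity) ?_ (by simp) fun x _ => hpt x
    have := IntervalIntegrable.sum (Finset.range N) (μ := volume) (a := 0) (b := 2 * π)
      (f := fun j x => h s (x + j * L) + h (L - s) (x + (j * L + s)))
      fun j _ => (hint _ _ _ _).add (hint _ _ _ _)
    refine this.congr fun x _ => ?_
    simp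
  rw [intervalIntegral.integral_finsetSum fun j _ => (hint _ _ _ _).add (hint _ _ _ _)] at hI
  simp_rw [intervalIntegral.integral_add (hint _ _ _ _) (hint _ _ _ _), hshift] at hI
  rw [Finset.sum_const, Finset.card_range, intervalIntegral.integral_const, nsmul_eq_mul,
    smul_eq_mul, sub_zero, ← mul_add, mul_left_comm] at hI
  have := le_of_mul_le_mul_left hI (by positivity)
  rw [le_div_iff₀ (by positivity)]
  linarith

theorem neg_half_le_cos_two_pi_mul_div_three (n : ℤ) : -(1 / 2) ≤ cos (2 * π / 3 * n) := by
  have h := cos_three_mul (2 * π / 3 * n)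
  rw [show 3 * (2 * π / 3 * n) = n * (2 * π) by ring, cos_int_mul_two_pi] at h
  nlinarith [sq_nonneg (cos (2 * π / 3 * n) - 1), sq_nonneg (2 * cos (2 * π / 3 * n) + 1)]

theorem integral_sin_add_mul_cos_nonpos {n : ℤ} (h0 : n ≠ 0) (h1 : n ≠ 1) (h2 : n ≠ -1) :
    ∫ s in (0:ℝ)..2 * π / 3, sin (s + π / 3) * cos (n * s) ≤ 0 := by
  have hn : (4 : ℝ) ≤ (n : ℝ) ^ 2 := by
    have : (4 : ℤ) ≤ n ^ 2 := by
      have : 2 ≤ |n| := by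
        rcases abs_cases n with h | h <;> omega
      rw [← sq_abs]; nlinarith
    exact_mod_cast this
  have hp : (1 + (n : ℝ)) ≠ 0 := fun h => by
    have : (n : ℝ) = -1 := by linarith
    rw [this] at hn; norm_num at hn
  have hm : (1 - (n : ℝ)) ≠ 0 := fun h => by
    have : (n : ℝ) = 1 := by linarith
    rw [this] at hn; norm_num at hn
  have hd : ∀ x ∈ uIcc 0 (2 * π / 3), HasDerivAt (fun s => -(1 / 2) *
      (cos ((1 + n) * s + π / 3) / (1 + n) + cos ((1 - n) * s + π / 3) / (1 - n)))
      (sin (x + π / 3) * cos (n * x)) x := by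
    intro x _
    have a1 : HasDerivAt (fun s : ℝ => (1 + n) * s + π / 3) (1 + n) x := by
      simpa using ((hasDerivAt_id x).const_mul (1 + n : ℝ)).add_const (π / 3)
    have a2 : HasDerivAt (fun s : ℝ => (1 - n) * s + π / 3) (1 - n) x := by
      simpa using ((hasDerivAt_id x).const_mul (1 - n : ℝ)).add_const (π / 3)
    refine (((a1.cos.div_const (1 + n : ℝ)).add (a2.cos.div_const (1 - n : ℝ))).const_mul
      (-(1 / 2) : ℝ)).congr_deriv ?_
    rw [show (1 + n) * x + π / 3 = (x + π / 3) + n * x by ring,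
      show (1 - n) * x + π / 3 = (x + π / 3) - n * x by ring, sin_add (x + π / 3),
      sin_sub (x + π / 3)]
    field_simp
    ring
  rw [intervalIntegral.integral_eq_sub_of_hasDerivAt hd
    (Continuous.intervalIntegrable (by fun_prop) _ _)]
  have e1 : cos ((1 + n) * (2 * π / 3) + π / 3) = -cos (2 * π / 3 * n) := by
    rw [← cos_add_pi]; ring_nf
  have e2 : cos ((1 - n) * (2 * π / 3) + π / 3) = -cos (2 * π / 3 * n) := by
    rw [← cos_pi_sub]; ring_nf
  rw [e1, e2]
  simp only [mul_zero, zero_add, cos_pi_div_three]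
  have key := neg_half_le_cos_two_pi_mul_div_three n
  set c := cos (2 * π / 3 * n)
  have : -(1 / 2) * (-c / (1 + n) + -c / (1 - n)) - -(1 / 2) * (1 / 2 / (1 + n) + 1 / 2 / (1 - n))
      = (1 / 2 + c) / (1 - n ^ 2 : ℝ) := by
    rw [show (1 - n ^ 2 : ℝ) = (1 + n) * (1 - n) by ring]
    field_simp
    ring
  rw [this]
  exact div_nonpos_of_nonneg_of_nonpos (by linarith) (by linarith)

theorem integral_sin_add_mul_cos :
    ∫ s in (0:ℝ)..2 * π / 3, sin (s + π / 3) * cos s = π / (2 * √3) := by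
  have hd : ∀ x ∈ uIcc 0 (2 * π / 3), HasDerivAt (fun s => -(1 / 4) * cos (2 * s + π / 3) +
      √3 / 4 * s) (sin (x + π / 3) * cos x) x := by
    intro x _
    have a1 : HasDerivAt (fun s : ℝ => 2 * s + π / 3) 2 x := by
      simpa using ((hasDerivAt_id x).const_mul (2 : ℝ)).add_const (π / 3)
    refine ((a1.cos.const_mul (-(1 / 4) : ℝ)).add
      ((hasDerivAt_id x).const_mul (√3 / 4))).congr_deriv ?_
    rw [sin_add, sin_add, sin_pi_div_three, cos_pi_div_three, sin_two_mul, cos_two_mul]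
    ring
  rw [intervalIntegral.integral_eq_sub_of_hasDerivAt hd
    (Continuous.intervalIntegrable (by fun_prop) _ _)]
  have e1 : cos (2 * (2 * π / 3) + π / 3) = 1 / 2 := by
    rw [← cos_pi_div_three, ← cos_neg, ← cos_add_two_pi]; ring_nf
  rw [e1]
  simp only [mul_zero, zero_add, cos_pi_div_three]
  have h3 : √3 * √3 = 3 := mul_self_sqrt (by norm_num)
  rw [eq_div_iff (by positivity)]
  linear_combination (π / 3) * h3

theorem integral_sin_add : ∫ s in (0:ℝ)..2 * π / 3, sin (s + π / 3) = 3 / 2 := by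
  rw [intervalIntegral.integral_comp_add_right (fun s => sin s), integral_sin]
  rw [show 2 * π / 3 + π / 3 = π by ring, zero_add, cos_pi_div_three, cos_pi]
  norm_num

theorem integral_mul_sin_add :
    ∫ s in (0:ℝ)..2 * π / 3, sin (s + π / 3) * s = 2 * π / 3 - √3 / 2 := by
  have hd : ∀ x ∈ uIcc 0 (2 * π / 3), HasDerivAt (fun s => -(s * cos (s + π / 3)) +
      sin (s + π / 3)) (sin (x + π / 3) * x) x := by
    intro x _
    have a1 : HasDerivAt (fun s : ℝ => s + π / 3) 1 x := by
      simpa using (hasDerivAt_id x).add_const (π / 3)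
    refine ((((hasDerivAt_id x).mul a1.cos).neg).add a1.sin).congr_deriv ?_
    simp only [id]
    ring
  rw [intervalIntegral.integral_eq_sub_of_hasDerivAt hd
    (Continuous.intervalIntegrable (by fun_prop) _ _)]
  rw [show 2 * π / 3 + π / 3 = π by ring, zero_add, cos_pi, sin_pi, sin_pi_div_three]
  ring

theorem integral_sin_add_mul_meanSinSq_le {φ : ℝ → ℝ} (hφ : Monotone φ)
    (hper : ∀ x, φ (x + 2 * π) = φ x + 2 * π) :
    ∫ s in (0:ℝ)..2 * π / 3, sin (s + π / 3) * meanSinSq φ s ≤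
      9 / (8 * π) * (2 * π / 3 - √3 / 2) := by
  have hS := continuous_meanSinSq hφ hper
  set E : ℝ → ℝ := fun s => 9 / (8 * π) * s - meanSinSq φ s with hEdef
  have hE : Continuous E := by fun_prop
  have hM : ∀ s ∈ Icc 0 (2 * π), |E s| ≤ 9 / 4 := by
    intro s hs
    have h1 := meanSinSq_nonneg φ s
    have h2 := meanSinSq_le_one hφ s
    have h3 : 9 / (8 * π) * s ≤ 9 / 4 := by
      rw [div_mul_eq_mul_div, div_le_iff₀ (by positivity)]
      linarith [hs.2]
    have h4 : 0 ≤ 9 / (8 * π) * s := mul_nonneg (by positivity) hs.1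
    rw [abs_le]
    constructor <;> simp only [hEdef] <;> linarith
  have hsym : ∀ N : ℕ, 0 < N → ∀ s ∈ Icc 0 (2 * π / N), 0 ≤ E s + E (2 * π / N - s) := by
    intro N hN s hs
    have := meanSinSq_add_meanSinSq_le hφ hper hN hs
    have e : 9 / (8 * π) * (2 * π / N) = 9 / (4 * N) := by field_simp; norm_num
    simp only [hEdef]
    linarith
  have hpos : 0 ≤ ∫ s in (0:ℝ)..π / 3, cos (s + π / 6) * E s := by
    have h6 : 2 * π / ((6 : ℕ) : ℝ) = π / 3 := by push_cast; ring
    have key := fun k : ℕ => neg_le_integral_mul_of_antitoneOn hE hM hsym k 6 (by norm_num)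
      (fun s => cos (s + π / 6)) (by
        rw [h6]
        intro x hx y hy hxy
        exact cos_le_cos_of_nonneg_of_le_pi (by linarith [hx.1, pi_pos]) (by linarith [hy.2, pi_pos])
          (by linarith)) (by
        rw [h6]
        intro x hx
        exact cos_nonneg_of_neg_pi_div_two_le_of_le (by linarith [hx.1, pi_pos])
          (by linarith [hx.2, pi_pos]))
    rw [h6] at key
    have hl : Tendsto (fun k : ℕ => -(cos (0 + π / 6) * (9 / 4) * (π / 3)) / (2 : ℝ) ^ k) atTop (𝓝 0) := by
      have := (tendsto_inv_atTop_zero.comp (tendsto_pow_atTop_atTop_of_one_lt (r := (2:ℝ))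
        one_lt_two)).const_mul (-(cos (0 + π / 6) * (9 / 4) * (π / 3)))
      simpa [div_eq_mul_inv] using this
    exact le_of_tendsto' hl key
  have hcont : Continuous fun s => sin (s + π / 3) * E s := by fun_prop
  have hwE : 0 ≤ ∫ s in (0:ℝ)..2 * π / 3, sin (s + π / 3) * E s := by
    have hsplit : ∫ s in (0:ℝ)..2 * π / 3, sin (s + π / 3) * E s =
        ∫ s in (0:ℝ)..π / 3, (sin s * (E s + E (2 * π / 3 - s)) + cos (s + π / 6) * E s) := by
      rw [← intervalIntegral.integral_add_adjacent_intervals (b := π / 3)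
        (hcont.intervalIntegrable _ _) (hcont.intervalIntegrable _ _)]
      have : ∫ s in (π / 3)..2 * π / 3, sin (s + π / 3) * E s =
          ∫ s in (0:ℝ)..π / 3, sin s * E (2 * π / 3 - s) := by
        have h := intervalIntegral.integral_comp_sub_left (a := 0) (b := π / 3)
          (fun s => sin (s + π / 3) * E s) (2 * π / 3)
        rw [show 2 * π / 3 - π / 3 = π / 3 by ring, sub_zero] at h
        rw [← h]
        refine intervalIntegral.integral_congr fun s _ => ?_
        rw [show 2 * π / 3 - s + π / 3 = π - s by ring, sin_pi_sub]
      rw [this, ← intervalIntegral.integral_add (hcont.intervalIntegrable _ _)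
        (Continuous.intervalIntegrable (by fun_prop) _ _)]
      refine intervalIntegral.integral_congr fun s _ => ?_
      have : sin (s + π / 3) = sin s + cos (s + π / 6) := by
        rw [sin_add, cos_add, sin_pi_div_three, cos_pi_div_three, cos_pi_div_six, sin_pi_div_six]
        ring
      simp only [this]
      ring
    rw [hsplit, intervalIntegral.integral_add (Continuous.intervalIntegrable (by fun_prop) _ _)
      (Continuous.intervalIntegrable (by fun_prop) _ _)]
    refine add_nonneg (intervalIntegral.integral_nonneg (by positivity) fun s hs => ?_) hpos
    refine mul_nonneg (sin_nonneg_of_nonneg_of_le_pi hs.1 (by linarith [hs.2, pi_pos])) ?_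
    have := hsym 3 (by norm_num) s (by
      push_cast; exact ⟨hs.1, by linarith [hs.2, pi_pos]⟩)
    exact_mod_cast this
  have : ∫ s in (0:ℝ)..2 * π / 3, sin (s + π / 3) * E s =
      9 / (8 * π) * (2 * π / 3 - √3 / 2) -
        ∫ s in (0:ℝ)..2 * π / 3, sin (s + π / 3) * meanSinSq φ s := by
    rw [← integral_mul_sin_add, ← intervalIntegral.integral_const_mul,
      ← intervalIntegral.integral_sub (Continuous.intervalIntegrable (by fun_prop) _ _)
      (Continuous.intervalIntegrable (by fun_prop) _ _)]
    refine intervalIntegral.integral_congr fun s _ => ?_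
    simp only [hEdef]
    ring
  linarith

/-- **Hall's inequality** for the boundary function of a univalent harmonic map of the disk fixing
the origin. -/
theorem le_norm_fourierCoef_sq_add {φ : ℝ → ℝ} (hφ : Monotone φ)
    (hper : ∀ x, φ (x + 2 * π) = φ x + 2 * π)
    (h0 : fourierCoef (fun x => Complex.exp (φ x * Complex.I)) 0 = 0) :
    27 / (4 * π ^ 2) ≤ ‖fourierCoef (fun x => Complex.exp (φ x * Complex.I)) 1‖ ^ 2 +
      ‖fourierCoef (fun x => Complex.exp (φ x * Complex.I)) (-1)‖ ^ 2 := by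
  set c : ℤ → ℝ := fun n => ‖fourierCoef (fun x => Complex.exp (φ x * Complex.I)) n‖ ^ 2 with hc
  have hc0 : ∀ n, 0 ≤ c n := fun n => sq_nonneg _
  have hs1 : HasSum c 1 := hasSum_norm_fourierCoef_sq_one hφ
  have hsum : HasSum (fun n : ℤ => ∫ s in (0:ℝ)..2 * π / 3,
      sin (s + π / 3) * (c n * ((1 - cos (n * s)) / 2)))
      (∫ s in (0:ℝ)..2 * π / 3, sin (s + π / 3) * meanSinSq φ s) := by
    refine intervalIntegral.hasSum_integral_of_dominated_convergence (fun n _ => c n)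
      (fun n => Continuous.aestronglyMeasurable (by fun_prop)) (fun n => ?_) ?_ ?_ ?_
    · refine Eventually.of_forall fun s _ => ?_
      rw [norm_mul, norm_mul, norm_of_nonneg (hc0 n)]
      have h1 : ‖sin (s + π / 3)‖ ≤ 1 := abs_sin_le_one _
      have h2 : ‖(1 - cos (n * s)) / 2‖ ≤ 1 := by
        rw [norm_eq_abs, abs_le]
        constructor <;> linarith [cos_le_one (n * s), neg_one_le_cos (n * s)]
      calc _ ≤ 1 * (c n * 1) := by have := hc0 n; gcongr
        _ = c n := by ring
    · exact Eventually.of_forall fun s _ => hs1.summable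
    · simp
    · exact Eventually.of_forall fun s _ => (hasSum_meanSinSq hφ hper s).mul_left _
  have hterm : ∀ n : ℤ, ∫ s in (0:ℝ)..2 * π / 3, sin (s + π / 3) * (c n * ((1 - cos (n * s)) / 2))
      = c n * (3 / 4 - (∫ s in (0:ℝ)..2 * π / 3, sin (s + π / 3) * cos (n * s)) / 2) := by
    intro n
    have : ∀ s : ℝ, sin (s + π / 3) * (c n * ((1 - cos (n * s)) / 2)) =
        c n / 2 * (sin (s + π / 3) - sin (s + π / 3) * cos (n * s)) := fun s => by ring
    rw [intervalIntegral.integral_congr fun s _ => this s, intervalIntegral.integral_const_mul,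
      intervalIntegral.integral_sub (Continuous.intervalIntegrable (by fun_prop) _ _)
      (Continuous.intervalIntegrable (by fun_prop) _ _), integral_sin_add]
    ring
  simp only [hterm] at hsum
  have hlow : HasSum (fun n : ℤ => c n * (3 / 4) -
      ∑ m ∈ ({1, -1} : Finset ℤ), Pi.single m (c m * (π / (4 * √3))) n)
      (1 * (3 / 4) - ∑ m ∈ ({1, -1} : Finset ℤ), c m * (π / (4 * √3))) :=
    (hs1.mul_right _).sub (hasSum_sum fun m _ => hasSum_pi_single m _)
  have hle := hasSum_le (fun n => ?_) hlow hsum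
  · have hup := integral_sin_add_mul_meanSinSq_le hφ hper
    rw [Finset.sum_pair (by norm_num)] at hle
    change 27 / (4 * π ^ 2) ≤ c 1 + c (-1)
    have h3 : √3 * √3 = 3 := mul_self_sqrt (by norm_num)
    have hs3 : 0 < √3 := by positivity
    have h := hle.trans hup
    have e : 9 / (8 * π) * (2 * π / 3 - √3 / 2) = 3 / 4 - 27 / (4 * π ^ 2) * (π / (4 * √3)) := by
      field_simp
      linear_combination (-432) * h3
    rw [e, ← add_mul] at h
    have hpos : 0 < π / (4 * √3) := by positivity
    refine le_of_mul_le_mul_right ?_ hpos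
    linarith
  · rw [Finset.sum_pair (by norm_num), Pi.single_apply, Pi.single_apply]
    have hI : π / (2 * √3) / 2 = π / (4 * √3) := by field_simp; norm_num
    by_cases h1 : n = 1
    · subst h1
      simp [integral_sin_add_mul_cos, hI, mul_sub]
    by_cases h2 : n = -1
    · subst h2
      simp [integral_sin_add_mul_cos, hI, mul_sub]
    by_cases h3 : n = 0
    · subst h3
      simp [hc, h0]
    · simp only [h1, h2, if_false]
      have := integral_sin_add_mul_cos_nonpos h3 h1 h2
      have := hc0 n
      nlinarith

theorem exists_monotone_extension_of_periodic {D : Set ℝ} {p : ℝ} (hp : 0 < p) (hne : D.Nonempty)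
    (hD : ∀ x, x + p ∈ D ↔ x ∈ D) {ψ : ℝ → ℝ} (hψ : MonotoneOn ψ D)
    (hper : ∀ x ∈ D, ψ (x + p) = ψ x + p) :
    ∃ φ : ℝ → ℝ, Monotone φ ∧ (∀ x, φ (x + p) = φ x + p) ∧ EqOn φ ψ D := by
  have hn : ∀ x ∈ D, ∀ n : ℕ, x + n * p ∈ D ∧ x - n * p ∈ D := by
    intro x hx n
    induction n with
    | zero => simpa using hx
    | succ n ih =>
      refine ⟨?_, ?_⟩
      · rw [show x + ((n + 1 : ℕ) : ℝ) * p = x + n * p + p by push_cast; ring, hD]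
        exact ih.1
      · rw [← hD, show x - ((n + 1 : ℕ) : ℝ) * p + p = x - n * p by push_cast; ring]
        exact ih.2
  obtain ⟨d, hd⟩ := hne
  have hbelow : ∀ x, (ψ '' (D ∩ Iic x)).Nonempty := by
    intro x
    obtain ⟨n, hn'⟩ := exists_nat_gt ((d - x) / p)
    rw [div_lt_iff₀ hp] at hn'
    exact ⟨_, d - n * p, ⟨(hn d hd n).2, by simp only [mem_Iic]; linarith⟩, rfl⟩
  have habove : ∀ x, BddAbove (ψ '' (D ∩ Iic x)) := by
    intro x
    obtain ⟨n, hn'⟩ := exists_nat_gt ((x - d) / p)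
    rw [div_lt_iff₀ hp] at hn'
    refine ⟨ψ (d + n * p), ?_⟩
    rintro _ ⟨y, ⟨hy, hyx⟩, rfl⟩
    simp only [mem_Iic] at hyx
    exact hψ hy (hn d hd n).1 (by linarith)
  refine ⟨fun x => sSup (ψ '' (D ∩ Iic x)), fun x y hxy => ?_, fun x => ?_, fun x hx => ?_⟩
  · exact csSup_le_csSup (habove y) (hbelow x)
      (image_mono (inter_subset_inter_right _ (Iic_subset_Iic.2 hxy)))
  · have hset : ψ '' (D ∩ Iic (x + p)) = (fun y => y + p) '' (ψ '' (D ∩ Iic x)) := by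
      ext z
      constructor
      · rintro ⟨y, ⟨hy, hyx⟩, rfl⟩
        simp only [mem_Iic] at hyx
        have hy' : y - p ∈ D := by rw [← hD]; simpa using hy
        refine ⟨_, ⟨y - p, ⟨hy', by simp only [mem_Iic]; linarith⟩, rfl⟩, ?_⟩
        simp only
        rw [← hper _ hy', sub_add_cancel]
      · rintro ⟨_, ⟨y, ⟨hy, hyx⟩, rfl⟩, rfl⟩
        simp only [mem_Iic] at hyx
        exact ⟨y + p, ⟨(hD y).2 hy, by simp only [mem_Iic]; linarith⟩, hper y hy⟩
    simp only [hset]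
    exact ((OrderIso.addRight p).map_csSup' (hbelow x) (habove x)).symm
  · refine le_antisymm (csSup_le (hbelow x) ?_) (le_csSup (habove x) ⟨x, ⟨hx, le_refl x⟩, rfl⟩)
    rintro _ ⟨y, ⟨hy, hyx⟩, rfl⟩
    exact hψ hy hx hyx

/-- The cut-off angular form `b(|H|²) d arg H` of the harmonic map `H = g + conj k`, encoded as a
complex function: its real and imaginary parts are the `du` and minus the `dv` coefficients. -/
noncomputable def angularForm (b : ℝ → ℝ) (g k : ℂ → ℂ) (z : ℂ) : ℂ :=
  -Complex.I * (b (‖g z + conj (k z)‖ ^ 2) : ℂ) *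
    (deriv g z / (g z + conj (k z)) - deriv k z / conj (g z + conj (k z)))

theorem contDiffOn_angularForm {b : ℝ → ℝ} (hb : ContDiff ℝ 1 b) {g k : ℂ → ℂ} {U : Set ℂ}
    (hU : IsOpen U) (hg : DifferentiableOn ℂ g U) (hk : DifferentiableOn ℂ k U)
    (hH : ∀ z ∈ U, g z + conj (k z) ≠ 0) : ContDiffOn ℝ 1 (angularForm b g k) U := by
  have key : ∀ {f : ℂ → ℂ}, DifferentiableOn ℂ f U → ContDiffOn ℝ 1 f U := fun hf =>
    (hf.contDiffOn hU).restrict_scalars ℝ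
  have hconj : ∀ {f : ℂ → ℂ}, ContDiffOn ℝ 1 f U → ContDiffOn ℝ 1 (fun z => conj (f z)) U :=
    fun hf => Complex.conjCLE.contDiff.comp_contDiffOn hf
  have hHd : ContDiffOn ℝ 1 (fun z => g z + conj (k z)) U := (key hg).add (hconj (key hk))
  have hb' : ContDiffOn ℝ 1 (fun z => (b (‖g z + conj (k z)‖ ^ 2) : ℂ)) U :=
    Complex.ofRealCLM.contDiff.comp_contDiffOn (hb.comp_contDiffOn (hHd.norm_sq ℝ))
  have e : angularForm b g k = fun z => -Complex.I * (b (‖g z + conj (k z)‖ ^ 2) : ℂ) *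
      (deriv g z * (g z + conj (k z))⁻¹ - deriv k z * (conj (g z + conj (k z)))⁻¹) := by
    funext z
    simp only [angularForm, div_eq_mul_inv]
  rw [e]
  exact (contDiffOn_const.mul hb').mul (((key (hg.deriv hU)).mul (hHd.inv hH)).sub
    ((key (hk.deriv hU)).mul ((hconj hHd).inv fun z hz => (map_ne_zero _).2 (hH z hz))))

theorem hasDerivAt_angularForm_line {b : ℝ → ℝ} (hb : Differentiable ℝ b) {g k : ℂ → ℂ} {U : Set ℂ}
    (hU : IsOpen U) (hg : DifferentiableOn ℂ g U) (hk : DifferentiableOn ℂ k U)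
    {z : ℂ} (hz : z ∈ U) (hH : g z + conj (k z) ≠ 0) (v : ℂ) :
    HasDerivAt (fun s : ℝ => angularForm b g k (z + s * v))
      (-Complex.I * ((deriv b (‖g z + conj (k z)‖ ^ 2) *
          (2 * ((deriv g z * v + conj (deriv k z * v)) * conj (g z + conj (k z))).re) : ℝ) : ℂ) *
          (deriv g z / (g z + conj (k z)) - deriv k z / conj (g z + conj (k z))) +
        -Complex.I * (b (‖g z + conj (k z)‖ ^ 2) : ℂ) *
          ((deriv (deriv g) z * v * (g z + conj (k z)) -
              deriv g z * (deriv g z * v + conj (deriv k z * v))) / (g z + conj (k z)) ^ 2 -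
            (deriv (deriv k) z * v * conj (g z + conj (k z)) -
              deriv k z * conj (deriv g z * v + conj (deriv k z * v))) /
                conj (g z + conj (k z)) ^ 2)) 0 := by
  have hline : HasDerivAt (fun s : ℝ => z + s * v) v 0 := by
    simpa using ((Complex.ofRealCLM.hasDerivAt (x := (0:ℝ))).mul_const v).const_add z
  have hcomp : ∀ {f : ℂ → ℂ}, DifferentiableOn ℂ f U →
      HasDerivAt (fun s : ℝ => f (z + s * v)) (deriv f z * v) 0 := by
    intro f hf
    have h1 : HasDerivAt f (deriv f z) (z + ((0 : ℝ) : ℂ) * v) := by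
      simpa using (hf.differentiableAt (hU.mem_nhds hz)).hasDerivAt
    exact h1.comp (0 : ℝ) hline
  have hHd : HasDerivAt (fun s : ℝ => g (z + s * v) + conj (k (z + s * v)))
      (deriv g z * v + conj (deriv k z * v)) 0 := (hcomp hg).add (hcomp hk).star
  have hN := hHd.norm_sq
  rw [Complex.inner] at hN
  have hB := ((hb _).hasDerivAt.comp (0 : ℝ) hN).ofReal_comp
  have hGd := hcomp (hg.deriv hU)
  have hKd := hcomp (hk.deriv hU)
  have hz0 : z + ((0 : ℝ) : ℂ) * v = z := by simp
  have := ((hB.const_mul (-Complex.I)).mul ((hGd.div hHd (by simpa using hH)).sub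
    (hKd.div hHd.star (by
      rw [star_ne_zero]; simpa using hH))))
  refine HasDerivAt.congr_deriv (f := fun s : ℝ => angularForm b g k (z + s * v)) this ?_
  simp only [Pi.sub_apply, Pi.div_apply, Function.comp, hz0]
  rfl

theorem re_angularForm_curl {b : ℝ → ℝ} (hb : Differentiable ℝ b) (hb' : ∀ x, 0 ≤ deriv b x)
    {g k : ℂ → ℂ} {U : Set ℂ}
    (hU : IsOpen U) (hg : DifferentiableOn ℂ g U) (hk : DifferentiableOn ℂ k U)
    {z : ℂ} (hz : z ∈ U) (hH : g z + conj (k z) ≠ 0) (hd : ‖deriv k z‖ ≤ ‖deriv g z‖)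
    (hf : DifferentiableAt ℝ (angularForm b g k) z) :
    0 ≤ (Complex.I • fderiv ℝ (angularForm b g k) z 1 -
      fderiv ℝ (angularForm b g k) z Complex.I).re := by
  have key : ∀ v, fderiv ℝ (angularForm b g k) z v = _ := fun v => by
    have hline : HasDerivAt (fun s : ℝ => z + s * v) v 0 := by
      simpa using ((Complex.ofRealCLM.hasDerivAt (x := (0:ℝ))).mul_const v).const_add z
    have hfd : HasFDerivAt (angularForm b g k) (fderiv ℝ (angularForm b g k) z)
        (z + ((0 : ℝ) : ℂ) * v) := by simpa using hf.hasFDerivAt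
    have hfl : HasDerivAt (fun s : ℝ => angularForm b g k (z + s * v))
        (fderiv ℝ (angularForm b g k) z v) 0 :=
      HasFDerivAt.comp_hasDerivAt (f := fun s : ℝ => z + s * v) (0 : ℝ) hfd hline
    exact hfl.unique (hasDerivAt_angularForm_line hb hU hg hk hz hH v)
  rw [key 1, key Complex.I]
  set H := g z + conj (k z) with hHdef
  set G := deriv g z
  set K := deriv k z
  set G' := deriv (deriv g) z
  set K' := deriv (deriv k) z
  set β := b (‖H‖ ^ 2)
  have hβ := hb' (‖H‖ ^ 2)
  set β' := deriv b (‖H‖ ^ 2)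
  have hHc : conj H ≠ 0 := by simpa using hH
  have hre : ∀ w : ℂ, ((2 * w.re : ℝ) : ℂ) = w + conj w := fun w => by
    rw [Complex.add_conj]
  have e : Complex.I • (-Complex.I * ((β' * (2 * ((G * 1 + conj (K * 1)) * conj H).re) : ℝ) : ℂ) *
        (G / H - K / conj H) + -Complex.I * (β : ℂ) *
        ((G' * 1 * H - G * (G * 1 + conj (K * 1))) / H ^ 2 -
          (K' * 1 * conj H - K * conj (G * 1 + conj (K * 1))) / conj H ^ 2)) -
      (-Complex.I * ((β' * (2 * ((G * Complex.I + conj (K * Complex.I)) * conj H).re) : ℝ) : ℂ) *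
        (G / H - K / conj H) + -Complex.I * (β : ℂ) *
        ((G' * Complex.I * H - G * (G * Complex.I + conj (K * Complex.I))) / H ^ 2 -
          (K' * Complex.I * conj H - K * conj (G * Complex.I + conj (K * Complex.I))) /
            conj H ^ 2)) =
      ((2 * β' * (‖G‖ ^ 2 - ‖K‖ ^ 2) : ℝ) : ℂ) +
        ((2 * β' * (G * conj K * conj H / H) - 2 * β * (G * conj K / H ^ 2)) -
          conj (2 * β' * (G * conj K * conj H / H) - 2 * β * (G * conj K / H ^ 2))) := by
    rw [Complex.ofReal_mul, Complex.ofReal_mul β' (2 * _), hre, hre]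
    push_cast
    rw [← Complex.conj_mul', ← Complex.conj_mul']
    simp only [mul_one, map_neg, map_mul, map_add, map_sub, map_div₀, map_pow, Complex.conj_conj, Complex.conj_I,
      Complex.conj_ofReal, map_ofNat, smul_eq_mul]
    field_simp
    ring_nf
    simp only [Complex.I_sq]
    ring
  rw [e, Complex.add_re, Complex.sub_re, Complex.conj_re, sub_self, add_zero, Complex.ofReal_re]
  have : ‖K‖ ^ 2 ≤ ‖G‖ ^ 2 := by gcongr
  exact mul_nonneg (by positivity) (by linarith)

theorem neg_le_integral_angle {g k : ℂ → ℂ}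
    (hg : DifferentiableOn ℂ g {z | z.re < 0}) (hk : DifferentiableOn ℂ k {z | z.re < 0})
    (hH : ∀ z : ℂ, z.re < 0 → g z + conj (k z) ≠ 0)
    (hd : ∀ z : ℂ, z.re < 0 → ‖deriv k z‖ ≤ ‖deriv g z‖)
    {t₀ t₂ x y m M : ℝ} (ht : t₀ ≤ t₂) (ht2 : t₂ < 0) (hxy : x ≤ y) (hm : 0 ≤ m) (hmM : m < M)
    (hlow : ∀ z : ℂ, z.re = t₀ → ‖g z + conj (k z)‖ ≤ m)
    (hup : ∀ z : ℂ, z.re = t₂ → M ≤ ‖g z + conj (k z)‖)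
    (hone : ∀ z : ℂ, z.re < 0 → t₀ ≤ z.re → 1 ≤ ‖g z + conj (k z)‖) :
    -(∫ t in t₀..t₂, 2 * ‖deriv g (t + x * Complex.I)‖) -
        (∫ t in t₀..t₂, 2 * ‖deriv g (t + y * Complex.I)‖) ≤
      ∫ θ in x..y, (deriv g (t₂ + θ * Complex.I) /
          (g (t₂ + θ * Complex.I) + conj (k (t₂ + θ * Complex.I))) -
        deriv k (t₂ + θ * Complex.I) /
          conj (g (t₂ + θ * Complex.I) + conj (k (t₂ + θ * Complex.I)))).re := by
  have hU : IsOpen {z : ℂ | z.re < 0} := isOpen_lt Complex.continuous_re continuous_const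
  have hMm : 0 < M ^ 2 - m ^ 2 := by nlinarith
  set b : ℝ → ℝ := fun s => smoothTransition ((s - m ^ 2) / (M ^ 2 - m ^ 2)) with hb
  have hbs : ContDiff ℝ 1 b :=
    smoothTransition.contDiff.comp ((contDiff_id.sub contDiff_const).div_const _)
  have hbm : Monotone b := fun s s' h => smoothTransition.monotone (by gcongr)
  have hb0 : ∀ s ≤ m ^ 2, b s = 0 := fun s hs =>
    smoothTransition.zero_of_nonpos (div_nonpos_of_nonpos_of_nonneg (by linarith) hMm.le)
  have hb1 : ∀ s, M ^ 2 ≤ s → b s = 1 := fun s hs =>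
    smoothTransition.one_of_one_le ((one_le_div hMm).2 (by linarith))
  set f := angularForm b g k with hf
  have hfc : ContDiffOn ℝ 1 f {z | z.re < 0} := contDiffOn_angularForm hbs hU hg hk hH
  have hfb : ∀ z : ℂ, z.re < 0 → t₀ ≤ z.re → ‖f z‖ ≤ 2 * ‖deriv g z‖ := by
    intro z hz hz0
    have h1 := hone z hz hz0
    have h2 := hd z hz
    rw [hf, angularForm, norm_mul, norm_mul, norm_neg, Complex.norm_I, one_mul]
    have e1 : ‖(b (‖g z + conj (k z)‖ ^ 2) : ℂ)‖ ≤ 1 := by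
      rw [Complex.norm_real, norm_of_nonneg (smoothTransition.nonneg _)]
      exact smoothTransition.le_one _
    have e2 : ‖deriv g z / (g z + conj (k z)) - deriv k z / conj (g z + conj (k z))‖ ≤
        2 * ‖deriv g z‖ := by
      refine (norm_sub_le _ _).trans ?_
      rw [norm_div, norm_div, Complex.norm_conj]
      have a1 := div_le_self (norm_nonneg (deriv g z)) h1
      have a2 := div_le_self (norm_nonneg (deriv k z)) h1
      linarith
    calc _ ≤ 1 * (2 * ‖deriv g z‖) := by gcongr
      _ = _ := one_mul _
  set p : ℂ := t₀ + x * Complex.I with hp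
  set q : ℂ := t₂ + y * Complex.I with hq
  have hpre : p.re = t₀ := by simp [hp]
  have hpim : p.im = x := by simp [hp]
  have hqre : q.re = t₂ := by simp [hq]
  have hqim : q.im = y := by simp [hq]
  have hrect : uIcc p.re q.re ×ℂ uIcc p.im q.im ⊆ {z | z.re < 0} := by
    intro z hz
    rw [Complex.mem_reProdIm, hpre, hqre, uIcc_of_le ht] at hz
    exact lt_of_le_of_lt hz.1.2 ht2
  have hfd : ContinuousOn (fun z => Complex.I • fderiv ℝ f z 1 - fderiv ℝ f z Complex.I)
      {z | z.re < 0} := by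
    have := hfc.continuousOn_fderiv_of_isOpen hU le_rfl
    have h1 : ContinuousOn (fun z => fderiv ℝ f z 1) {z | z.re < 0} :=
      this.clm_apply continuousOn_const
    have h2 : ContinuousOn (fun z => fderiv ℝ f z Complex.I) {z | z.re < 0} :=
      this.clm_apply continuousOn_const
    exact (h1.const_smul Complex.I).sub h2
  have hst := Complex.integral_boundary_rect_of_differentiableOn_real f p q
    ((hfc.differentiableOn one_ne_zero).mono hrect)
    ((hfd.mono hrect).integrableOn_compact (isCompact_uIcc.reProdIm isCompact_uIcc))
  rw [hpre, hpim, hqre, hqim] at hst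
  have hz : ∀ y : ℝ, f (t₀ + y * Complex.I) = 0 := by
    intro y
    rw [hf, angularForm, hb0]
    · simp
    · have := hlow (t₀ + y * Complex.I) (by simp)
      gcongr
  simp only [hz, intervalIntegral.integral_zero, smul_zero, sub_zero] at hst
  have hglinec : ∀ y : ℝ, ContinuousOn (fun t : ℝ => 2 * ‖deriv g (t + y * Complex.I)‖)
      (uIcc t₀ t₂) := by
    intro y
    refine continuousOn_const.mul
      (((hg.deriv hU).continuousOn.comp (by fun_prop) fun t ht' => ?_).norm)
    rw [uIcc_of_le ht] at ht'
    simpa using lt_of_le_of_lt ht'.2 ht2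
  have hbound : ∀ y : ℝ, |(∫ t in t₀..t₂, f (t + y * Complex.I)).re| ≤
      ∫ t in t₀..t₂, 2 * ‖deriv g (t + y * Complex.I)‖ := by
    intro y
    refine (Complex.abs_re_le_norm _).trans ?_
    refine intervalIntegral.norm_integral_le_of_norm_le ht (ae_of_all _ fun t ht' => ?_)
      (hglinec y).intervalIntegrable
    exact hfb _ (by simpa using lt_of_le_of_lt ht'.2 ht2) (by simpa using ht'.1.le)
  have hdd : 0 ≤ (∫ t in t₀..t₂, ∫ θ in x..y, Complex.I • fderiv ℝ f (t + θ * Complex.I) 1 -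
      fderiv ℝ f (t + θ * Complex.I) Complex.I).re := by
    have hre : ∀ {F : ℝ → ℂ} {a b : ℝ}, a ≤ b → (∀ s ∈ Ioc a b, 0 ≤ (F s).re) →
        0 ≤ (∫ s in a..b, F s).re := by
      intro F a b hab hF
      by_cases hi : IntervalIntegrable F volume a b
      · have := Complex.reCLM.intervalIntegral_comp_comm hi
        simp only [Complex.reCLM_apply] at this
        rw [← this, intervalIntegral.integral_of_le hab]
        exact setIntegral_nonneg measurableSet_Ioc hF
      · rw [intervalIntegral.integral_undef hi]; simp
    refine hre ht fun t ht' => hre hxy fun θ hθ => ?_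
    have hzU : ((t : ℂ) + θ * Complex.I).re < 0 := by simpa using lt_of_le_of_lt ht'.2 ht2
    exact re_angularForm_curl (hbs.differentiable one_ne_zero) (fun s => hbm.deriv_nonneg) hU hg hk
      hzU (hH _ hzU) (hd _ hzU)
      ((hfc.differentiableOn one_ne_zero).differentiableAt (hU.mem_nhds hzU))
  rw [← hst, Complex.add_re, Complex.sub_re] at hdd
  have htop : (Complex.I • ∫ θ in x..y, f (t₂ + θ * Complex.I)).re =
      ∫ θ in x..y, (deriv g (t₂ + θ * Complex.I) /
          (g (t₂ + θ * Complex.I) + conj (k (t₂ + θ * Complex.I))) -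
        deriv k (t₂ + θ * Complex.I) /
          conj (g (t₂ + θ * Complex.I) + conj (k (t₂ + θ * Complex.I)))).re := by
    rw [← intervalIntegral.integral_smul]
    have hi : IntervalIntegrable (fun θ : ℝ => Complex.I • f (t₂ + θ * Complex.I)) volume x y := by
      refine ContinuousOn.intervalIntegrable ?_
      refine ContinuousOn.const_smul (g := fun θ : ℝ => f (t₂ + θ * Complex.I)) ?_ Complex.I
      refine hfc.continuousOn.comp (by fun_prop) fun θ _ => ?_
      simpa using ht2
    have := Complex.reCLM.intervalIntegral_comp_comm hi
    simp only [Complex.reCLM_apply] at this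
    rw [← this]
    refine intervalIntegral.integral_congr fun θ _ => ?_
    simp only [smul_eq_mul, hf, angularForm]
    have hMup := hup (t₂ + θ * Complex.I) (by simp)
    rw [hb1 _ (pow_le_pow_left₀ (hm.trans hmM.le) hMup 2), Complex.ofReal_one, mul_one, ← mul_assoc, mul_neg, Complex.I_mul_I,
      neg_neg, one_mul]
  rw [htop] at hdd
  have h1 := abs_le.1 (hbound x)
  have h2 := abs_le.1 (hbound y)
  linarith [h1.2, h2.1]

/-- A continuous choice of the argument of `exp l + conj k`. -/
noncomputable def angleLift (l k : ℂ → ℂ) (z : ℂ) : ℝ :=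
  (l z + Complex.log (1 + conj (k z) / Complex.exp (l z))).im

theorem norm_conj_div_exp_lt_one {l k : ℂ → ℂ} {z : ℂ} (hlt : ‖k z‖ < ‖Complex.exp (l z)‖) :
    ‖conj (k z) / Complex.exp (l z)‖ < 1 := by
  rw [norm_div, Complex.norm_conj]
  exact (div_lt_one ((norm_nonneg _).trans_lt hlt)).2 hlt

theorem exp_add_conj_ne_zero {l k : ℂ → ℂ} {z : ℂ} (hlt : ‖k z‖ < ‖Complex.exp (l z)‖) :
    Complex.exp (l z) + conj (k z) ≠ 0 := by
  intro h
  have := congrArg norm (eq_neg_of_add_eq_zero_left h)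
  rw [norm_neg, Complex.norm_conj] at this
  linarith

theorem norm_mul_exp_angleLift {l k : ℂ → ℂ} {z : ℂ} (hlt : ‖k z‖ < ‖Complex.exp (l z)‖) :
    ‖Complex.exp (l z) + conj (k z)‖ * Complex.exp (angleLift l k z * Complex.I) =
      Complex.exp (l z) + conj (k z) := by
  have hw := Complex.slitPlane_ne_zero
    (Complex.mem_slitPlane_of_norm_lt_one (norm_conj_div_exp_lt_one hlt))
  have hE : Complex.exp (l z + Complex.log (1 + conj (k z) / Complex.exp (l z))) =
      Complex.exp (l z) + conj (k z) := by
    rw [Complex.exp_add, Complex.exp_log hw, mul_add, mul_one,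
      mul_div_cancel₀ _ (Complex.exp_ne_zero _)]
  rw [← hE, Complex.norm_exp, angleLift, Complex.ofReal_exp, ← Complex.exp_add, Complex.re_add_im]

theorem hasDerivAt_angleLift {l k : ℂ → ℂ} {U : Set ℂ} (hU : IsOpen U)
    (hl : DifferentiableOn ℂ l U) (hk : DifferentiableOn ℂ k U) {c v : ℂ} {s : ℝ}
    (hz : c + s * v ∈ U) (hlt : ‖k (c + s * v)‖ < ‖Complex.exp (l (c + s * v))‖) :
    HasDerivAt (fun s : ℝ => angleLift l k (c + s * v))
      ((deriv (fun z => Complex.exp (l z)) (c + s * v) * v + conj (deriv k (c + s * v) * v)) /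
        (Complex.exp (l (c + s * v)) + conj (k (c + s * v)))).im s := by
  have hline : HasDerivAt (fun s : ℝ => c + s * v) v s := by
    simpa using ((Complex.ofRealCLM.hasDerivAt (x := s)).mul_const v).const_add c
  have hcomp : ∀ {f : ℂ → ℂ}, DifferentiableOn ℂ f U →
      HasDerivAt (fun s : ℝ => f (c + s * v)) (deriv f (c + s * v) * v) s := by
    intro f hf
    exact ((hf.differentiableAt (hU.mem_nhds hz)).hasDerivAt).comp s hline
  have hexp : DifferentiableOn ℂ (fun z => Complex.exp (l z)) U := hl.cexp
  have hw := Complex.mem_slitPlane_of_norm_lt_one (norm_conj_div_exp_lt_one hlt)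
  have hE0 : Complex.exp (l (c + s * v)) ≠ 0 := Complex.exp_ne_zero _
  have hH := exp_add_conj_ne_zero hlt
  have hq : HasDerivAt (fun s : ℝ => conj (k (c + s * v)) / Complex.exp (l (c + s * v))) _ s :=
    (hcomp hk).star.div (hcomp hexp) hE0
  have hL := (hcomp hl).add ((hq.const_add 1).clog_real hw)
  have him := Complex.imCLM.hasFDerivAt.comp_hasDerivAt s hL
  refine HasDerivAt.congr_deriv (f := fun s : ℝ => angleLift l k (c + s * v)) him ?_
  rw [Complex.imCLM_apply]
  congr 1
  have hd : deriv (fun z => Complex.exp (l z)) (c + s * v) =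
      Complex.exp (l (c + s * v)) * deriv l (c + s * v) :=
    ((hl.differentiableAt (hU.mem_nhds hz)).hasDerivAt.cexp).deriv
  rw [hd]
  have hw0 := Complex.slitPlane_ne_zero hw
  simp only [starRingEnd_apply] at *
  set E := Complex.exp (l (c + s * v))
  set κ := star (k (c + s * v))
  have hw1 : 1 + κ / E = (E + κ) / E := by field_simp
  rw [hw1]
  field_simp
  ring

theorem norm_div_add_conj_le {G K H v : ℂ} (hv : ‖v‖ = 1) (hd : ‖K‖ ≤ ‖G‖) (hH : 1 ≤ ‖H‖) :
    ‖(G * v + conj (K * v)) / H‖ ≤ 2 * ‖G‖ := by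
  rw [norm_div]
  refine (div_le_self (norm_nonneg _) hH).trans ((norm_add_le _ _).trans ?_)
  rw [Complex.norm_conj, norm_mul, norm_mul, hv]
  linarith

theorem exists_tendsto_angleLift {l k : ℂ → ℂ}
    (hl : DifferentiableOn ℂ l {z | z.re < 0}) (hk : DifferentiableOn ℂ k {z | z.re < 0})
    (hlt : ∀ z : ℂ, z.re < 0 → ‖k z‖ < ‖Complex.exp (l z)‖)
    (hd : ∀ z : ℂ, z.re < 0 → ‖deriv k z‖ ≤ ‖deriv (fun z => Complex.exp (l z)) z‖)
    {τ : ℝ} (hτ : τ < 0)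
    (hone : ∀ z : ℂ, z.re < 0 → τ ≤ z.re → 1 ≤ ‖Complex.exp (l z) + conj (k z)‖) {θ : ℝ}
    (hθ : IntervalIntegrable (fun t : ℝ => deriv (fun z => Complex.exp (l z)) (t + θ * Complex.I))
      volume τ 0) :
    ∃ a : ℝ, Tendsto (fun t : ℝ => angleLift l k (t + θ * Complex.I)) (𝓝[<] 0) (𝓝 a) := by
  have hU : IsOpen {z : ℂ | z.re < 0} := isOpen_lt Complex.continuous_re continuous_const
  set g : ℂ → ℂ := fun z => Complex.exp (l z) with hg
  have hgd : DifferentiableOn ℂ g {z | z.re < 0} := hl.cexp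
  set d : ℝ → ℝ := fun t => ((deriv g (t + θ * Complex.I) * 1 +
    conj (deriv k (t + θ * Complex.I) * 1)) /
      (g (t + θ * Complex.I) + conj (k (t + θ * Complex.I)))).im with hddef
  have hder : ∀ t : ℝ, t < 0 →
      HasDerivAt (fun t : ℝ => angleLift l k (t + θ * Complex.I)) (d t) t := by
    intro t ht
    have hz : θ * Complex.I + (t : ℂ) * 1 ∈ {z : ℂ | z.re < 0} := by simpa using ht
    have h := hasDerivAt_angleLift hU hl hk hz (hlt _ hz)
    simp only [mul_one, add_comm (θ * Complex.I)] at h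
    simpa only [hddef, mul_one] using h
  have hmaps : MapsTo (fun t : ℝ => (t : ℂ) + θ * Complex.I) (Iio 0) {z | z.re < 0} := by
    intro t ht; simpa using ht
  have hline : Continuous (fun t : ℝ => (t : ℂ) + θ * Complex.I) := by fun_prop
  have hdc : ContinuousOn d (Iio 0) := by
    have c1 := (hgd.deriv hU).continuousOn.comp hline.continuousOn hmaps
    have c2 := (hk.deriv hU).continuousOn.comp hline.continuousOn hmaps
    have c3 := hgd.continuousOn.comp hline.continuousOn hmaps
    have c4 := hk.continuousOn.comp hline.continuousOn hmaps
    refine Complex.continuous_im.comp_continuousOn (ContinuousOn.div ?_ ?_ fun t ht => ?_)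
    · exact (c1.mul continuousOn_const).add
        (Complex.continuous_conj.comp_continuousOn (c2.mul continuousOn_const))
    · exact c3.add (Complex.continuous_conj.comp_continuousOn c4)
    · exact exp_add_conj_ne_zero (hlt _ (hmaps ht))
  have hdi : IntervalIntegrable d volume τ 0 := by
    rw [intervalIntegrable_iff_integrableOn_Ioo_of_le hτ.le] at hθ ⊢
    refine (hθ.norm.const_mul 2).mono' ((hdc.mono fun t ht => ht.2).aestronglyMeasurable
      measurableSet_Ioo) ?_
    refine (ae_restrict_iff' measurableSet_Ioo).2 (ae_of_all _ fun t ht => ?_)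
    have hz := hmaps ht.2
    exact (Complex.abs_im_le_norm _).trans (norm_div_add_conj_le (by simp) (hd _ hz)
      (hone _ hz (by simpa using ht.1.le)))
  have hprim := intervalIntegral.continuousOn_primitive_interval' hdi left_mem_uIcc
  have h0 : Tendsto (fun t => ∫ s in τ..t, d s) (𝓝[<] 0) (𝓝 (∫ s in τ..0, d s)) := by
    refine (hprim 0 right_mem_uIcc).mono_left ?_
    rw [uIcc_of_le hτ.le]
    have : 𝓝[<] (0:ℝ) = 𝓝[Ioo τ 0] 0 := (nhdsWithin_Ioo_eq_nhdsLT hτ).symm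
    rw [this]
    exact nhdsWithin_mono _ Ioo_subset_Icc_self
  refine ⟨angleLift l k (τ + θ * Complex.I) + ∫ s in τ..0, d s,
    (h0.const_add _).congr' ?_⟩
  filter_upwards [Ioo_mem_nhdsLT hτ] with t ht
  have hsub : ∀ s ∈ uIcc τ t, s < 0 := fun s hs => by
    rw [uIcc_of_le ht.1.le] at hs
    exact lt_of_le_of_lt hs.2 ht.2
  rw [intervalIntegral.integral_eq_sub_of_hasDerivAt (fun s hs => hder s (hsub s hs))
    ((hdc.mono hsub).intervalIntegrable)]
  ring

theorem tendsto_primitive_nhdsLT {d : ℝ → ℝ} {τ : ℝ} (hτ : τ < 0)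
    (hd : IntervalIntegrable d volume τ 0) :
    Tendsto (fun t => ∫ s in τ..t, d s) (𝓝[<] 0) (𝓝 (∫ s in τ..0, d s)) := by
  have hprim := intervalIntegral.continuousOn_primitive_interval' hd left_mem_uIcc
  refine (hprim 0 right_mem_uIcc).mono_left ?_
  rw [uIcc_of_le hτ.le, ← nhdsWithin_Ioo_eq_nhdsLT hτ]
  exact nhdsWithin_mono _ Ioo_subset_Icc_self

theorem im_mul_I_add_conj_div (G K H : ℂ) (hH : H ≠ 0) :
    ((G * Complex.I + conj (K * Complex.I)) / H).im = (G / H - K / conj H).re := by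
  have h : (K / conj H) = conj (conj K / H) := by simp
  rw [h, Complex.sub_re, Complex.conj_re, ← Complex.sub_re, ← sub_div, map_mul, Complex.conj_I]
  have : (G * Complex.I + conj K * -Complex.I) / H = Complex.I * ((G - conj K) / H) := by
    field_simp
    ring
  rw [this, Complex.I_mul_im]

theorem angleLift_limit_le {l k : ℂ → ℂ}
    (hl : DifferentiableOn ℂ l {z | z.re < 0}) (hk : DifferentiableOn ℂ k {z | z.re < 0})
    (hlt : ∀ z : ℂ, z.re < 0 → ‖k z‖ < ‖Complex.exp (l z)‖)
    (hd : ∀ z : ℂ, z.re < 0 → ‖deriv k z‖ ≤ ‖deriv (fun z => Complex.exp (l z)) z‖)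
    {τ R : ℝ} (hτ : τ < 0)
    (hone : ∀ z : ℂ, z.re < 0 → τ ≤ z.re → 1 ≤ ‖Complex.exp (l z) + conj (k z)‖)
    (hlow : ∀ s < 0, ∃ m < R, 0 ≤ m ∧
      ∀ z : ℂ, z.re = s → ‖Complex.exp (l z) + conj (k z)‖ ≤ m)
    (hup : ∀ M < R, ∀ᶠ t in 𝓝[<] (0 : ℝ),
      ∀ z : ℂ, z.re = t → M ≤ ‖Complex.exp (l z) + conj (k z)‖)
    {x y a b : ℝ} (hxy : x ≤ y)
    (hx : IntervalIntegrable (fun t : ℝ => deriv (fun z => Complex.exp (l z)) (t + x * Complex.I))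
      volume τ 0)
    (hy : IntervalIntegrable (fun t : ℝ => deriv (fun z => Complex.exp (l z)) (t + y * Complex.I))
      volume τ 0)
    (ha : Tendsto (fun t : ℝ => angleLift l k (t + x * Complex.I)) (𝓝[<] 0) (𝓝 a))
    (hb : Tendsto (fun t : ℝ => angleLift l k (t + y * Complex.I)) (𝓝[<] 0) (𝓝 b)) : a ≤ b := by
  have hU : IsOpen {z : ℂ | z.re < 0} := isOpen_lt Complex.continuous_re continuous_const
  set g : ℂ → ℂ := fun z => Complex.exp (l z) with hg
  have hgd : DifferentiableOn ℂ g {z | z.re < 0} := hl.cexp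
  have hH : ∀ z : ℂ, z.re < 0 → g z + conj (k z) ≠ 0 := fun z hz => exp_add_conj_ne_zero (hlt z hz)
  set N : ℝ → ℝ → ℝ := fun x t => 2 * ‖deriv g (t + x * Complex.I)‖ with hN
  have hxN : IntervalIntegrable (N x) volume τ 0 := hx.norm.const_mul 2
  have hyN : IntervalIntegrable (N y) volume τ 0 := hy.norm.const_mul 2
  have hsubI : ∀ {f : ℝ → ℝ} {s : ℝ}, IntervalIntegrable f volume τ 0 → s ∈ Ioo τ 0 →
      IntervalIntegrable f volume s 0 := fun hf hs => by
    refine hf.mono_set ?_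
    rw [uIcc_of_le hs.2.le, uIcc_of_le hτ.le]
    exact Icc_subset_Icc_left hs.1.le
  have key : ∀ s ∈ Ioo τ 0, -(∫ t in s..0, N x t) - (∫ t in s..0, N y t) ≤ b - a := by
    intro s hs
    obtain ⟨m, hmR, hm0, hm⟩ := hlow s hs.2
    obtain ⟨M, hmM, hMR⟩ := exists_between hmR
    refine le_of_tendsto_of_tendsto
      ((tendsto_primitive_nhdsLT hs.2 (hsubI hxN hs)).neg.sub
        (tendsto_primitive_nhdsLT hs.2 (hsubI hyN hs))) (hb.sub ha) ?_
    filter_upwards [hup M hMR, Ioo_mem_nhdsLT hs.2] with t hM ht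
    refine (neg_le_integral_angle hgd hk hH hd ht.1.le ht.2 hxy hm0 hmM hm hM
      fun z hz hz0 => hone z hz (hs.1.le.trans hz0)).trans_eq ?_
    have hmap : ∀ θ : ℝ, (t : ℂ) + θ * Complex.I ∈ {z : ℂ | z.re < 0} := fun θ => by
      simpa using ht.2
    have hder : ∀ θ : ℝ, HasDerivAt (fun θ : ℝ => angleLift l k (t + θ * Complex.I))
        (deriv g (t + θ * Complex.I) / (g (t + θ * Complex.I) + conj (k (t + θ * Complex.I))) -
        deriv k (t + θ * Complex.I) /
          conj (g (t + θ * Complex.I) + conj (k (t + θ * Complex.I)))).re θ := fun θ =>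
      (hasDerivAt_angleLift hU hl hk (hmap θ) (hlt _ (hmap θ))).congr_deriv
        (im_mul_I_add_conj_div _ _ _ (hH _ (hmap θ)))
    rw [intervalIntegral.integral_eq_sub_of_hasDerivAt (fun θ _ => hder θ)]
    refine Continuous.intervalIntegrable ?_ _ _
    have hline : Continuous (fun θ : ℝ => (t : ℂ) + θ * Complex.I) := by fun_prop
    have c1 := (hgd.deriv hU).continuousOn.comp_continuous hline hmap
    have c2 := (hk.deriv hU).continuousOn.comp_continuous hline hmap
    have c3 := (hgd.continuousOn.comp_continuous hline hmap).add
      (Complex.continuous_conj.comp (hk.continuousOn.comp_continuous hline hmap))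
    refine Complex.continuous_re.comp ((c1.div c3 fun θ => hH _ (hmap θ)).sub
      (c2.div (Complex.continuous_conj.comp c3) fun θ => ?_))
    exact (map_ne_zero _).2 (hH _ (hmap θ))
  have htail : ∀ {f : ℝ → ℝ}, IntervalIntegrable f volume τ 0 →
      Tendsto (fun s => ∫ t in s..0, f t) (𝓝[<] 0) (𝓝 0) := by
    intro f hf
    have h := (tendsto_const_nhds (x := ∫ t in τ..0, f t)).sub (tendsto_primitive_nhdsLT hτ hf)
    rw [sub_self] at h
    refine h.congr' ?_
    filter_upwards [Ioo_mem_nhdsLT hτ] with s hs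
    rw [intervalIntegral.integral_interval_sub_left hf]
    refine hf.mono_set ?_
    rw [uIcc_of_le hs.1.le, uIcc_of_le hτ.le]
    exact Icc_subset_Icc_right hs.2.le
  have hlim := (htail hxN).neg.sub (htail hyN)
  have := le_of_tendsto hlim (Filter.eventually_of_mem (Ioo_mem_nhdsLT hτ) key)
  linarith

theorem exists_log_on_ball {h : ℂ → ℂ} {r : ℝ} (hh : DifferentiableOn ℂ h (Metric.ball 0 r))
    (h0 : ∀ z ∈ Metric.ball (0 : ℂ) r, h z ≠ 0) :
    ∃ κ : ℂ → ℂ, DifferentiableOn ℂ κ (Metric.ball 0 r) ∧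
      ∀ z ∈ Metric.ball (0 : ℂ) r, h z = Complex.exp (κ z) := by
  have hq : DifferentiableOn ℂ (fun z => deriv h z / h z) (Metric.ball 0 r) :=
    (hh.deriv Metric.isOpen_ball).div hh h0
  obtain ⟨κ, hκ0, hκ⟩ := hq.isExactOn_ball.with_val_at 0 (Complex.log (h 0))
  have hκd : DifferentiableOn ℂ κ (Metric.ball 0 r) := fun z hz =>
    (hκ z hz).differentiableAt.differentiableWithinAt
  refine ⟨κ, hκd, fun z hz => ?_⟩
  have hr : 0 < r := (norm_nonneg z).trans_lt (mem_ball_zero_iff.1 hz)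
  have hder : ∀ z ∈ Metric.ball (0 : ℂ) r,
      HasDerivAt (fun z => h z * Complex.exp (-κ z)) 0 z := by
    intro z hz
    have h1 := (hh.differentiableAt (Metric.isOpen_ball.mem_nhds hz)).hasDerivAt
    refine (h1.mul (hκ z hz).neg.cexp).congr_deriv ?_
    have := h0 z hz
    field_simp
    ring
  have hconst := Metric.isOpen_ball.is_const_of_deriv_eq_zero
    (convex_ball (0 : ℂ) r).isPreconnected
    (fun z hz => (hder z hz).differentiableAt.differentiableWithinAt)
    (fun z hz => (hder z hz).deriv) hz (Metric.mem_ball_self hr)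
  simp only [hκ0] at hconst
  rw [Complex.exp_neg, Complex.exp_neg, Complex.exp_log (h0 0 (Metric.mem_ball_self hr)),
    mul_inv_cancel₀ (h0 0 (Metric.mem_ball_self hr))] at hconst
  have he := Complex.exp_ne_zero (κ z)
  field_simp at hconst
  exact hconst

theorem exists_eq_mul_exp {g : ℂ → ℂ} (hg : DifferentiableOn ℂ g (Metric.ball 0 1))
    (hinj : InjOn g (Metric.ball 0 1)) (g0 : g 0 = 0) (hd0 : deriv g 0 ≠ 0) :
    ∃ κ : ℂ → ℂ, DifferentiableOn ℂ κ (Metric.ball 0 1) ∧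
      ∀ z ∈ Metric.ball (0 : ℂ) 1, g z = z * Complex.exp (κ z) := by
  have h0 : (0 : ℂ) ∈ Metric.ball (0 : ℂ) 1 := Metric.mem_ball_self one_pos
  have hsl : ∀ z ≠ 0, g z = z * dslope g 0 z := fun z hz => by
    rw [dslope_of_ne _ hz, slope_def_field, g0]
    field_simp
    ring
  obtain ⟨κ, hκ, hκe⟩ := exists_log_on_ball
    ((Complex.differentiableOn_dslope (Metric.ball_mem_nhds 0 one_pos)).2 hg) fun z hz hs => by
      by_cases hz0 : z = 0
      · rw [hz0, dslope_same] at hs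
        exact hd0 hs
      · have := hsl z hz0
        rw [hs, mul_zero, ← g0] at this
        exact hz0 (hinj hz h0 this)
  refine ⟨κ, hκ, fun z hz => ?_⟩
  rw [← hκe z hz]
  by_cases hz0 : z = 0
  · simp [hz0, g0]
  · exact hsl z hz0

theorem abs_det_restrictScalars_smulRight (c : ℂ) :
    |((ContinuousLinearMap.toSpanSingleton ℂ c).restrictScalars ℝ).det| = ‖c‖ ^ 2 := by
  have : (((ContinuousLinearMap.toSpanSingleton ℂ c).restrictScalars ℝ : ℂ →L[ℝ] ℂ) : ℂ →ₗ[ℝ] ℂ) =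
      (LinearMap.toSpanSingleton ℂ ℂ c).restrictScalars ℝ := rfl
  rw [ContinuousLinearMap.det, this, LinearMap.det_restrictScalars, LinearMap.det_ring,
    Algebra.norm_complex_apply]
  simp [Complex.normSq_eq_norm_sq]

theorem integrableOn_norm_deriv_sq {G : ℂ → ℂ} {S : Set ℂ} (hS : IsOpen S)
    (hG : DifferentiableOn ℂ G S) (hinj : InjOn G S) (hb : Bornology.IsBounded (G '' S)) :
    IntegrableOn (fun z => ‖deriv G z‖ ^ 2) S := by
  have hc : ContinuousOn (fun z => ‖deriv G z‖ ^ 2) S :=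
    (hG.deriv hS).continuousOn.norm.pow 2
  refine ⟨hc.aestronglyMeasurable hS.measurableSet, ?_⟩
  have h := lintegral_abs_det_fderiv_eq_addHaar_image volume hS.measurableSet
    (f := G) (f' := fun z => (ContinuousLinearMap.toSpanSingleton ℂ (deriv G z)).restrictScalars ℝ)
    (fun z hz => (((hG.differentiableAt
      (hS.mem_nhds hz)).hasDerivAt.hasFDerivAt).restrictScalars ℝ).hasFDerivWithinAt) hinj
  simp only [abs_det_restrictScalars_smulRight] at h
  rw [hasFiniteIntegral_iff_ofReal (ae_of_all _ fun z => by positivity), h]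
  exact hb.measure_lt_top

theorem ae_intervalIntegrable_deriv {G : ℂ → ℂ} {τ p : ℝ} (hτ : τ < 0)
    (hG : DifferentiableOn ℂ G {z | z.re < 0})
    (hinj : InjOn G {z | z.re < 0 ∧ 0 < z.im ∧ z.im < p})
    (hb : Bornology.IsBounded (G '' {z | z.re < 0})) :
    ∀ᵐ θ : ℝ, θ ∈ Ioo 0 p →
      IntervalIntegrable (fun t : ℝ => deriv G (t + θ * Complex.I)) volume τ 0 := by
  have hU : IsOpen {z : ℂ | z.re < 0} := isOpen_lt Complex.continuous_re continuous_const
  set S : Set ℂ := Ioo τ 0 ×ℂ Ioo 0 p with hS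
  have hSo : IsOpen S := isOpen_Ioo.reProdIm isOpen_Ioo
  have hSU : S ⊆ {z | z.re < 0} := fun z hz => hz.1.2
  have hSV : S ⊆ {z | z.re < 0 ∧ 0 < z.im ∧ z.im < p} := fun z hz => ⟨hz.1.2, hz.2.1, hz.2.2⟩
  have h := integrableOn_norm_deriv_sq hSo (hG.mono hSU) (hinj.mono hSV) (hb.subset (image_mono hSU))
  have hmp := Complex.volume_preserving_equiv_real_prod.symm
  have h2 := (hmp.integrableOn_comp_preimage
    Complex.measurableEquivRealProd.symm.measurableEmbedding).2 h
  have hpre : Complex.measurableEquivRealProd.symm ⁻¹' S = Ioo τ 0 ×ˢ Ioo 0 p := by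
    ext ⟨a, b⟩
    simp [hS, Complex.mem_reProdIm, Complex.measurableEquivRealProd_symm_apply]
  rw [hpre, IntegrableOn, Measure.volume_eq_prod, ← Measure.prod_restrict] at h2
  have h3 := h2.prod_left_ae
  rw [ae_restrict_iff' measurableSet_Ioo] at h3
  filter_upwards [h3] with θ hθ hθ'
  rw [intervalIntegrable_iff_integrableOn_Ioo_of_le hτ.le]
  have hline : Continuous (fun t : ℝ => (t : ℂ) + θ * Complex.I) := by fun_prop
  have hmeas : ContinuousOn (fun t : ℝ => deriv G (t + θ * Complex.I)) (Ioo τ 0) :=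
    (hG.deriv hU).continuousOn.comp hline.continuousOn fun t ht => by simpa using ht.2
  refine Integrable.mono' ((hθ hθ').add (integrable_const 1))
    (hmeas.aestronglyMeasurable measurableSet_Ioo) (ae_of_all _ fun t => ?_)
  have e : Complex.measurableEquivRealProd.symm (t, θ) = t + θ * Complex.I := by
    apply Complex.ext <;> simp [Complex.measurableEquivRealProd_symm_apply]
  simp only [Function.comp_apply, e, Pi.add_apply]
  nlinarith [sq_nonneg (‖deriv G (t + θ * Complex.I)‖ - 1), norm_nonneg (deriv G (t + θ * Complex.I))]

theorem fourierCoef_conj (u : ℝ → ℂ) (n : ℤ) :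
    fourierCoef (fun x => conj (u x)) n = conj (fourierCoef u (-n)) := by
  rw [fourierCoef, fourierCoef, map_mul, ← intervalIntegral.intervalIntegral_conj]
  congr 1
  · simp [Complex.conj_ofNat]
  · refine intervalIntegral.integral_congr fun x _ => ?_
    simp only [map_mul, ← Complex.exp_conj]
    congr 2
    simp

theorem fourierCoef_add {u v : ℝ → ℂ} (hu : Continuous u) (hv : Continuous v) (n : ℤ) :
    fourierCoef (fun x => u x + v x) n = fourierCoef u n + fourierCoef v n := by
  simp only [fourierCoef, mul_add]
  rw [intervalIntegral.integral_add, mul_add]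
  · exact (by fun_prop : Continuous _).intervalIntegrable _ _
  · exact (by fun_prop : Continuous _).intervalIntegrable _ _

theorem fourierCoef_circleMap (g : ℂ → ℂ) {r : ℝ} (hr : 0 < r) (n : ℤ) :
    fourierCoef (fun θ => g (circleMap 0 r θ)) n =
      (2 * π * Complex.I : ℂ)⁻¹ * ((r : ℂ) ^ n * ∮ z in C(0, r), z ^ (-(n + 1)) * g z) := by
  have hr' : (r : ℂ) ≠ 0 := by exact_mod_cast hr.ne'
  suffices key : ∫ θ in (0 : ℝ)..2 * π, Complex.exp (-(n * θ * Complex.I)) * g (circleMap 0 r θ) =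
      ∫ θ in (0 : ℝ)..2 * π, Complex.I⁻¹ * ((r : ℂ) ^ n * (deriv (circleMap 0 r) θ •
        (circleMap 0 r θ ^ (-(n + 1)) * g (circleMap 0 r θ)))) by
    rw [fourierCoef, circleIntegral, key, intervalIntegral.integral_const_mul,
      intervalIntegral.integral_const_mul, mul_inv _ Complex.I, mul_assoc _ Complex.I⁻¹]
  refine intervalIntegral.integral_congr fun θ _ => ?_
  have hc : circleMap 0 r θ ≠ 0 := circleMap_ne_center hr.ne'
  have hz : circleMap 0 r θ ^ (-(n + 1)) =
      (r : ℂ) ^ (-n) * Complex.exp (-(n * θ * Complex.I)) * (circleMap 0 r θ)⁻¹ := by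
    rw [neg_add, zpow_add₀ hc, zpow_neg_one, circleMap_zero, mul_zpow, ← Complex.exp_int_mul]
    congr 3
    push_cast
    ring
  simp only [deriv_circleMap, smul_eq_mul, hz]
  have hrn : (r : ℂ) ^ n * (r : ℂ) ^ (-n) = 1 := by
    rw [← zpow_add₀ hr', add_neg_cancel, zpow_zero]
  have hcc := mul_inv_cancel₀ hc
  have hII := inv_mul_cancel₀ Complex.I_ne_zero
  linear_combination (-Complex.exp (-(n * θ * Complex.I)) * g (circleMap 0 r θ)) *
    (Complex.I⁻¹ * Complex.I * circleMap 0 r θ * (circleMap 0 r θ)⁻¹ * hrn +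
      Complex.I⁻¹ * Complex.I * hcc + hII)

theorem continuous_comp_circleMap {g : ℂ → ℂ} (hg : DifferentiableOn ℂ g (Metric.ball 0 1))
    {r : ℝ} (hr : 0 < r) (hr1 : r < 1) : Continuous fun θ => g (circleMap 0 r θ) :=
  hg.continuousOn.comp_continuous (continuous_circleMap 0 r) fun θ => by
    rw [mem_ball_zero_iff, norm_circleMap_zero, abs_of_pos hr]; exact hr1

theorem fourierCoef_circleMap_zero {g : ℂ → ℂ} (hg : DifferentiableOn ℂ g (Metric.ball 0 1))
    {r : ℝ} (hr : 0 < r) (hr1 : r < 1) : fourierCoef (fun θ => g (circleMap 0 r θ)) 0 = g 0 := by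
  have h := (hg.mono (Metric.closedBall_subset_ball hr1)).circleIntegral_sub_inv_smul
    (Metric.mem_ball_self hr)
  simp only [sub_zero, smul_eq_mul] at h
  rw [fourierCoef_circleMap g hr]
  simp only [zero_add, zpow_neg_one, zpow_zero, one_mul, h]
  field_simp [Real.pi_ne_zero, Complex.I_ne_zero]

theorem fourierCoef_circleMap_one {g : ℂ → ℂ} (hg : DifferentiableOn ℂ g (Metric.ball 0 1))
    {r : ℝ} (hr : 0 < r) (hr1 : r < 1) :
    fourierCoef (fun θ => g (circleMap 0 r θ)) 1 = r * deriv g 0 := by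
  have h := Complex.two_pi_I_inv_smul_circleIntegral_sub_sq_inv_smul_of_differentiable
    Metric.isOpen_ball (Metric.closedBall_subset_ball hr1) hg (Metric.mem_ball_self hr)
  simp only [sub_zero, smul_eq_mul] at h
  rw [fourierCoef_circleMap g hr, ← h]
  have : ∀ z : ℂ, z ^ (-((1 : ℤ) + 1)) = (z ^ 2)⁻¹ := fun z => by
    rw [zpow_neg]; rfl
  simp only [this, zpow_one]
  ring

theorem fourierCoef_circleMap_neg_one {g : ℂ → ℂ} (hg : DifferentiableOn ℂ g (Metric.ball 0 1))
    {r : ℝ} (hr : 0 < r) (hr1 : r < 1) :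
    fourierCoef (fun θ => g (circleMap 0 r θ)) (-1) = 0 := by
  have h := (hg.mono (Metric.closedBall_subset_ball hr1)).diffContOnCl_ball
    (subset_refl _) |>.circleIntegral_eq_zero hr.le
  rw [fourierCoef_circleMap g hr]
  simp [h]

theorem fourierCoef_add_conj_circleMap {g k : ℂ → ℂ}
    (hg : DifferentiableOn ℂ g (Metric.ball 0 1)) (hk : DifferentiableOn ℂ k (Metric.ball 0 1))
    {r : ℝ} (hr : 0 < r) (hr1 : r < 1) (n : ℤ) :
    fourierCoef (fun θ => g (circleMap 0 r θ) + conj (k (circleMap 0 r θ))) n =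
      fourierCoef (fun θ => g (circleMap 0 r θ)) n +
        conj (fourierCoef (fun θ => k (circleMap 0 r θ)) (-n)) := by
  rw [← fourierCoef_conj]
  exact fourierCoef_add (continuous_comp_circleMap hg hr hr1)
    (continuous_comp_circleMap hk hr hr1).star n

theorem tendsto_fourierCoef {ι : Type*} {L : Filter ι} [L.IsCountablyGenerated]
    {F : ι → ℝ → ℂ} {v : ℝ → ℂ} {C : ℝ}
    (hF : ∀ᶠ t in L, Continuous (F t)) (hC : ∀ᶠ t in L, ∀ x, ‖F t x‖ ≤ C)
    (hv : ∀ᵐ x : ℝ, x ∈ Ioo 0 (2 * π) → Tendsto (fun t => F t x) L (𝓝 (v x))) (n : ℤ) :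
    Tendsto (fun t => fourierCoef (F t) n) L (𝓝 (fourierCoef v n)) := by
  refine Tendsto.const_mul _ ?_
  refine intervalIntegral.tendsto_integral_filter_of_dominated_convergence (fun _ => C) ?_ ?_ ?_ ?_
  · filter_upwards [hF] with t ht
    exact (by fun_prop : Continuous _).aestronglyMeasurable
  · filter_upwards [hC] with t ht
    refine ae_of_all _ fun x _ => ?_
    rw [norm_mul, show -(n * x * Complex.I) = ((-(n * x) : ℝ) : ℂ) * Complex.I by push_cast; ring,
      Complex.norm_exp_ofReal_mul_I, one_mul]
    exact ht x
  · exact intervalIntegrable_const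
  · have hne : ∀ᵐ x : ℝ, x ≠ 2 * π := by simp [ae_iff, measure_singleton]
    filter_upwards [hv, hne] with x hx hx2 hxm
    rw [uIoc_of_le (by positivity)] at hxm
    exact (hx ⟨hxm.1, lt_of_le_of_ne hxm.2 hx2⟩).const_mul _

theorem exists_monotone_boundary_angle {l k : ℂ → ℂ}
    (hl : DifferentiableOn ℂ l {z | z.re < 0}) (hk : DifferentiableOn ℂ k {z | z.re < 0})
    (hlt : ∀ z : ℂ, z.re < 0 → ‖k z‖ < ‖Complex.exp (l z)‖)
    (hd : ∀ z : ℂ, z.re < 0 → ‖deriv k z‖ ≤ ‖deriv (fun z => Complex.exp (l z)) z‖)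
    (hper_l : ∀ z, l (z + 2 * π * Complex.I) = l z + 2 * π * Complex.I)
    (hper_k : ∀ z, k (z + 2 * π * Complex.I) = k z)
    (hinj : InjOn (fun z => Complex.exp (l z)) {z | z.re < 0 ∧ 0 < z.im ∧ z.im < 2 * π})
    (hb : Bornology.IsBounded ((fun z => Complex.exp (l z)) '' {z | z.re < 0}))
    {R : ℝ} (hR1 : 1 < R)
    (hlow : ∀ s < 0, ∃ m < R, 0 ≤ m ∧
      ∀ z : ℂ, z.re = s → ‖Complex.exp (l z) + conj (k z)‖ ≤ m)
    (hup : ∀ M < R, ∃ τ < 0, ∀ z : ℂ, z.re < 0 → τ ≤ z.re →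
      M ≤ ‖Complex.exp (l z) + conj (k z)‖) :
    ∃ φ : ℝ → ℝ, Monotone φ ∧ (∀ x, φ (x + 2 * π) = φ x + 2 * π) ∧
      ∀ᵐ θ : ℝ, θ ∈ Ioo 0 (2 * π) → Tendsto
        (fun t : ℝ => Complex.exp (l (t + θ * Complex.I)) + conj (k (t + θ * Complex.I)))
        (𝓝[<] 0) (𝓝 (R * Complex.exp (φ θ * Complex.I))) := by
  obtain ⟨τ, hτ, hone⟩ := hup 1 hR1
  have hup' : ∀ M < R, ∀ᶠ t in 𝓝[<] (0 : ℝ),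
      ∀ z : ℂ, z.re = t → M ≤ ‖Complex.exp (l z) + conj (k z)‖ := by
    intro M hM
    obtain ⟨σ, hσ, h⟩ := hup M hM
    filter_upwards [Ioo_mem_nhdsLT hσ] with t ht z hz
    exact h z (hz ▸ ht.2) (hz ▸ ht.1.le)
  set E : ℂ → ℂ := fun z => Complex.exp (l z) with hE
  have hEper : ∀ z, E (z + 2 * π * Complex.I) = E z := fun z => by
    simp only [hE, hper_l, Complex.exp_add, Complex.exp_two_pi_mul_I, mul_one]
  have hdEper : ∀ z, deriv E (z + 2 * π * Complex.I) = deriv E z := fun z => by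
    rw [← deriv_comp_add_const]
    exact congrArg (fun f => deriv f z) (funext hEper)
  set D : Set ℝ := {θ | IntervalIntegrable (fun t : ℝ => deriv E (t + θ * Complex.I))
    volume τ 0} with hD
  have hshift : ∀ (t x : ℝ), (t : ℂ) + (x + 2 * π : ℝ) * Complex.I =
      t + x * Complex.I + 2 * π * Complex.I := fun t x => by push_cast; ring
  have hDper : ∀ x, x + 2 * π ∈ D ↔ x ∈ D := fun x => by
    simp only [hD, mem_ofPred_eq, hshift, hdEper]
  have hDae : ∀ᵐ θ : ℝ, θ ∈ Ioo 0 (2 * π) → θ ∈ D :=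
    ae_intervalIntegrable_deriv hτ hl.cexp hinj hb
  have hne : D.Nonempty := by
    by_contra hempty
    rw [not_nonempty_iff_eq_empty] at hempty
    have h0 : volume (Ioo 0 (2 * π)) = 0 :=
      measure_mono_null (fun θ hθ => by
        rw [mem_ofPred_eq]
        exact fun h => by simpa [hempty] using h hθ) (ae_iff.1 hDae)
    rw [Real.volume_Ioo, ENNReal.ofReal_eq_zero] at h0
    linarith [Real.pi_pos]
  have hex : ∀ θ, ∃ a : ℝ, θ ∈ D →
      Tendsto (fun t : ℝ => angleLift l k (t + θ * Complex.I)) (𝓝[<] 0) (𝓝 a) := by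
    intro θ
    by_cases hθ : θ ∈ D
    · obtain ⟨a, ha⟩ := exists_tendsto_angleLift hl hk hlt hd hτ hone hθ
      exact ⟨a, fun _ => ha⟩
    · exact ⟨0, fun h => absurd h hθ⟩
  choose ψ hψ using hex
  have hmono : MonotoneOn ψ D := fun x hx y hy hxy =>
    angleLift_limit_le hl hk hlt hd hτ hone hlow hup' hxy hx hy (hψ x hx) (hψ y hy)
  have hAper : ∀ z, angleLift l k (z + 2 * π * Complex.I) = angleLift l k z + 2 * π := fun z => by
    have := hEper z
    simp only [hE] at this
    rw [angleLift, angleLift, this, hper_l, hper_k]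
    simp only [Complex.add_im]
    have : (2 * π * Complex.I : ℂ).im = 2 * π := by simp
    rw [this]
    ring
  have hψper : ∀ x ∈ D, ψ (x + 2 * π) = ψ x + 2 * π := fun x hx => by
    have h1 := hψ _ ((hDper x).2 hx)
    simp only [hshift, hAper] at h1
    exact tendsto_nhds_unique h1 ((hψ x hx).add_const _)
  obtain ⟨φ, hφ, hφper, hφψ⟩ :=
    exists_monotone_extension_of_periodic (by positivity) hne hDper hmono hψper
  refine ⟨φ, hφ, hφper, ?_⟩
  filter_upwards [hDae] with θ hθ hθm
  have hθD := hθ hθm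
  rw [hφψ hθD]
  have hnorm : Tendsto (fun t : ℝ => ‖E (t + θ * Complex.I) + conj (k (t + θ * Complex.I))‖)
      (𝓝[<] 0) (𝓝 R) := by
    refine tendsto_order.2 ⟨fun a ha => ?_, fun a ha => ?_⟩
    · obtain ⟨b, hab, hbR⟩ := exists_between ha
      filter_upwards [hup' b hbR] with t ht
      exact hab.trans_le (ht _ (by simp))
    · filter_upwards [self_mem_nhdsWithin] with t ht
      obtain ⟨m, hm, -, h⟩ := hlow t ht
      exact ((h _ (by simp)).trans_lt hm).trans ha
  have hang : Tendsto (fun t : ℝ => Complex.exp (angleLift l k (t + θ * Complex.I) * Complex.I))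
      (𝓝[<] 0) (𝓝 (Complex.exp (ψ θ * Complex.I))) :=
    ((by fun_prop : Continuous fun a : ℝ => Complex.exp (a * Complex.I)).tendsto (ψ θ)).comp
      (hψ θ hθD)
  refine (((Complex.continuous_ofReal.tendsto R).comp hnorm).mul hang).congr' ?_
  filter_upwards [self_mem_nhdsWithin] with t ht
  exact norm_mul_exp_angleLift (hlt _ (by simpa using ht))

theorem injOn_exp_strip : InjOn Complex.exp {z : ℂ | z.re < 0 ∧ 0 < z.im ∧ z.im < 2 * π} := by
  intro z hz w hw h
  obtain ⟨n, hn⟩ := Complex.exp_eq_exp_iff_exists_int.1 h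
  have him : z.im = w.im + n * (2 * π) := by simpa using congrArg Complex.im hn
  have hn1 : (n : ℝ) < 1 := by nlinarith [hz.2.1, hz.2.2, hw.2.1, hw.2.2, Real.pi_pos]
  have hn2 : (-1 : ℝ) < n := by nlinarith [hz.2.1, hz.2.2, hw.2.1, hw.2.2, Real.pi_pos]
  have : n = 0 := by
    have h1 : n < 1 := by exact_mod_cast hn1
    have h2 : -1 < n := by exact_mod_cast hn2
    omega
  simpa [this] using hn

theorem fourierCoef_const_mul (c : ℂ) (u : ℝ → ℂ) (n : ℤ) :
    fourierCoef (fun x => c * u x) n = c * fourierCoef u n := by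
  simp only [fourierCoef, mul_left_comm _ c, intervalIntegral.integral_const_mul]

/-- A univalent `g` and a dominated `k` for which `g + conj k` is a proper map to a disk
have first coefficients that are not both small. -/
theorem le_norm_deriv_sq_add {g k : ℂ → ℂ} {R : ℝ} (hR : 1 < R)
    (hg : DifferentiableOn ℂ g (Metric.ball 0 1)) (hk : DifferentiableOn ℂ k (Metric.ball 0 1))
    (hinj : InjOn g (Metric.ball 0 1)) (hb : Bornology.IsBounded (g '' Metric.ball 0 1))
    (g0 : g 0 = 0) (k0 : k 0 = 0) (hd0 : deriv g 0 ≠ 0)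
    (hlt : ∀ z ∈ Metric.ball (0 : ℂ) 1, z ≠ 0 → ‖k z‖ < ‖g z‖)
    (hd : ∀ z ∈ Metric.ball (0 : ℂ) 1, ‖deriv k z‖ ≤ ‖deriv g z‖)
    (hRlt : ∀ z ∈ Metric.ball (0 : ℂ) 1, ‖g z + conj (k z)‖ < R)
    (hprop : ∀ M < R, ∃ ρ < 1, ∀ z ∈ Metric.ball (0 : ℂ) 1, ρ < ‖z‖ → M ≤ ‖g z + conj (k z)‖) :
    27 * R ^ 2 / (4 * π ^ 2) ≤ ‖deriv g 0‖ ^ 2 + ‖deriv k 0‖ ^ 2 := by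
  obtain ⟨κ, hκ, hgκ⟩ := exists_eq_mul_exp hg hinj g0 hd0
  have hU : IsOpen {z : ℂ | z.re < 0} := isOpen_lt Complex.continuous_re continuous_const
  have hmap : MapsTo Complex.exp {z | z.re < 0} (Metric.ball 0 1) := fun z hz => by
    rw [mem_ball_zero_iff, Complex.norm_exp]
    exact Real.exp_lt_one_iff.2 hz
  set l : ℂ → ℂ := fun z => z + κ (Complex.exp z) with hl
  set kt : ℂ → ℂ := fun z => k (Complex.exp z) with hkt
  have hld : DifferentiableOn ℂ l {z | z.re < 0} :=
    differentiableOn_id.add (hκ.comp Complex.differentiable_exp.differentiableOn hmap)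
  have hkd : DifferentiableOn ℂ kt {z | z.re < 0} :=
    hk.comp Complex.differentiable_exp.differentiableOn hmap
  have hexp : EqOn (fun z => Complex.exp (l z)) (fun z => g (Complex.exp z)) {z | z.re < 0} := by
    intro z hz
    simp only [hl, Complex.exp_add, hgκ _ (hmap hz)]
  have hexp' : ∀ z : ℂ, z.re < 0 → Complex.exp (l z) = g (Complex.exp z) := fun z hz => hexp hz
  have hderiv : ∀ {f : ℂ → ℂ}, DifferentiableOn ℂ f (Metric.ball 0 1) → ∀ z : ℂ, z.re < 0 →
      deriv (fun z => f (Complex.exp z)) z = deriv f (Complex.exp z) * Complex.exp z := by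
    intro f hf z hz
    exact ((hf.differentiableAt (Metric.isOpen_ball.mem_nhds (hmap hz))).hasDerivAt.comp z
      (Complex.hasDerivAt_exp z)).deriv
  have hHeq : ∀ z : ℂ, z.re < 0 → Complex.exp (l z) + conj (kt z) =
      g (Complex.exp z) + conj (k (Complex.exp z)) := fun z hz => by rw [hexp' z hz]
  obtain ⟨φ, hφ, hφper, hlim⟩ := exists_monotone_boundary_angle (R := R) hld hkd
    (fun z hz => by
      rw [hexp' z hz]
      exact hlt _ (hmap hz) (Complex.exp_ne_zero z))
    (fun z hz => by
      rw [(hexp.eventuallyEq_of_mem (hU.mem_nhds hz)).deriv_eq, hderiv hg z hz, hderiv hk z hz,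
        norm_mul, norm_mul]
      gcongr
      exact hd _ (hmap hz))
    (fun z => by
      simp only [hl, Complex.exp_add, Complex.exp_two_pi_mul_I, mul_one]
      ring)
    (fun z => by simp only [hkt, Complex.exp_add, Complex.exp_two_pi_mul_I, mul_one])
    (fun z hz w hw h => injOn_exp_strip hz hw (hinj (hmap hz.1) (hmap hw.1) (by
      rw [← hexp' z hz.1, ← hexp' w hw.1]
      exact h)))
    (hb.subset (by
      rw [hexp.image_eq]
      rintro _ ⟨z, hz, rfl⟩
      exact mem_image_of_mem _ (hmap hz)))
    hR
    (fun s hs => by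
      have hcont : ContinuousOn (fun z => ‖g z + conj (k z)‖) (Metric.sphere 0 (Real.exp s)) := by
        have hsub : Metric.sphere (0 : ℂ) (Real.exp s) ⊆ Metric.ball 0 1 := fun z hz => by
          rw [mem_ball_zero_iff, mem_sphere_zero_iff_norm.1 hz]
          exact Real.exp_lt_one_iff.2 hs
        exact ((hg.mono hsub).continuousOn.add (hk.mono hsub).continuousOn.star).norm
      obtain ⟨z₀, hz₀, hmax⟩ := (isCompact_sphere (0 : ℂ) (Real.exp s)).exists_isMaxOn
        (NormedSpace.sphere_nonempty.2 (Real.exp_pos s).le) hcont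
      refine ⟨_, hRlt z₀ ?_, norm_nonneg _, fun z hz => ?_⟩
      · rw [mem_ball_zero_iff, mem_sphere_zero_iff_norm.1 hz₀]
        exact Real.exp_lt_one_iff.2 hs
      · rw [hHeq z (by rw [hz]; exact hs)]
        exact hmax (by rw [mem_sphere_zero_iff_norm, Complex.norm_exp, hz]))
    (fun M hM => by
      obtain ⟨ρ, hρ, h⟩ := hprop M hM
      have hev : ∀ᶠ t in 𝓝[<] (0 : ℝ), ρ < Real.exp t :=
        (Real.continuous_exp.continuousWithinAt (s := Iio 0) (x := 0)).eventually_const_lt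
          (by simpa using hρ)
      obtain ⟨τ, hτρ, hτ⟩ := (hev.and self_mem_nhdsWithin).exists
      refine ⟨τ, hτ, fun z hz hzτ => ?_⟩
      rw [hHeq z hz]
      refine h _ (hmap hz) (hτρ.trans_le ?_)
      rw [Complex.norm_exp]
      exact Real.exp_le_exp.2 hzτ)
  have hcirc : ∀ t θ : ℝ, Complex.exp (t + θ * Complex.I) = circleMap 0 (Real.exp t) θ := by
    intro t θ
    rw [circleMap_zero, Complex.exp_add, Complex.ofReal_exp]
  set H : ℝ → ℝ → ℂ := fun t θ => g (circleMap 0 (Real.exp t) θ) +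
    conj (k (circleMap 0 (Real.exp t) θ)) with hH
  have hneg : ∀ᶠ t in 𝓝[<] (0 : ℝ), t < 0 := self_mem_nhdsWithin
  have hFlim := tendsto_fourierCoef (L := 𝓝[<] (0 : ℝ)) (F := H) (C := R)
    (v := fun θ => R * Complex.exp (φ θ * Complex.I))
    (by
      filter_upwards [hneg] with t ht
      exact (continuous_comp_circleMap hg (Real.exp_pos t) (Real.exp_lt_one_iff.2 ht)).add
        (continuous_comp_circleMap hk (Real.exp_pos t) (Real.exp_lt_one_iff.2 ht)).star)
    (by
      filter_upwards [hneg] with t ht θ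
      refine (hRlt _ ?_).le
      rw [← hcirc]
      exact hmap (by simpa using ht))
    (by
      filter_upwards [hlim] with θ hθ hθm
      refine (hθ hθm).congr' ?_
      filter_upwards [hneg] with t ht
      rw [hHeq _ (by simpa using ht), hcirc])
  have hcoef : ∀ (n : ℤ) (c : ℂ), (∀ t < 0, fourierCoef (H t) n = Real.exp t * c) →
      R * fourierCoef (fun θ => Complex.exp (φ θ * Complex.I)) n = c := by
    intro n c hc
    have h1 := hFlim n
    rw [fourierCoef_const_mul] at h1
    have h2 : Tendsto (fun t : ℝ => (Real.exp t : ℂ) * c) (𝓝[<] 0) (𝓝 c) := by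
      have : Continuous fun t : ℝ => (Real.exp t : ℂ) * c := by fun_prop
      simpa using (this.tendsto 0).mono_left nhdsWithin_le_nhds
    refine tendsto_nhds_unique h1 (h2.congr' ?_)
    filter_upwards [hneg] with t ht
    exact (hc t ht).symm
  have hsplit : ∀ t < 0, ∀ n, fourierCoef (H t) n = _ := fun t ht n =>
    fourierCoef_add_conj_circleMap hg hk (Real.exp_pos t) (Real.exp_lt_one_iff.2 ht) n
  have hR0 : (R : ℂ) ≠ 0 := by exact_mod_cast (one_pos.trans hR).ne'
  have c0 := hcoef 0 0 fun t ht => by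
    rw [hsplit t ht, neg_zero, fourierCoef_circleMap_zero hg (Real.exp_pos t) (Real.exp_lt_one_iff.2 ht),
      fourierCoef_circleMap_zero hk (Real.exp_pos t) (Real.exp_lt_one_iff.2 ht), g0, k0]
    simp
  have c1 := hcoef 1 (deriv g 0) fun t ht => by
    rw [hsplit t ht, fourierCoef_circleMap_one hg (Real.exp_pos t) (Real.exp_lt_one_iff.2 ht),
      fourierCoef_circleMap_neg_one hk (Real.exp_pos t) (Real.exp_lt_one_iff.2 ht)]
    simp
  have c2 := hcoef (-1) (conj (deriv k 0)) fun t ht => by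
    rw [hsplit t ht, neg_neg, fourierCoef_circleMap_one hk (Real.exp_pos t) (Real.exp_lt_one_iff.2 ht),
      fourierCoef_circleMap_neg_one hg (Real.exp_pos t) (Real.exp_lt_one_iff.2 ht), map_mul,
      Complex.conj_ofReal, zero_add]
  have hC := le_norm_fourierCoef_sq_add hφ hφper ((mul_eq_zero.1 c0).resolve_left hR0)
  have n1 := congrArg norm c1
  have n2 := congrArg norm c2
  rw [norm_mul, Complex.norm_real, norm_of_nonneg (by linarith)] at n1 n2
  rw [Complex.norm_conj] at n2
  rw [← n1, ← n2, mul_pow, mul_pow, ← mul_add]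
  calc 27 * R ^ 2 / (4 * π ^ 2) = R ^ 2 * (27 / (4 * π ^ 2)) := by ring
    _ ≤ _ := by gcongr

/-- The disk automorphism sending `a` to `0`. -/
noncomputable def diskAut (a z : ℂ) : ℂ := (z - a) / (1 - conj a * z)

theorem one_sub_conj_mul_ne_zero {a z : ℂ} (ha : ‖a‖ < 1) (hz : ‖z‖ < 1) :
    1 - conj a * z ≠ 0 := by
  intro h
  have h1 : ‖conj a * z‖ = 1 := by rw [← sub_eq_zero.1 h, norm_one]
  rw [norm_mul, Complex.norm_conj] at h1
  nlinarith [norm_nonneg a, norm_nonneg z]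

theorem norm_diskAut_lt_one {a z : ℂ} (ha : ‖a‖ < 1) (hz : ‖z‖ < 1) : ‖diskAut a z‖ < 1 := by
  have h0 := one_sub_conj_mul_ne_zero ha hz
  rw [diskAut, norm_div, div_lt_one (norm_pos_iff.2 h0)]
  refine lt_of_pow_lt_pow_left₀ 2 (norm_nonneg _) ?_
  have ha2 : ‖a‖ ^ 2 < 1 := by nlinarith [norm_nonneg a]
  have hz2 : ‖z‖ ^ 2 < 1 := by nlinarith [norm_nonneg z]
  have key : ‖1 - conj a * z‖ ^ 2 - ‖z - a‖ ^ 2 = (1 - ‖a‖ ^ 2) * (1 - ‖z‖ ^ 2) := by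
    simp only [← Complex.normSq_eq_norm_sq, Complex.normSq_apply, Complex.sub_re, Complex.sub_im,
      Complex.mul_re, Complex.mul_im, Complex.conj_re, Complex.conj_im, Complex.one_re,
      Complex.one_im]
    ring
  nlinarith [mul_pos (sub_pos.2 ha2) (sub_pos.2 hz2)]

theorem diskAut_self (a : ℂ) : diskAut a a = 0 := by simp [diskAut]

theorem diskAut_eq_zero {a z : ℂ} (ha : ‖a‖ < 1) (hz : ‖z‖ < 1) : diskAut a z = 0 ↔ z = a := by
  rw [diskAut, div_eq_zero_iff, or_iff_left (one_sub_conj_mul_ne_zero ha hz), sub_eq_zero]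

theorem one_sub_conj_mul_self {a : ℂ} : 1 - conj a * a = ((1 - ‖a‖ ^ 2 : ℝ) : ℂ) := by
  rw [mul_comm, Complex.mul_conj, Complex.normSq_eq_norm_sq]
  push_cast
  rfl

theorem hasDerivAt_diskAut {a z : ℂ} (ha : ‖a‖ < 1) (hz : ‖z‖ < 1) :
    HasDerivAt (diskAut a) (((1 - ‖a‖ ^ 2 : ℝ) : ℂ) / (1 - conj a * z) ^ 2) z := by
  have h0 := one_sub_conj_mul_ne_zero ha hz
  refine (((hasDerivAt_id z).sub_const a).div
    (((hasDerivAt_id z).const_mul (conj a)).const_sub 1) h0).congr_deriv ?_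
  rw [← one_sub_conj_mul_self]
  simp only [id]
  ring

theorem deriv_diskAut_ne_zero {a z : ℂ} (ha : ‖a‖ < 1) (hz : ‖z‖ < 1) :
    ((1 - ‖a‖ ^ 2 : ℝ) : ℂ) / (1 - conj a * z) ^ 2 ≠ 0 := by
  refine div_ne_zero ?_ (pow_ne_zero 2 (one_sub_conj_mul_ne_zero ha hz))
  have : 1 - ‖a‖ ^ 2 ≠ 0 := by nlinarith [norm_nonneg a]
  exact_mod_cast this

theorem diskAut_injOn {a : ℂ} (ha : ‖a‖ < 1) : InjOn (diskAut a) (Metric.ball 0 1) := by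
  intro z hz w hw h
  rw [mem_ball_zero_iff] at hz hw
  have h1 := one_sub_conj_mul_ne_zero ha hz
  have h2 := one_sub_conj_mul_ne_zero ha hw
  rw [diskAut, diskAut, div_eq_div_iff h1 h2] at h
  have h3 : (1 - conj a * a) * (z - w) = 0 := by linear_combination h
  exact sub_eq_zero.1 ((mul_eq_zero.1 h3).resolve_left (one_sub_conj_mul_ne_zero ha ha))

/-- Schwarz–Pick at the origin. -/
theorem norm_deriv_zero_le_one_sub_sq {f : ℂ → ℂ} (hf : DifferentiableOn ℂ f (Metric.ball 0 1))
    (hm : MapsTo f (Metric.ball 0 1) (Metric.ball 0 1)) : ‖deriv f 0‖ ≤ 1 - ‖f 0‖ ^ 2 := by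
  have h0 : (0 : ℂ) ∈ Metric.ball (0 : ℂ) 1 := Metric.mem_ball_self one_pos
  have hball : ∀ z ∈ Metric.ball (0 : ℂ) 1, ‖f z‖ < 1 := fun z hz =>
    mem_ball_zero_iff.1 (hm hz)
  have ha := hball 0 h0
  have hd := (hasDerivAt_diskAut ha ha).comp (0 : ℂ)
    (hf.differentiableAt (Metric.ball_mem_nhds 0 one_pos)).hasDerivAt
  have hS := Complex.norm_deriv_le_one_of_mapsTo_ball (f := diskAut (f 0) ∘ f) (c := 0) (R := 1)
    (fun z hz => ((hasDerivAt_diskAut ha (hball z hz)).differentiableAt.comp z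
      (hf.differentiableAt (Metric.isOpen_ball.mem_nhds hz))).differentiableWithinAt)
    (fun z hz => by
      rw [Function.comp_apply, Function.comp_apply, diskAut_self]
      exact Metric.ball_subset_closedBall (mem_ball_zero_iff.2 (norm_diskAut_lt_one ha (hball z hz)))) one_pos
  have hpos : 0 < 1 - ‖f 0‖ ^ 2 := by nlinarith [norm_nonneg (f 0)]
  rw [hd.deriv, one_sub_conj_mul_self, norm_mul, norm_div, norm_pow, Complex.norm_real,
    norm_of_nonneg hpos.le] at hS
  have : (1 - ‖f 0‖ ^ 2) / (1 - ‖f 0‖ ^ 2) ^ 2 = (1 - ‖f 0‖ ^ 2)⁻¹ := by field_simp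
  rwa [this, inv_mul_le_iff₀ hpos, mul_one] at hS

theorem hasDerivAt_of_sq {h F : ℂ → ℂ} {F' z : ℂ} (hsq : ∀ z, h z ^ 2 = F z)
    (hc : ContinuousAt h z) (h0 : h z ≠ 0) (hF : HasDerivAt F F' z) :
    HasDerivAt h (F' / (2 * h z)) z := by
  rw [hasDerivAt_iff_tendsto_slope] at hF ⊢
  have hsum : Tendsto (fun w => h w + h z) (𝓝[≠] z) (𝓝 (2 * h z)) := by
    rw [two_mul]
    exact (hc.mono_left nhdsWithin_le_nhds).add_const _
  refine (hF.div hsum (mul_ne_zero two_ne_zero h0)).congr' ?_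
  filter_upwards [hsum.eventually_ne (mul_ne_zero two_ne_zero h0), self_mem_nhdsWithin] with w hw hwz
  have hwz' : w - z ≠ 0 := sub_ne_zero.2 hwz
  rw [Pi.div_apply, slope_def_field, slope_def_field, ← hsq, ← hsq, sq_sub_sq]
  field_simp

/-- Koebe's square root trick. -/
theorem exists_deriv_lt_of_not_surjOn {U : Set ℂ} (hUo : IsOpen U) (hUc : IsSimplyConnected U)
    (h0U : (0 : ℂ) ∈ U) {f : ℂ → ℂ} (hf : DifferentiableOn ℂ f U)
    (hm : MapsTo f U (Metric.ball 0 1)) (hinj : InjOn f U) (hd : ∀ z ∈ U, deriv f z ≠ 0)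
    (f0 : f 0 = 0) (hs : ¬ SurjOn f U (Metric.ball 0 1)) :
    ∃ F : ℂ → ℂ, DifferentiableOn ℂ F U ∧ MapsTo F U (Metric.ball 0 1) ∧ InjOn F U ∧
      (∀ z ∈ U, deriv F z ≠ 0) ∧ F 0 = 0 ∧ ‖deriv f 0‖ < ‖deriv F 0‖ := by
  obtain ⟨a, ha, haf⟩ := not_subset.1 hs
  rw [mem_ball_zero_iff] at ha
  have hball : ∀ z ∈ U, ‖f z‖ < 1 := fun z hz => mem_ball_zero_iff.1 (hm hz)
  have hFder : ∀ z ∈ U, HasDerivAt (fun z => diskAut a (f z))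
      (((1 - ‖a‖ ^ 2 : ℝ) : ℂ) / (1 - conj a * f z) ^ 2 * deriv f z) z := fun z hz =>
    (hasDerivAt_diskAut ha (hball z hz)).comp z (hf.differentiableAt (hUo.mem_nhds hz)).hasDerivAt
  have hF0 : ∀ z ∈ U, diskAut a (f z) ≠ 0 := fun z hz h =>
    haf ⟨z, hz, (diskAut_eq_zero ha (hball z hz)).1 h⟩
  obtain ⟨h, hhc, hh⟩ := Complex.exists_continuousOn_pow_eq hUc hUo
    (g := fun z => diskAut a (f z)) (fun z hz => (hFder z hz).continuousAt.continuousWithinAt)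
    (by
      rintro ⟨z, hz, hz0⟩
      exact hF0 z hz hz0) two_ne_zero
  have hh0 : ∀ z ∈ U, h z ≠ 0 := fun z hz hz0 => hF0 z hz (by rw [← hh, hz0, zero_pow two_ne_zero])
  have hder : ∀ z ∈ U, HasDerivAt h _ z := fun z hz =>
    hasDerivAt_of_sq hh (hhc.continuousAt (hUo.mem_nhds hz)) (hh0 z hz) (hFder z hz)
  have hhb : ∀ z ∈ U, ‖h z‖ < 1 := fun z hz => by
    have := norm_diskAut_lt_one ha (hball z hz)
    rw [← hh, norm_pow] at this
    nlinarith [norm_nonneg (h z)]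
  have hb := hhb 0 h0U
  have hψ : ∀ z ∈ U, HasDerivAt (fun z => diskAut (h 0) (h z)) _ z := fun z hz =>
    (hasDerivAt_diskAut hb (hhb z hz)).comp z (hder z hz)
  refine ⟨fun z => diskAut (h 0) (h z),
    fun z hz => (hψ z hz).differentiableAt.differentiableWithinAt,
    fun z hz => mem_ball_zero_iff.2 (norm_diskAut_lt_one hb (hhb z hz)),
    fun z hz w hw hzw => ?_, fun z hz => ?_, diskAut_self _, ?_⟩
  · have h1 := diskAut_injOn hb (mem_ball_zero_iff.2 (hhb z hz)) (mem_ball_zero_iff.2 (hhb w hw)) hzw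
    exact hinj hz hw (diskAut_injOn ha (hm hz) (hm hw) (by rw [← hh, ← hh, h1]))
  · rw [(hψ z hz).deriv]
    refine mul_ne_zero (deriv_diskAut_ne_zero hb (hhb z hz)) (div_ne_zero (mul_ne_zero
      (deriv_diskAut_ne_zero ha (hball z hz)) (hd z hz)) ?_)
    simpa using hh0 z hz
  · rw [(hψ 0 h0U).deriv, f0]
    have hab : ‖a‖ = ‖h 0‖ ^ 2 := by
      rw [← norm_pow, hh, f0]
      simp [diskAut]
    have hb0 : 0 < ‖h 0‖ := norm_pos_iff.2 (hh0 0 h0U)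
    have hpos : 0 < 1 - ‖h 0‖ ^ 2 := by nlinarith
    have hposa : 0 < 1 - ‖a‖ ^ 2 := by nlinarith [norm_nonneg a]
    have hdp : 0 < ‖deriv f 0‖ := norm_pos_iff.2 (hd 0 h0U)
    rw [one_sub_conj_mul_self]
    rw [hab] at hposa
    simp only [mul_zero, sub_zero, one_pow, div_one, norm_mul, norm_div, norm_pow,
      Complex.norm_real, norm_of_nonneg hpos.le, norm_of_nonneg hposa.le, Complex.norm_ofNat, hab]
    have : (1 - ‖h 0‖ ^ 2) / (1 - ‖h 0‖ ^ 2) ^ 2 *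
        ((1 - (‖h 0‖ ^ 2) ^ 2) * ‖deriv f 0‖ / (2 * ‖h 0‖)) =
        ‖deriv f 0‖ * ((1 + ‖h 0‖ ^ 2) / (2 * ‖h 0‖)) := by
      field_simp
      ring
    rw [this]
    refine lt_mul_of_one_lt_right hdp ?_
    rw [one_lt_div (by positivity)]
    nlinarith [sq_pos_of_pos (sub_pos.2 hb)]

/-- Hurwitz's theorem, local form. -/
theorem eventually_eq_zero_of_tendsto_ne_zero {ι : Type*} {l : Filter ι} [l.NeBot]
    {F : ι → ℂ → ℂ} {f : ℂ → ℂ} {V : Set ℂ} (hV : IsOpen V) {b : ℂ} (hbV : b ∈ V)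
    (hF : ∀ i, DifferentiableOn ℂ (F i) V) (hne : ∀ i, ∀ z ∈ V, F i z ≠ 0)
    (hu : TendstoLocallyUniformlyOn F f l V) (hb : f b = 0) : ∀ᶠ z in 𝓝 b, f z = 0 := by
  have hfd : DifferentiableOn ℂ f V := hu.differentiableOn (.of_forall hF) hV
  refine ((hfd.analyticAt (hV.mem_nhds hbV)).eventually_eq_zero_or_eventually_ne_zero).resolve_right
    fun hn => ?_
  obtain ⟨ε, hε, hεn⟩ := Metric.eventually_nhds_iff.1 (eventually_nhdsWithin_iff.1 hn)
  obtain ⟨R, hR, hRV⟩ := Metric.isOpen_iff.1 hV b hbV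
  obtain ⟨δ, hδ0, hδ⟩ := exists_between (lt_min hε hR)
  have hcV : Metric.closedBall b δ ⊆ V :=
    (Metric.closedBall_subset_ball (hδ.trans_le (min_le_right _ _))).trans hRV
  obtain ⟨x, hx, hmin⟩ := (isCompact_sphere b δ).exists_isMinOn
    (NormedSpace.sphere_nonempty.2 hδ0.le)
    ((hfd.continuousOn.mono (Metric.sphere_subset_closedBall.trans hcV)).norm)
  have hm : 0 < ‖f x‖ := by
    rw [norm_pos_iff]
    rw [Metric.mem_sphere] at hx
    exact hεn (by rw [hx]; exact hδ.trans_le (min_le_left _ _))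
      (by rintro rfl; rw [dist_self] at hx; exact hδ0.ne hx)
  have huc := (tendstoLocallyUniformlyOn_iff_forall_isCompact hV).1 hu _ hcV
    (isCompact_closedBall b δ)
  obtain ⟨i, hi⟩ := (Metric.tendstoUniformlyOn_iff.1 huc (‖f x‖ / 3) (by positivity)).exists
  have hfib : ‖F i b‖ < ‖f x‖ / 3 := by
    have := hi b (Metric.mem_closedBall_self hδ0.le)
    rwa [hb, dist_zero_left] at this
  have hdc : DiffContOnCl ℂ (fun z => (F i z)⁻¹) (Metric.ball b δ) := by
    refine DifferentiableOn.diffContOnCl ?_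
    rw [closure_ball b hδ0.ne']
    exact ((hF i).mono hcV).inv fun z hz => hne i z (hcV hz)
  have key := Complex.norm_le_of_forall_mem_frontier_norm_le Metric.isBounded_ball hdc
    (C := (‖f x‖ / 3)⁻¹) (fun z hz => by
      rw [frontier_ball b hδ0.ne'] at hz
      have h1 := hi z (Metric.sphere_subset_closedBall hz)
      have h2 : ‖f x‖ ≤ ‖f z‖ := hmin hz
      rw [dist_eq_norm] at h1
      have h3 : ‖f x‖ / 3 ≤ ‖F i z‖ := by
        have := norm_sub_norm_le (f z) (F i z)
        linarith
      rw [norm_inv]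
      exact inv_anti₀ (by positivity) h3) (subset_closure (Metric.mem_ball_self hδ0))
  rw [norm_inv, inv_le_inv₀ (norm_pos_iff.2 (hne i b hbV)) (by positivity)] at key
  exact absurd hfib key.not_gt

/-- Montel's theorem along an ultrafilter. -/
theorem exists_tendstoLocallyUniformlyOn_ultrafilter {ι : Type*} (l : Ultrafilter ι)
    {F : ι → ℂ → ℂ} {U : Set ℂ} (hU : IsOpen U) (hF : ∀ i, DifferentiableOn ℂ (F i) U)
    (hm : ∀ i, MapsTo (F i) U (Metric.ball 0 1)) :
    ∃ f, TendstoLocallyUniformlyOn F f (l : Filter ι) U := by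
  have hlim : ∀ z : ℂ, ∃ y, z ∈ U → Tendsto (fun i => F i z) (l : Filter ι) (𝓝 y) := by
    intro z
    by_cases hz : z ∈ U
    · obtain ⟨y, -, hy⟩ := (isCompact_closedBall (0 : ℂ) 1).ultrafilter_le_nhds
        (l.map fun i => F i z) (by
          rw [le_principal_iff, Ultrafilter.mem_coe, Ultrafilter.mem_map]
          exact univ_mem' fun i => Metric.ball_subset_closedBall (hm i hz))
      exact ⟨y, fun _ => hy⟩
    · exact ⟨0, fun h => absurd h hz⟩
  choose f hf using hlim
  refine ⟨f, (tendstoLocallyUniformlyOn_iff_forall_isCompact hU).2 fun K hKU hK => ?_⟩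
  have heq : EquicontinuousOn F K := by
    intro x hx
    refine EquicontinuousAt.equicontinuousWithinAt ?_ K
    obtain ⟨R, hR, hRU⟩ := Metric.isOpen_iff.1 hU x (hKU hx)
    refine Metric.equicontinuousAt_of_continuity_modulus (fun z => 2 / R * dist z x) ?_ F ?_
    · have : Continuous fun z => 2 / R * dist z x := by fun_prop
      simpa using this.tendsto x
    · filter_upwards [Metric.ball_mem_nhds x hR] with z hz i
      rw [dist_comm]
      refine Complex.dist_le_div_mul_dist_of_mapsTo_ball ((hF i).mono hRU) (fun w hw => ?_) hz
      have h1 := mem_ball_zero_iff.1 (hm i (hRU hw))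
      have h2 := mem_ball_zero_iff.1 (hm i (hKU hx))
      rw [Metric.mem_closedBall, dist_eq_norm]
      linarith [norm_sub_le (F i w) (F i x)]
  have h := (EquicontinuousOn.tendsto_uniformOnFun_iff_pi' (𝔖 := {K}) (F := F)
    (by rintro _ rfl; exact hK) (by rintro _ rfl; exact heq) l f).2 (by
      rw [tendsto_pi_nhds]
      rintro ⟨z, hz⟩
      rw [sUnion_singleton] at hz
      exact hf z (hKU hz))
  exact UniformOnFun.tendsto_iff_tendstoUniformlyOn.1 h K rfl

/-- Injective holomorphic maps from `U` into the unit disk that fix the origin. -/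
def diskEmbeddings (U : Set ℂ) : Set (ℂ → ℂ) :=
  {f | DifferentiableOn ℂ f U ∧ MapsTo f U (Metric.ball 0 1) ∧ InjOn f U ∧
    (∀ z ∈ U, deriv f z ≠ 0) ∧ f 0 = 0}

theorem diskEmbeddings_nonempty {U : Set ℂ} (hb : Bornology.IsBounded U) :
    (diskEmbeddings U).Nonempty := by
  obtain ⟨M, hM0, hM⟩ := hb.subset_ball_lt 0 0
  have hMc : (M : ℂ) ≠ 0 := by exact_mod_cast hM0.ne'
  refine ⟨fun z => z / M, by fun_prop, fun z hz => ?_, fun z _ w _ h => ?_, fun z _ => ?_, by simp⟩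
  · have := mem_ball_zero_iff.1 (hM hz)
    rw [mem_ball_zero_iff, norm_div, Complex.norm_real, norm_of_nonneg hM0.le, div_lt_one hM0]
    exact this
  · exact (div_left_inj' hMc).1 h
  · rw [((hasDerivAt_id' z).div_const (M : ℂ)).deriv]
    exact div_ne_zero one_ne_zero hMc

theorem bddAbove_norm_deriv_diskEmbeddings {U : Set ℂ} (hU : IsOpen U) (h0 : (0 : ℂ) ∈ U) :
    BddAbove ((fun f : ℂ → ℂ => ‖deriv f 0‖) '' diskEmbeddings U) := by
  obtain ⟨R, hR, hRU⟩ := Metric.isOpen_iff.1 hU 0 h0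
  refine ⟨1 / R, ?_⟩
  rintro _ ⟨f, hf, rfl⟩
  refine Complex.norm_deriv_le_div_of_mapsTo_ball (hf.1.mono hRU) (fun z hz => ?_) hR
  rw [hf.2.2.2.2]
  exact Metric.ball_subset_closedBall (hf.2.1 (hRU hz))

theorem mem_diskEmbeddings_of_tendsto {ι : Type*} {l : Filter ι} [l.NeBot] {F : ι → ℂ → ℂ}
    {f : ℂ → ℂ} {U : Set ℂ} (hU : IsOpen U) (hc : IsPreconnected U) (h0 : (0 : ℂ) ∈ U)
    (hF : ∀ i, F i ∈ diskEmbeddings U) (hu : TendstoLocallyUniformlyOn F f l U)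
    (hd0 : deriv f 0 ≠ 0) : f ∈ diskEmbeddings U := by
  have hFd : ∀ i, DifferentiableOn ℂ (F i) U := fun i => (hF i).1
  have hfd : DifferentiableOn ℂ f U := hu.differentiableOn (.of_forall hFd) hU
  have hlim : ∀ z ∈ U, Tendsto (fun i => F i z) l (𝓝 (f z)) := fun z hz => hu.tendsto_at hz
  have f0 : f 0 = 0 := by
    refine tendsto_nhds_unique (hlim 0 h0) ?_
    simp only [(hF _).2.2.2.2]
    exact tendsto_const_nhds
  have hconst : ∀ c : ℂ, ¬ EqOn f (fun _ => c) U := fun c hfc => hd0 <| by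
    rw [(hfc.eventuallyEq_of_mem (hU.mem_nhds h0)).deriv_eq, deriv_const]
  have hle : ∀ z ∈ U, ‖f z‖ ≤ 1 := fun z hz =>
    le_of_tendsto (hlim z hz).norm (.of_forall fun i => (mem_ball_zero_iff.1 ((hF i).2.1 hz)).le)
  refine ⟨hfd, fun z hz => ?_, fun a ha w hw haw => ?_, fun b hb hb0 => ?_, f0⟩
  · rw [mem_ball_zero_iff]
    refine (hle z hz).lt_of_ne fun h1 => ?_
    have := Complex.norm_eqOn_of_isPreconnected_of_isMaxOn hc hU hfd hz
      (fun w hw => by simpa [h1] using hle w hw) h0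
    simp [f0, h1] at this
  · by_contra hne
    have hV : IsOpen (U \ {a}) := hU.sdiff isClosed_singleton
    have hu' : TendstoLocallyUniformlyOn (fun i z => F i z - F i a) (fun z => f z - f a) l
        (U \ {a}) := by
      rw [Metric.tendstoLocallyUniformlyOn_iff] at hu ⊢
      intro ε hε x hx
      obtain ⟨t, ht, h⟩ := hu (ε / 2) (by positivity) x hx.1
      refine ⟨t, nhdsWithin_mono x sdiff_subset ht, ?_⟩
      filter_upwards [h, Metric.tendsto_nhds.1 (hlim a ha) (ε / 2) (by positivity)] with i h1 h2 y hy
      rw [dist_comm] at h2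
      linarith [h1 y hy, dist_sub_sub_le (f y) (f a) (F i y) (F i a)]
    have hev := eventually_eq_zero_of_tendsto_ne_zero hV (b := w) ⟨hw, fun h => hne h.symm⟩
      (fun i => ((hFd i).mono sdiff_subset).sub_const _)
      (fun i z hz h => hz.2 ((hF i).2.2.1 hz.1 ha (sub_eq_zero.1 h))) hu'
      (sub_eq_zero.2 haw.symm)
    exact hconst (f a) ((hfd.analyticOnNhd hU).eqOn_of_preconnected_of_eventuallyEq
      analyticOnNhd_const hc hw (hev.mono fun z hz => sub_eq_zero.1 hz))
  · have hev := eventually_eq_zero_of_tendsto_ne_zero hU hb (fun i => (hFd i).deriv hU)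
      (fun i => (hF i).2.2.2.1) (hu.deriv (.of_forall hFd) hU) hb0
    exact hd0 (((hfd.deriv hU).analyticOnNhd hU).eqOn_zero_of_preconnected_of_eventuallyEq_zero
      hc hb hev h0)

/-- The Riemann mapping theorem for bounded domains. -/
theorem exists_diskEmbedding_surjOn {U : Set ℂ} (hU : IsOpen U) (hUc : IsSimplyConnected U)
    (hb : Bornology.IsBounded U) (h0 : (0 : ℂ) ∈ U) :
    ∃ f ∈ diskEmbeddings U, SurjOn f U (Metric.ball 0 1) := by
  have hbdd := bddAbove_norm_deriv_diskEmbeddings hU h0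
  have hne := diskEmbeddings_nonempty hb
  obtain ⟨u, -, hu, huS⟩ := exists_seq_tendsto_sSup (hne.image fun f : ℂ → ℂ => ‖deriv f 0‖) hbdd
  choose F hF hFu using huS
  obtain ⟨f, hf⟩ := exists_tendstoLocallyUniformlyOn_ultrafilter (hyperfilter ℕ) hU
    (fun n => (hF n).1) (fun n => (hF n).2.1)
  have hlim : Tendsto (fun n => ‖deriv (F n) 0‖) (hyperfilter ℕ : Filter ℕ) (𝓝 ‖deriv f 0‖) :=
    ((hf.deriv (.of_forall fun n => (hF n).1) hU).tendsto_at h0).norm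
  have hsup : ‖deriv f 0‖ = sSup ((fun f : ℂ → ℂ => ‖deriv f 0‖) '' diskEmbeddings U) := by
    refine tendsto_nhds_unique hlim ((hu.mono_left Nat.hyperfilter_le_atTop).congr fun n => ?_)
    exact (hFu n).symm
  have hle : ∀ g ∈ diskEmbeddings U, ‖deriv g 0‖ ≤ ‖deriv f 0‖ := fun g hg =>
    hsup ▸ le_csSup hbdd (mem_image_of_mem _ hg)
  have hd0 : deriv f 0 ≠ 0 := by
    obtain ⟨g, hg⟩ := hne
    exact norm_pos_iff.1 ((norm_pos_iff.2 (hg.2.2.2.1 0 h0)).trans_le (hle g hg))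
  have hmem := mem_diskEmbeddings_of_tendsto hU
    hUc.isPathConnected.isConnected.isPreconnected h0 hF hf hd0
  refine ⟨f, hmem, ?_⟩
  by_contra hs
  obtain ⟨G, h1, h2, h3, h4, h5, hlt⟩ := exists_deriv_lt_of_not_surjOn hU hUc h0 hmem.1 hmem.2.1
    hmem.2.2.1 hmem.2.2.2.1 hmem.2.2.2.2 hs
  exact (hle G ⟨h1, h2, h3, h4, h5⟩).not_gt hlt

/-- Riemann map from the disk onto a bounded simply connected domain. -/
theorem exists_riemann_map {U : Set ℂ} (hU : IsOpen U) (hUc : IsSimplyConnected U)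
    (hb : Bornology.IsBounded U) (h0 : (0 : ℂ) ∈ U) :
    ∃ g ψ : ℂ → ℂ, DifferentiableOn ℂ g (Metric.ball 0 1) ∧ InjOn g (Metric.ball 0 1) ∧
      g '' Metric.ball 0 1 = U ∧ g 0 = 0 ∧ (∀ z ∈ Metric.ball 0 1, deriv g z ≠ 0) ∧
      ContinuousOn ψ U ∧ MapsTo ψ U (Metric.ball 0 1) ∧ ∀ z ∈ Metric.ball 0 1, ψ (g z) = z := by
  obtain ⟨ψ, ⟨hd, hm, hinj, hd0, ψ0⟩, hs⟩ := exists_diskEmbedding_surjOn hU hUc hb h0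
  have hinv : InvOn (Function.invFunOn ψ U) ψ U (Metric.ball 0 1) :=
    ⟨hinj.leftInvOn_invFunOn, hs.rightInvOn_invFunOn⟩
  have hgm : MapsTo (Function.invFunOn ψ U) (Metric.ball 0 1) U := hs.mapsTo_invFunOn
  set g := Function.invFunOn ψ U
  have hder : ∀ z ∈ Metric.ball (0 : ℂ) 1, HasDerivAt g (deriv ψ (g z))⁻¹ z := by
    intro z hz
    have hψz := hd.differentiableAt (hU.mem_nhds (hgm hz))
    have hnhds : map ψ (𝓝 (g z)) = 𝓝 z := by
      have := ((hd.analyticAt (hU.mem_nhds (hgm hz))).hasStrictDerivAt).map_nhds_eq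
        (hd0 _ (hgm hz))
      rwa [hinv.2 hz] at this
    refine HasDerivAt.of_local_left_inverse ?_ hψz.hasDerivAt (hd0 _ (hgm hz)) ?_
    · rw [ContinuousAt, ← hnhds, tendsto_map'_iff]
      refine tendsto_id.congr' ?_
      filter_upwards [hU.mem_nhds (hgm hz)] with w hw
      exact (hinv.1 hw).symm
    · filter_upwards [Metric.isOpen_ball.mem_nhds hz] with w hw
      exact hinv.2 hw
  refine ⟨g, ψ, fun z hz => (hder z hz).differentiableAt.differentiableWithinAt,
    hinv.2.injOn, ?_, ?_, fun z hz => ?_, hd.continuousOn, hm, fun z hz => hinv.2 hz⟩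
  · refine (image_subset_iff.2 hgm).antisymm fun w hw => ⟨ψ w, hm hw, hinv.1 hw⟩
  · have := hinv.1 h0
    rwa [ψ0] at this
  · rw [(hder z hz).deriv]
    exact inv_ne_zero (hd0 _ (hgm hz))

/-- The real-linear map on `ℂ` with prescribed values at `1` and `I`. -/
noncomputable def partialsCLM (x y : ℂ) : ℂ →L[ℝ] ℂ :=
  Complex.reCLM.smulRight x + Complex.imCLM.smulRight y

theorem partialsCLM_apply (x y h : ℂ) : partialsCLM x y h = h.re * x + h.im * y := by
  simp [partialsCLM]

/-- The partial derivatives of `s` along `1` and `I` at `w` are `x` and `y`. -/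
def HasPartials (s : ℂ → ℂ) (x y w : ℂ) : Prop := HasFDerivAt s (partialsCLM x y) w

theorem hasFDerivAt_partialsCLM_iff {s : ℂ → ℂ} {L : ℂ →L[ℝ] ℂ} {x y w : ℂ}
    (hL : ∀ h, L h = h.re * x + h.im * y) : HasFDerivAt s L w ↔ HasPartials s x y w := by
  rw [HasPartials, show L = partialsCLM x y from
    ContinuousLinearMap.ext fun h => by rw [hL, partialsCLM_apply]]

theorem HasPartials.congr_partials {s : ℂ → ℂ} {x y x' y' w : ℂ} (h : HasPartials s x y w)
    (hx : x = x') (hy : y = y') : HasPartials s x' y' w := by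
  subst hx hy
  exact h

theorem hasPartials_const (c w : ℂ) : HasPartials (fun _ => c) 0 0 w :=
  (hasFDerivAt_partialsCLM_iff fun h => by simp).1 (hasFDerivAt_const c w)

theorem hasPartials_id (w : ℂ) : HasPartials (fun z => z) 1 Complex.I w :=
  (hasFDerivAt_partialsCLM_iff fun h => by simp).1 (hasFDerivAt_id w)

theorem HasPartials.add {s t : ℂ → ℂ} {x y x' y' w : ℂ} (hs : HasPartials s x y w)
    (ht : HasPartials t x' y' w) : HasPartials (fun z => s z + t z) (x + x') (y + y') w :=
  (hasFDerivAt_partialsCLM_iff fun h => by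
    simp only [add_apply, partialsCLM_apply]; ring).1 (HasFDerivAt.add hs ht)

theorem HasPartials.sub {s t : ℂ → ℂ} {x y x' y' w : ℂ} (hs : HasPartials s x y w)
    (ht : HasPartials t x' y' w) : HasPartials (fun z => s z - t z) (x - x') (y - y') w :=
  (hasFDerivAt_partialsCLM_iff fun h => by
    simp only [sub_apply, partialsCLM_apply]; ring).1 (HasFDerivAt.sub hs ht)

theorem HasPartials.mul {s t : ℂ → ℂ} {x y x' y' w : ℂ} (hs : HasPartials s x y w)
    (ht : HasPartials t x' y' w) :
    HasPartials (fun z => s z * t z) (x * t w + s w * x') (y * t w + s w * y') w :=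
  (hasFDerivAt_partialsCLM_iff fun h => by
    simp only [add_apply, smul_apply, smul_eq_mul, partialsCLM_apply]; ring).1
    (HasFDerivAt.fun_mul hs ht)

theorem HasPartials.inv {t : ℂ → ℂ} {x y w : ℂ} (ht : HasPartials t x y w) (h0 : t w ≠ 0) :
    HasPartials (fun z => (t z)⁻¹) (-x / t w ^ 2) (-y / t w ^ 2) w :=
  (hasFDerivAt_partialsCLM_iff fun h => by simp [partialsCLM_apply]; ring).1
    (((hasDerivAt_inv h0).hasFDerivAt.restrictScalars ℝ).comp w ht)

theorem HasPartials.div {s t : ℂ → ℂ} {x y x' y' w : ℂ} (hs : HasPartials s x y w)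
    (ht : HasPartials t x' y' w) (h0 : t w ≠ 0) :
    HasPartials (fun z => s z / t z) ((x * t w - s w * x') / t w ^ 2)
      ((y * t w - s w * y') / t w ^ 2) w :=
  (hs.mul (ht.inv h0)).congr_partials (by field_simp; ring) (by field_simp; ring)

theorem HasPartials.conj {s : ℂ → ℂ} {x y w : ℂ} (hs : HasPartials s x y w) :
    HasPartials (fun z => conj (s z)) (conj x) (conj y) w :=
  (hasFDerivAt_partialsCLM_iff fun h => by simp [partialsCLM_apply]).1
    (Complex.conjCLE.toContinuousLinearMap.hasFDerivAt.comp w hs)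

theorem HasPartials.sqrt {s : ℂ → ℝ} {x y : ℝ} {w : ℂ}
    (hs : HasPartials (fun z => (s z : ℂ)) x y w) (h0 : 0 < s w) :
    HasPartials (fun z => (√(s z) : ℂ)) (x / (2 * (√(s w) : ℂ))) (y / (2 * (√(s w) : ℂ))) w := by
  have h1 : HasFDerivAt s (Complex.reCLM.comp (partialsCLM x y)) w :=
    Complex.reCLM.hasFDerivAt.comp w hs
  refine (hasFDerivAt_partialsCLM_iff fun h => ?_).1
    (Complex.ofRealCLM.hasFDerivAt.comp w (h1.sqrt h0.ne'))
  simp [partialsCLM_apply]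
  ring

theorem exists_potential {X Y Xu Xv Yv : ℂ → ℂ} {V : Set ℂ} (hV : Convex ℝ V) (hVo : IsOpen V)
    (hX : ∀ w ∈ V, HasPartials X (Xu w) (Xv w) w) (hY : ∀ w ∈ V, HasPartials Y (Xv w) (Yv w) w) :
    ∃ G : ℂ → ℂ, ∀ w ∈ V, HasPartials G (X w) (Y w) w := by
  have hω : ∀ w ∈ V, HasFDerivAt (fun z => partialsCLM (X z) (Y z))
      ((ContinuousLinearMap.smulRightL ℝ ℂ ℂ Complex.reCLM).comp (partialsCLM (Xu w) (Xv w)) +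
        (ContinuousLinearMap.smulRightL ℝ ℂ ℂ Complex.imCLM).comp (partialsCLM (Xv w) (Yv w))) w :=
    fun w hw => ((ContinuousLinearMap.smulRightL ℝ ℂ ℂ Complex.reCLM).hasFDerivAt.comp w
      (hX w hw)).add ((ContinuousLinearMap.smulRightL ℝ ℂ ℂ Complex.imCLM).hasFDerivAt.comp w
      (hY w hw))
  refine hV.exists_forall_hasFDerivAt_of_fderiv_symmetric hVo
    (fun w hw => (hω w hw).differentiableAt.differentiableWithinAt) fun w hw h k => ?_
  rw [(hω w hw).fderiv]
  simp [partialsCLM_apply]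
  ring

/-- If `s - c Φ` is stationary at `w` and `Ψ` is a contracting local inverse of `Φ`, then `s ∘ Ψ`
has complex derivative `c`. -/
theorem hasDerivAt_comp_of_hasPartials {s Φ Ψ : ℂ → ℂ} {c x y w : ℂ}
    (hs : HasPartials s (c * x) (c * y) w) (hΦ : HasPartials Φ x y w) (hw : Ψ (Φ w) = w)
    (hinv : ∀ᶠ ζ in 𝓝 (Φ w), Φ (Ψ ζ) = ζ) (hexp : ∀ᶠ ζ in 𝓝 (Φ w), ‖Ψ ζ - w‖ ≤ ‖ζ - Φ w‖) :
    HasDerivAt (fun ζ => s (Ψ ζ)) c (Φ w) := by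
  have hΨ : Tendsto Ψ (𝓝 (Φ w)) (𝓝 w) := by
    rw [tendsto_iff_norm_sub_tendsto_zero]
    refine squeeze_zero' (.of_forall fun _ => norm_nonneg _) hexp ?_
    exact tendsto_iff_norm_sub_tendsto_zero.1 tendsto_id
  have h1 := (hs.sub ((hasPartials_const c w).mul hΦ)).congr_partials (x' := 0) (y' := 0)
    (by ring) (by ring)
  have h2 := (hasFDerivAt_iff_isLittleO.1 h1).comp_tendsto hΨ
  rw [hasDerivAt_iff_isLittleO]
  refine (h2.trans_isBigO (Asymptotics.IsBigO.of_bound 1 ?_)).congr' ?_ EventuallyEq.rfl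
  · filter_upwards [hexp] with ζ h
    rw [one_mul]
    exact h
  · filter_upwards [hinv] with ζ h
    simp only [Function.comp_apply, partialsCLM_apply, h, hw, smul_eq_mul]
    ring

/-- `(p, q)` is the gradient of a minimal graph over the disk whose Hessian is `(a, b; b, d)`. -/
structure IsMinimalGradient (p q a b d : ℂ → ℝ) : Prop where
  partials_p : ∀ w ∈ Metric.ball (0 : ℂ) 1, HasPartials (fun z => (p z : ℂ)) (a w) (b w) w
  partials_q : ∀ w ∈ Metric.ball (0 : ℂ) 1, HasPartials (fun z => (q z : ℂ)) (b w) (d w) w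
  equation : ∀ w ∈ Metric.ball (0 : ℂ) 1,
    (1 + q w ^ 2) * a w - 2 * p w * q w * b w + (1 + p w ^ 2) * d w = 0

/-- The area element of the graph. -/
noncomputable def areaElement (p q : ℂ → ℝ) (w : ℂ) : ℝ := √(1 + p w ^ 2 + q w ^ 2)

/-- First column of the metric divided by the area element, as a complex number. -/
noncomputable def metricFst (p q : ℂ → ℝ) (w : ℂ) : ℂ :=
  ((1 + p w * p w) + Complex.I * (p w * q w)) / areaElement p q w

/-- Second column of the metric divided by the area element, as a complex number. -/
noncomputable def metricSnd (p q : ℂ → ℝ) (w : ℂ) : ℂ :=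
  ((p w * q w) + Complex.I * (1 + q w * q w)) / areaElement p q w

/-- Stereographic projection of the (conjugate) Gauss map. -/
noncomputable def gaussStereo (p q : ℂ → ℝ) (w : ℂ) : ℂ :=
  (p w - Complex.I * q w) / (1 + areaElement p q w)

theorem areaElement_sq (p q : ℂ → ℝ) (w : ℂ) :
    areaElement p q w ^ 2 = 1 + p w ^ 2 + q w ^ 2 := Real.sq_sqrt (by positivity)

theorem one_le_areaElement (p q : ℂ → ℝ) (w : ℂ) : 1 ≤ areaElement p q w :=
  Real.one_le_sqrt.2 (by nlinarith [sq_nonneg (p w), sq_nonneg (q w)])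

theorem areaElement_ne_zero (p q : ℂ → ℝ) (w : ℂ) : (areaElement p q w : ℂ) ≠ 0 := by
  exact_mod_cast (zero_lt_one.trans_le (one_le_areaElement p q w)).ne'

theorem one_add_areaElement_ne_zero (p q : ℂ → ℝ) (w : ℂ) : (1 + areaElement p q w : ℂ) ≠ 0 := by
  have := one_le_areaElement p q w
  exact_mod_cast (by linarith : (0 : ℝ) < 1 + areaElement p q w).ne'

theorem ofReal_areaElement_sq (p q : ℂ → ℝ) (w : ℂ) :
    (areaElement p q w : ℂ) ^ 2 = 1 + (p w : ℂ) ^ 2 + (q w : ℂ) ^ 2 := by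
  exact_mod_cast congrArg (Complex.ofReal) (areaElement_sq p q w)

theorem metricFst_re (p q : ℂ → ℝ) (w : ℂ) :
    (metricFst p q w).re = (1 + p w ^ 2) / areaElement p q w := by
  rw [metricFst, Complex.div_ofReal_re]
  simp [sq]

theorem metricFst_im (p q : ℂ → ℝ) (w : ℂ) :
    (metricFst p q w).im = p w * q w / areaElement p q w := by
  rw [metricFst, Complex.div_ofReal_im]
  simp

theorem metricSnd_re (p q : ℂ → ℝ) (w : ℂ) :
    (metricSnd p q w).re = p w * q w / areaElement p q w := by
  rw [metricSnd, Complex.div_ofReal_re]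
  simp

theorem metricSnd_im (p q : ℂ → ℝ) (w : ℂ) :
    (metricSnd p q w).im = (1 + q w ^ 2) / areaElement p q w := by
  rw [metricSnd, Complex.div_ofReal_im]
  simp [sq]

theorem one_add_metricFst_ne_zero (p q : ℂ → ℝ) (w : ℂ) : 1 + metricFst p q w ≠ 0 := by
  intro h
  have h1 := congrArg Complex.re h
  rw [Complex.add_re, metricFst_re, Complex.one_re, Complex.zero_re] at h1
  have := zero_lt_one.trans_le (one_le_areaElement p q w)
  have : 0 < (1 + p w ^ 2) / areaElement p q w := by positivity
  linarith

/-- The metric is positive definite. -/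
theorem metric_pos (p q : ℂ → ℝ) (w : ℂ) {h : ℂ} (hh : h ≠ 0) :
    0 < h.re * (partialsCLM (metricFst p q w) (metricSnd p q w) h).re +
      h.im * (partialsCLM (metricFst p q w) (metricSnd p q w) h).im := by
  have hW := zero_lt_one.trans_le (one_le_areaElement p q w)
  have h1 : 0 < h.re ^ 2 + h.im ^ 2 := by
    have := Complex.normSq_pos.2 hh
    rw [Complex.normSq_apply] at this
    nlinarith
  have : h.re * (partialsCLM (metricFst p q w) (metricSnd p q w) h).re +
      h.im * (partialsCLM (metricFst p q w) (metricSnd p q w) h).im =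
      (h.re ^ 2 + h.im ^ 2 + (p w * h.re + q w * h.im) ^ 2) / areaElement p q w := by
    rw [partialsCLM_apply, Complex.add_re, Complex.add_im, Complex.re_ofReal_mul,
      Complex.re_ofReal_mul, Complex.im_ofReal_mul, Complex.im_ofReal_mul, metricFst_re,
      metricFst_im, metricSnd_re, metricSnd_im]
    ring
  rw [this]
  positivity

theorem norm_gaussStereo_sq (p q : ℂ → ℝ) (w : ℂ) :
    ‖gaussStereo p q w‖ ^ 2 = (areaElement p q w - 1) / (areaElement p q w + 1) := by
  have hW := one_le_areaElement p q w
  have h1 := areaElement_sq p q w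
  have h2 : ‖(p w - Complex.I * q w : ℂ)‖ ^ 2 = p w ^ 2 + q w ^ 2 := by
    rw [← Complex.normSq_eq_norm_sq, Complex.normSq_apply]
    simp
    ring
  have h3 : ‖(1 + areaElement p q w : ℂ)‖ = 1 + areaElement p q w := by
    have : (1 + areaElement p q w : ℂ) = ((1 + areaElement p q w : ℝ) : ℂ) := by push_cast; rfl
    rw [this, Complex.norm_real, norm_of_nonneg (by linarith)]
  rw [gaussStereo, norm_div, div_pow, h2, h3, div_eq_div_iff (by positivity) (by positivity)]
  linear_combination (-(areaElement p q w + 1)) * h1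

theorem norm_gaussStereo_lt_one (p q : ℂ → ℝ) (w : ℂ) : ‖gaussStereo p q w‖ < 1 := by
  have hW := one_le_areaElement p q w
  refine lt_of_pow_lt_pow_left₀ 2 zero_le_one ?_
  rw [norm_gaussStereo_sq, one_pow, div_lt_one (by linarith)]
  linarith

/-- The Beltrami-type relation between the metric and the Gauss map, first column. -/
theorem conj_one_sub_metricFst (p q : ℂ → ℝ) (w : ℂ) :
    conj (1 - metricFst p q w) = -(gaussStereo p q w) ^ 2 * (1 + metricFst p q w) := by
  have h0 := areaElement_ne_zero p q w
  have h1 := one_add_areaElement_ne_zero p q w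
  have h2 := ofReal_areaElement_sq p q w
  have h3 := Complex.I_sq
  simp only [metricFst, gaussStereo, map_sub, map_one, map_div₀, map_add, map_mul,
    Complex.conj_ofReal, Complex.conj_I]
  generalize (areaElement p q w : ℂ) = W at *
  field_simp
  grind

theorem conj_I_sub_metricSnd (p q : ℂ → ℝ) (w : ℂ) :
    conj (Complex.I - metricSnd p q w) =
      -(gaussStereo p q w) ^ 2 * (Complex.I + metricSnd p q w) := by
  have h0 := areaElement_ne_zero p q w
  have h1 := one_add_areaElement_ne_zero p q w
  have h2 := ofReal_areaElement_sq p q w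
  have h3 := Complex.I_sq
  simp only [metricSnd, gaussStereo, map_sub, map_one, map_div₀, map_add, map_mul,
    Complex.conj_ofReal, Complex.conj_I]
  generalize (areaElement p q w : ℂ) = W at *
  field_simp
  grind

namespace IsMinimalGradient

theorem partials_areaElement {p q a b d : ℂ → ℝ} (h : IsMinimalGradient p q a b d) {w : ℂ}
    (hw : w ∈ Metric.ball (0 : ℂ) 1) :
    HasPartials (fun z => (areaElement p q z : ℂ)) ((p w * a w + q w * b w) / areaElement p q w)
      ((p w * b w + q w * d w) / areaElement p q w) w := by
  have hp := h.partials_p w hw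
  have hq := h.partials_q w hw
  have h1 : HasPartials (fun z => ((1 + p z ^ 2 + q z ^ 2 : ℝ) : ℂ))
      ((2 * (p w * a w + q w * b w) : ℝ) : ℂ) ((2 * (p w * b w + q w * d w) : ℝ) : ℂ) w := by
    have := (((hasPartials_const 1 w).add (hp.mul hp)).add (hq.mul hq)).congr_partials
      (x' := ((2 * (p w * a w + q w * b w) : ℝ) : ℂ)) (y' := ((2 * (p w * b w + q w * d w) : ℝ) : ℂ))
      (by push_cast; ring) (by push_cast; ring)
    refine this.congr_of_eventuallyEq (.of_forall fun z => ?_)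
    push_cast
    ring
  refine (h1.sqrt (by positivity)).congr_partials ?_ ?_ <;>
  · rw [areaElement]
    push_cast
    rw [mul_div_mul_left _ _ two_ne_zero]

theorem equation_ofReal {p q a b d : ℂ → ℝ} (h : IsMinimalGradient p q a b d) {w : ℂ}
    (hw : w ∈ Metric.ball (0 : ℂ) 1) :
    (1 + (q w : ℂ) ^ 2) * a w - 2 * p w * q w * b w + (1 + (p w : ℂ) ^ 2) * d w = 0 := by
  exact_mod_cast congrArg (Complex.ofReal) (h.equation w hw)

/-- Potential of the divergence-free fields of the minimal surface equation. -/
theorem exists_jorgens_potential {p q a b d : ℂ → ℝ} (h : IsMinimalGradient p q a b d) :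
    ∃ G : ℂ → ℂ, G 0 = 0 ∧
      ∀ w ∈ Metric.ball (0 : ℂ) 1, HasPartials G (metricFst p q w) (metricSnd p q w) w := by
  have hX := fun w (hw : w ∈ Metric.ball (0 : ℂ) 1) =>
    (((hasPartials_const 1 w).add ((h.partials_p w hw).mul (h.partials_p w hw))).add
      ((hasPartials_const Complex.I w).mul ((h.partials_p w hw).mul (h.partials_q w hw)))).div
      (h.partials_areaElement hw) (areaElement_ne_zero p q w)
  have hY := fun w (hw : w ∈ Metric.ball (0 : ℂ) 1) =>
    (((h.partials_p w hw).mul (h.partials_q w hw)).add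
      ((hasPartials_const Complex.I w).mul ((hasPartials_const 1 w).add
        ((h.partials_q w hw).mul (h.partials_q w hw))))).div
      (h.partials_areaElement hw) (areaElement_ne_zero p q w)
  obtain ⟨G, hG⟩ := exists_potential (convex_ball (0 : ℂ) 1) Metric.isOpen_ball hX
    (fun w hw => (hY w hw).congr_partials (by
      have h0 := areaElement_ne_zero p q w
      have h2 := ofReal_areaElement_sq p q w
      have h3 := h.equation_ofReal hw
      generalize (areaElement p q w : ℂ) = W at *
      field_simp
      rw [h2]
      linear_combination (q w - Complex.I * p w) * h3) rfl)
  exact ⟨fun w => G w - G 0, sub_self _, fun w hw =>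
    ((hG w hw).sub (hasPartials_const (G 0) w)).congr_partials (sub_zero _) (sub_zero _)⟩

end IsMinimalGradient

theorem im_conj_mul_mul (c m n : ℂ) :
    (conj (c * m) * (c * n)).im = ‖c‖ ^ 2 * (conj m * n).im := by
  rw [← Complex.normSq_eq_norm_sq, ← Complex.im_ofReal_mul, Complex.normSq_eq_conj_mul_self,
    map_mul]
  congr 1
  ring

theorem im_conj_metric (p q : ℂ → ℝ) (w : ℂ) :
    (conj (1 + metricFst p q w) * (Complex.I + metricSnd p q w)).im =
      (1 + areaElement p q w) ^ 2 / areaElement p q w := by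
  have hW := zero_lt_one.trans_le (one_le_areaElement p q w)
  have h2 := areaElement_sq p q w
  rw [Complex.mul_im, Complex.conj_re, Complex.conj_im, Complex.add_re, Complex.add_im,
    Complex.add_re, Complex.add_im, metricFst_re, metricFst_im, metricSnd_re, metricSnd_im]
  simp only [Complex.one_re, Complex.one_im, Complex.I_re, Complex.I_im]
  field_simp
  linear_combination (-(areaElement p q w + 1)) * h2

namespace IsMinimalGradient

/-- The Gauss map is conformal for the metric of the Jörgens coordinate, with dilation determined
by the Hessian. -/
theorem exists_gauss_dilation {p q a b d : ℂ → ℝ} (h : IsMinimalGradient p q a b d) {w : ℂ}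
    (hw : w ∈ Metric.ball (0 : ℂ) 1) :
    ∃ c : ℂ, HasPartials (gaussStereo p q) (c * (1 + metricFst p q w))
      (c * (Complex.I + metricSnd p q w)) w ∧
      ‖c‖ ^ 2 * (1 + areaElement p q w) ^ 4 = |a w * d w - b w ^ 2| := by
  have hS := ((h.partials_p w hw).sub ((hasPartials_const Complex.I w).mul
    (h.partials_q w hw))).div ((hasPartials_const 1 w).add (h.partials_areaElement hw))
    (one_add_areaElement_ne_zero p q w)
  have hWr := zero_lt_one.trans_le (one_le_areaElement p q w)
  have hW2r := areaElement_sq p q w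
  have him := im_conj_metric p q w
  set W := areaElement p q w with hWdef
  set xr := (a w * (1 + W) - p w * ((p w * a w + q w * b w) / W)) / (1 + W) ^ 2 with hxr
  set xi := (b w * (1 + W) - q w * ((p w * a w + q w * b w) / W)) / (1 + W) ^ 2 with hxi
  set yr := (b w * (1 + W) - p w * ((p w * b w + q w * d w) / W)) / (1 + W) ^ 2 with hyr
  set yi := (d w * (1 + W) - q w * ((p w * b w + q w * d w) / W)) / (1 + W) ^ 2 with hyi
  have hS' : HasPartials (gaussStereo p q) (xr - Complex.I * xi) (yr - Complex.I * yi) w :=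
    hS.congr_partials (by rw [hxr, hxi]; push_cast; ring) (by rw [hyr, hyi]; push_cast; ring)
  have hX0 := one_add_metricFst_ne_zero p q w
  have hx : (xr - Complex.I * xi : ℂ) =
      (xr - Complex.I * xi) / (1 + metricFst p q w) * (1 + metricFst p q w) := by
    field_simp
  have hy : (yr - Complex.I * yi : ℂ) =
      (xr - Complex.I * xi) / (1 + metricFst p q w) * (Complex.I + metricSnd p q w) := by
    rw [div_mul_eq_mul_div, eq_div_iff hX0, metricFst, metricSnd, ← hWdef, hxr, hxi, hyr, hyi]
    have h0 : (W : ℂ) ≠ 0 := areaElement_ne_zero p q w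
    have h1 : (1 + W : ℂ) ≠ 0 := one_add_areaElement_ne_zero p q w
    have h2 : (W : ℂ) ^ 2 = _ := ofReal_areaElement_sq p q w
    have h3 := h.equation_ofReal hw
    have h4 := Complex.I_sq
    push_cast
    field_simp
    grind
  refine ⟨(xr - Complex.I * xi) / (1 + metricFst p q w), hS'.congr_partials hx hy, ?_⟩
  have key := im_conj_mul_mul ((xr - Complex.I * xi) / (1 + metricFst p q w))
    (1 + metricFst p q w) (Complex.I + metricSnd p q w)
  rw [← hx, ← hy, him] at key
  have hdet : (conj (xr - Complex.I * xi : ℂ) * (yr - Complex.I * yi)).im =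
      -((a w * d w - b w ^ 2) / (W * (1 + W) ^ 2)) := by
    have : (conj (xr - Complex.I * xi : ℂ) * (yr - Complex.I * yi)).im = xi * yr - xr * yi := by
      simp
      ring
    rw [this, hxr, hxi, hyr, hyi]
    field_simp
    grind
  rw [hdet] at key
  have h5 : 0 ≤ ‖(xr - Complex.I * xi) / (1 + metricFst p q w)‖ ^ 2 * (1 + W) ^ 4 := by positivity
  rw [← abs_of_nonneg h5, ← abs_neg]
  congr 1
  field_simp at key ⊢
  linear_combination key


end IsMinimalGradient

theorem norm_add_sq_sub_norm_sub_sq (x y : ℂ) :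
    ‖x + y‖ ^ 2 - ‖x - y‖ ^ 2 = 4 * (x.re * y.re + x.im * y.im) := by
  simp only [← Complex.normSq_eq_norm_sq, Complex.normSq_apply, Complex.add_re, Complex.add_im,
    Complex.sub_re, Complex.sub_im]
  ring

theorem norm_le_norm_add {x y : ℂ} (h : 0 ≤ x.re * y.re + x.im * y.im) : ‖x‖ ≤ ‖x + y‖ := by
  refine (pow_le_pow_iff_left₀ (norm_nonneg _) (norm_nonneg _) two_ne_zero).1 ?_
  simp only [← Complex.normSq_eq_norm_sq, Complex.normSq_apply, Complex.add_re, Complex.add_im]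
  nlinarith [mul_self_nonneg y.re, mul_self_nonneg y.im]

/-- A map whose differential is positive definite on a convex set is strictly monotone. -/
theorem sub_mul_sub_pos_of_partials {G X Y : ℂ → ℂ} {V : Set ℂ} (hV : Convex ℝ V)
    (hG : ∀ w ∈ V, HasPartials G (X w) (Y w) w)
    (hpos : ∀ w ∈ V, ∀ h : ℂ, h ≠ 0 →
      0 < h.re * (partialsCLM (X w) (Y w) h).re + h.im * (partialsCLM (X w) (Y w) h).im)
    {w₁ w₂ : ℂ} (h₁ : w₁ ∈ V) (h₂ : w₂ ∈ V) (hne : w₁ ≠ w₂) :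
    0 < (w₁ - w₂).re * (G w₁ - G w₂).re + (w₁ - w₂).im * (G w₁ - G w₂).im := by
  set h := w₁ - w₂ with hh
  have hmem : ∀ t ∈ Icc (0 : ℝ) 1, w₂ + t * h ∈ V := fun t ht => by
    have := hV.add_smul_sub_mem h₂ h₁ ht
    rwa [Complex.real_smul] at this
  have hder : ∀ t ∈ Icc (0 : ℝ) 1, HasDerivAt
      (fun t : ℝ => h.re * (G (w₂ + t * h)).re + h.im * (G (w₂ + t * h)).im)
      (h.re * (partialsCLM (X (w₂ + t * h)) (Y (w₂ + t * h)) h).re +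
        h.im * (partialsCLM (X (w₂ + t * h)) (Y (w₂ + t * h)) h).im) t := by
    intro t ht
    have hline : HasDerivAt (fun t : ℝ => w₂ + t * h) h t := by
      simpa using ((Complex.ofRealCLM.hasDerivAt (x := t)).mul_const h).const_add w₂
    have hcomp := HasFDerivAt.comp_hasDerivAt t (hG _ (hmem t ht)) hline
    exact ((Complex.reCLM.hasFDerivAt.comp_hasDerivAt t hcomp).const_mul h.re).add
      ((Complex.imCLM.hasFDerivAt.comp_hasDerivAt t hcomp).const_mul h.im)
  obtain ⟨c, hc, hceq⟩ := exists_hasDerivAt_eq_slope _ _ zero_lt_one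
    (fun t ht => (hder t ht).continuousAt.continuousWithinAt)
    (fun t ht => hder t (Ioo_subset_Icc_self ht))
  have := hpos _ (hmem c (Ioo_subset_Icc_self hc)) h (sub_ne_zero.2 hne)
  rw [hceq] at this
  simp only [Complex.ofReal_one, Complex.ofReal_zero, one_mul, zero_mul, add_zero, sub_zero,
    div_one] at this
  rw [hh, add_sub_cancel, ← hh] at this
  rw [Complex.sub_re (G w₁), Complex.sub_im (G w₁)]
  linarith

theorem isSimplyConnected_image_of_convex {Φ Ψ : ℂ → ℂ} {V : Set ℂ} (hV : Convex ℝ V)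
    (hne : V.Nonempty) (hΦ : ContinuousOn Φ V) (hΨ : ContinuousOn Ψ (Φ '' V))
    (hinv : ∀ w ∈ V, Ψ (Φ w) = w) : IsSimplyConnected (Φ '' V) := by
  have hΨm : MapsTo Ψ (Φ '' V) V := by
    rintro _ ⟨w, hw, rfl⟩
    rwa [hinv w hw]
  let e : V ≃ₜ Φ '' V :=
    { toFun := fun w => ⟨Φ w, mem_image_of_mem _ w.2⟩
      invFun := fun ζ => ⟨Ψ ζ, hΨm ζ.2⟩
      left_inv := fun w => Subtype.ext (hinv w w.2)
      right_inv := by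
        rintro ⟨_, w, hw, rfl⟩
        exact Subtype.ext (congrArg Φ (hinv w hw))
      continuous_toFun := (continuousOn_iff_continuous_domRestrict.1 hΦ).subtype_mk _
      continuous_invFun := (continuousOn_iff_continuous_domRestrict.1 hΨ).subtype_mk _ }
  have : ContractibleSpace V := hV.contractibleSpace hne
  have : ContractibleSpace (Φ '' V) := e.symm.contractibleSpace
  exact SimplyConnectedSpace.ofContractible _

/-- The isothermal coordinate of Jörgens: `Φ` flattens the graph, `Ψ` is its inverse, the height
projection is `(ζ + conj (H ζ)) / 2`, and `S` is the Gauss map, with `-S²` the derivative of `H`. -/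
theorem IsMinimalGradient.exists_jorgens_coordinate {p q a b d : ℂ → ℝ}
    (h : IsMinimalGradient p q a b d) :
    ∃ Φ Ψ H S : ℂ → ℂ, Φ 0 = 0 ∧ ContinuousOn Φ (Metric.ball 0 1) ∧
      (∀ w ∈ Metric.ball (0 : ℂ) 1, map Φ (𝓝 w) = 𝓝 (Φ w)) ∧
      (∀ w ∈ Metric.ball (0 : ℂ) 1, Ψ (Φ w) = w) ∧
      ContinuousOn Ψ (Φ '' Metric.ball 0 1) ∧
      (∀ w ∈ Metric.ball (0 : ℂ) 1, HasDerivAt H (-(S (Φ w)) ^ 2) (Φ w)) ∧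
      (∀ w ∈ Metric.ball (0 : ℂ) 1, Φ w + conj (H (Φ w)) = 2 * w) ∧
      (∀ w ∈ Metric.ball (0 : ℂ) 1, w ≠ 0 → ‖H (Φ w)‖ < ‖Φ w‖) ∧
      (∀ w ∈ Metric.ball (0 : ℂ) 1, DifferentiableAt ℂ S (Φ w)) ∧
      (∀ w ∈ Metric.ball (0 : ℂ) 1, S (Φ w) = gaussStereo p q w) ∧
      ‖deriv S 0‖ ^ 2 * (1 + areaElement p q 0) ^ 4 = |a 0 * d 0 - b 0 ^ 2| := by
  obtain ⟨G, G0, hG⟩ := h.exists_jorgens_potential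
  have hmono : ∀ w₁ ∈ Metric.ball (0 : ℂ) 1, ∀ w₂ ∈ Metric.ball (0 : ℂ) 1, w₁ ≠ w₂ →
      0 < (w₁ - w₂).re * (G w₁ - G w₂).re + (w₁ - w₂).im * (G w₁ - G w₂).im :=
    fun w₁ h₁ w₂ h₂ hne => sub_mul_sub_pos_of_partials (convex_ball 0 1) hG
      (fun w _ h hh => metric_pos p q w hh) h₁ h₂ hne
  have h0 : (0 : ℂ) ∈ Metric.ball (0 : ℂ) 1 := Metric.mem_ball_self one_pos
  set Φ : ℂ → ℂ := fun w => w + G w with hΦdef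
  have hΦp : ∀ w ∈ Metric.ball (0 : ℂ) 1,
      HasPartials Φ (1 + metricFst p q w) (Complex.I + metricSnd p q w) w :=
    fun w hw => (hasPartials_id w).add (hG w hw)
  have hexp : ∀ w₁ ∈ Metric.ball (0 : ℂ) 1, ∀ w₂ ∈ Metric.ball (0 : ℂ) 1,
      ‖w₁ - w₂‖ ≤ ‖Φ w₁ - Φ w₂‖ := by
    intro w₁ h₁ w₂ h₂
    rcases eq_or_ne w₁ w₂ with rfl | hne
    · simp
    · rw [hΦdef, add_sub_add_comm]
      exact norm_le_norm_add (hmono w₁ h₁ w₂ h₂ hne).le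
  have hinj : InjOn Φ (Metric.ball 0 1) := fun w₁ h₁ w₂ h₂ he => by
    have := hexp w₁ h₁ w₂ h₂
    rw [he, sub_self, norm_zero] at this
    exact sub_eq_zero.1 (norm_le_zero_iff.1 this)
  have hΦc : ContinuousOn Φ (Metric.ball 0 1) := fun w hw =>
    (HasFDerivAt.continuousAt (hΦp w hw)).continuousWithinAt
  have hmap : ∀ w ∈ Metric.ball (0 : ℂ) 1, map Φ (𝓝 w) = 𝓝 (Φ w) := by
    intro w hw
    have hcont : ContinuousAt (fun z => partialsCLM (1 + metricFst p q z)
        (Complex.I + metricSnd p q z)) w := by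
      have hp := (h.partials_p w hw).continuousAt
      have hq := (h.partials_q w hw).continuousAt
      have hW := (h.partials_areaElement hw).continuousAt
      have hW0 := areaElement_ne_zero p q w
      have hX : ContinuousAt (metricFst p q) w := by
        unfold metricFst
        exact ((continuousAt_const.add (hp.mul hp)).add
          (continuousAt_const.mul (hp.mul hq))).div hW hW0
      have hY : ContinuousAt (metricSnd p q) w := by
        unfold metricSnd
        exact ((hp.mul hq).add (continuousAt_const.mul
          (continuousAt_const.add (hq.mul hq)))).div hW hW0
      exact ((ContinuousLinearMap.smulRightL ℝ ℂ ℂ Complex.reCLM).continuous.continuousAt.comp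
        (continuousAt_const.add hX)).add
        ((ContinuousLinearMap.smulRightL ℝ ℂ ℂ Complex.imCLM).continuous.continuousAt.comp
        (continuousAt_const.add hY))
    refine (hasStrictFDerivAt_of_hasFDerivAt_of_continuousAt (f' := fun z =>
      partialsCLM (1 + metricFst p q z) (Complex.I + metricSnd p q z)) ?_ hcont).map_nhds_eq_of_surj ?_
    · filter_upwards [Metric.isOpen_ball.mem_nhds hw] with z hz
      exact hΦp z hz
    · rw [LinearMap.range_eq_top, ← LinearMap.injective_iff_surjective, injective_iff_map_eq_zero]
      intro k hk
      by_contra hk0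
      have h1 := metric_pos p q w hk0
      have h2 : k + partialsCLM (metricFst p q w) (metricSnd p q w) k = 0 := by
        rw [← hk, ContinuousLinearMap.coe_coe, partialsCLM_apply, partialsCLM_apply]
        nth_rewrite 1 [← Complex.re_add_im k]
        ring
      rw [← neg_eq_iff_add_eq_zero.2 h2] at h1
      simp only [Complex.neg_re, Complex.neg_im] at h1
      nlinarith [mul_self_nonneg k.re, mul_self_nonneg k.im]
  set Ψ := Function.invFunOn Φ (Metric.ball 0 1)
  have hΨ : ∀ w ∈ Metric.ball (0 : ℂ) 1, Ψ (Φ w) = w := hinj.leftInvOn_invFunOn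
  have hnhds : ∀ w ∈ Metric.ball (0 : ℂ) 1, Φ '' Metric.ball 0 1 ∈ 𝓝 (Φ w) := fun w hw => by
    rw [← hmap w hw]
    exact image_mem_map (Metric.isOpen_ball.mem_nhds hw)
  have hlip : ∀ w ∈ Metric.ball (0 : ℂ) 1, ∀ ζ ∈ Φ '' Metric.ball 0 1,
      ‖Ψ ζ - w‖ ≤ ‖ζ - Φ w‖ := by
    rintro w hw _ ⟨z, hz, rfl⟩
    rw [hΨ z hz]
    exact hexp z hz w hw
  have htrans : ∀ (s : ℂ → ℂ) (c w : ℂ), w ∈ Metric.ball (0 : ℂ) 1 →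
      HasPartials s (c * (1 + metricFst p q w)) (c * (Complex.I + metricSnd p q w)) w →
      HasDerivAt (fun ζ => s (Ψ ζ)) c (Φ w) := by
    intro s c w hw hs
    refine hasDerivAt_comp_of_hasPartials hs (hΦp w hw) (hΨ w hw) ?_ ?_
    · filter_upwards [hnhds w hw]
      rintro _ ⟨z, hz, rfl⟩
      rw [hΨ z hz]
    · filter_upwards [hnhds w hw] with ζ hζ
      exact hlip w hw ζ hζ
  have hΦ0 : Φ 0 = 0 := by simp [hΦdef, G0]
  refine ⟨Φ, Ψ, fun ζ => conj (Ψ ζ - G (Ψ ζ)), fun ζ => gaussStereo p q (Ψ ζ), hΦ0, hΦc, hmap, hΨ,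
    ?_, fun w hw => ?_, fun w hw => ?_, fun w hw hw0 => ?_, fun w hw => ?_, fun w hw => ?_, ?_⟩
  · rintro _ ⟨w, hw, rfl⟩
    rw [Metric.continuousWithinAt_iff]
    refine fun ε hε => ⟨ε, hε, fun {ζ} hζ hd => ?_⟩
    rw [hΨ w hw, dist_eq_norm]
    rw [dist_eq_norm] at hd
    exact (hlip w hw ζ hζ).trans_lt hd
  · beta_reduce
    rw [hΨ w hw]
    refine htrans (fun z => conj (z - G z)) _ w hw ?_
    exact ((hasPartials_id w).sub (hG w hw)).conj.congr_partials
      (conj_one_sub_metricFst p q w) (conj_I_sub_metricSnd p q w)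
  · beta_reduce
    rw [hΨ w hw, Complex.conj_conj]
    simp only [hΦdef]
    ring
  · have h1 := hmono w hw 0 h0 hw0
    rw [G0, sub_zero, sub_zero] at h1
    beta_reduce
    rw [hΨ w hw, Complex.norm_conj]
    refine lt_of_pow_lt_pow_left₀ 2 (norm_nonneg _) ?_
    have h2 := norm_add_sq_sub_norm_sub_sq w (G w)
    simp only [hΦdef]
    linarith
  · obtain ⟨c, hc, -⟩ := h.exists_gauss_dilation hw
    exact (htrans _ c w hw hc).differentiableAt
  · beta_reduce
    rw [hΨ w hw]
  · obtain ⟨c, hc, hcd⟩ := h.exists_gauss_dilation h0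
    have := htrans _ c 0 h0 hc
    rw [hΦ0] at this
    rw [this.deriv, hcd]

theorem IsMinimalGradient.hessian_bound_of_lt_one {p q a b d : ℂ → ℝ}
    (h : IsMinimalGradient p q a b d) {r : ℝ} (hr : 1 / 2 < r) (hr1 : r < 1) :
    |a 0 * d 0 - b 0 ^ 2| * (27 * r ^ 2) ≤ 16 * π ^ 2 * areaElement p q 0 ^ 2 := by
  obtain ⟨Φ, Ψ, H, S, Φ0, hΦc, hmap, hΨ, hΨc, hH, hΦH, hHlt, hSd, hS, hcurv⟩ :=
    h.exists_jorgens_coordinate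
  have hr0 : 0 < r := by linarith
  have hsub : Metric.ball (0 : ℂ) r ⊆ Metric.ball 0 1 := Metric.ball_subset_ball hr1.le
  have h0 : (0 : ℂ) ∈ Metric.ball (0 : ℂ) 1 := Metric.mem_ball_self one_pos
  have hUo : IsOpen (Φ '' Metric.ball 0 r) := by
    refine isOpen_iff_mem_nhds.2 ?_
    rintro _ ⟨w, hw, rfl⟩
    rw [← hmap w (hsub hw)]
    exact image_mem_map (Metric.isOpen_ball.mem_nhds hw)
  have hUc : IsSimplyConnected (Φ '' Metric.ball 0 r) :=
    isSimplyConnected_image_of_convex (convex_ball 0 r) (Metric.nonempty_ball.2 hr0)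
      (hΦc.mono hsub) (hΨc.mono (image_mono hsub)) fun w hw => hΨ w (hsub hw)
  have hUb : Bornology.IsBounded (Φ '' Metric.ball 0 r) :=
    (((isCompact_closedBall (0 : ℂ) r).image_of_continuousOn
      (hΦc.mono (Metric.closedBall_subset_ball hr1))).isBounded).subset
      (image_mono Metric.ball_subset_closedBall)
  obtain ⟨g, ψ, hgd, hginj, hgU, g0, hgd0, hψc, hψm, hψg⟩ := exists_riemann_map hUo hUc hUb
    ⟨0, Metric.mem_ball_self hr0, Φ0⟩
  have hlift : ∀ z ∈ Metric.ball (0 : ℂ) 1, ∃ w ∈ Metric.ball (0 : ℂ) r, Φ w = g z :=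
    fun z hz => (hgU ▸ mem_image_of_mem g hz : g z ∈ Φ '' Metric.ball 0 r)
  have hgder : ∀ z ∈ Metric.ball (0 : ℂ) 1, HasDerivAt g (deriv g z) z := fun z hz =>
    (hgd.differentiableAt (Metric.isOpen_ball.mem_nhds hz)).hasDerivAt
  have hkder : ∀ z ∈ Metric.ball (0 : ℂ) 1,
      HasDerivAt (fun z => H (g z)) (-(S (g z)) ^ 2 * deriv g z) z := fun z hz => by
    obtain ⟨w, hw, hwz⟩ := hlift z hz
    have := hH w (hsub hw)
    rw [hwz] at this
    exact this.comp z (hgder z hz)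
  have hS1 : ∀ z ∈ Metric.ball (0 : ℂ) 1, ‖S (g z)‖ < 1 := fun z hz => by
    obtain ⟨w, hw, hwz⟩ := hlift z hz
    rw [← hwz, hS w (hsub hw)]
    exact norm_gaussStereo_lt_one p q w
  have hH0 : H 0 = 0 := by
    have := hΦH 0 h0
    rwa [Φ0, zero_add, mul_zero, map_eq_zero] at this
  have hB := le_norm_deriv_sq_add (g := g) (k := fun z => H (g z)) (R := 2 * r) (by linarith) hgd
    (fun z hz => (hkder z hz).differentiableAt.differentiableWithinAt) hginj (by rwa [hgU]) g0
    (by rw [g0, hH0]) (hgd0 0 h0)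
    (fun z hz hz0 => by
      obtain ⟨w, hw, hwz⟩ := hlift z hz
      rw [← hwz]
      refine hHlt w (hsub hw) ?_
      rintro rfl
      exact hz0 (hginj hz h0 (by rw [← hwz, Φ0, g0])))
    (fun z hz => by
      rw [(hkder z hz).deriv, norm_mul, norm_neg, norm_pow]
      exact mul_le_of_le_one_left (norm_nonneg _) (pow_le_one₀ (norm_nonneg _) (hS1 z hz).le))
    (fun z hz => by
      obtain ⟨w, hw, hwz⟩ := hlift z hz
      rw [← hwz, hΦH w (hsub hw), norm_mul, Complex.norm_two]
      have := mem_ball_zero_iff.1 hw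
      linarith)
    (fun M hM => by
      have hM2 : Metric.closedBall (0 : ℂ) (M / 2) ⊆ Metric.ball 0 r :=
        Metric.closedBall_subset_ball (by linarith)
      have hK : IsCompact (ψ '' (Φ '' Metric.closedBall 0 (M / 2))) :=
        ((isCompact_closedBall (0 : ℂ) (M / 2)).image_of_continuousOn
          (hΦc.mono (hM2.trans hsub))).image_of_continuousOn (hψc.mono (image_mono hM2))
      obtain ⟨ρ, hρ1, hρ⟩ := exists_lt_subset_ball hK.isClosed
        ((image_mono (image_mono hM2)).trans hψm.image_subset)
      refine ⟨ρ, hρ1, fun z hz hzρ => ?_⟩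
      obtain ⟨w, hw, hwz⟩ := hlift z hz
      rw [← hwz, hΦH w (hsub hw), norm_mul, Complex.norm_two]
      by_contra! hlt
      refine hzρ.not_gt (mem_ball_zero_iff.1 (hρ ⟨g z, ⟨w, ?_, hwz⟩, hψg z hz⟩))
      rw [mem_closedBall_zero_iff]
      linarith)
  have hSg : ∀ z ∈ Metric.ball (0 : ℂ) 1,
      HasDerivAt (fun z => S (g z)) (deriv S (g z) * deriv g z) z := fun z hz => by
    obtain ⟨w, hw, hwz⟩ := hlift z hz
    have := hSd w (hsub hw)
    rw [hwz] at this
    exact this.hasDerivAt.comp z (hgder z hz)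
  have hSP := norm_deriv_zero_le_one_sub_sq
    (fun z hz => (hSg z hz).differentiableAt.differentiableWithinAt)
    (fun z hz => mem_ball_zero_iff.2 (hS1 z hz))
  have hS0 : S 0 = gaussStereo p q 0 := by
    have := hS 0 h0
    rwa [Φ0] at this
  have hσ := norm_gaussStereo_sq p q 0
  rw [(hSg 0 h0).deriv, g0, norm_mul, hS0, hσ] at hSP
  rw [(hkder 0 h0).deriv, g0, norm_mul, norm_neg, norm_pow, hS0, hσ] at hB
  rw [← hcurv]
  have hW := one_le_areaElement p q 0
  have hg0 := norm_pos_iff.2 (hgd0 0 h0)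
  generalize areaElement p q 0 = W at *
  generalize ‖deriv g 0‖ = t at *
  have hc := norm_nonneg (deriv S 0)
  generalize ‖deriv S 0‖ = c at *
  have e1 : 1 - (W - 1) / (W + 1) = 2 / (W + 1) := by field_simp; ring
  rw [e1, le_div_iff₀ (by linarith)] at hSP
  have e2 : t ^ 2 + ((W - 1) / (W + 1) * t) ^ 2 = t ^ 2 * (2 * (W ^ 2 + 1)) / (W + 1) ^ 2 := by
    field_simp
    ring
  rw [e2, div_le_div_iff₀ (by positivity) (by positivity)] at hB
  have hSP2 : (c * t * (W + 1)) ^ 2 ≤ 2 ^ 2 := pow_le_pow_left₀ (by positivity) hSP 2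
  have h1 := mul_le_mul_of_nonneg_left hB (by positivity : 0 ≤ c ^ 2 * (W + 1) ^ 2)
  have h2 := mul_le_mul_of_nonneg_left hSP2 (by positivity : 0 ≤ 8 * π ^ 2 * (W ^ 2 + 1))
  have h3 : 0 ≤ π ^ 2 * (W ^ 2 - 1) := mul_nonneg (by positivity) (by nlinarith)
  linarith

theorem pu_eq_fderiv {g : ℝ × ℝ → ℝ} {x : ℝ × ℝ} (hg : DifferentiableAt ℝ g x) :
    pu g x = fderiv ℝ g x (1, 0) :=
  (HasFDerivAt.comp_hasDerivAt (f := fun u : ℝ => (u, x.2)) x.1 hg.hasFDerivAt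
    ((hasDerivAt_id x.1).prodMk (hasDerivAt_const x.1 x.2))).deriv

theorem pv_eq_fderiv {g : ℝ × ℝ → ℝ} {x : ℝ × ℝ} (hg : DifferentiableAt ℝ g x) :
    pv g x = fderiv ℝ g x (0, 1) :=
  (HasFDerivAt.comp_hasDerivAt (f := fun v : ℝ => (x.1, v)) x.2 hg.hasFDerivAt
    ((hasDerivAt_const x.2 x.1).prodMk (hasDerivAt_id x.2))).deriv

theorem hasPartials_of_differentiableAt {g : ℝ × ℝ → ℝ} {w : ℂ}
    (hg : DifferentiableAt ℝ g (w.re, w.im)) :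
    HasPartials (fun z => (g (z.re, z.im) : ℂ)) (pu g (w.re, w.im)) (pv g (w.re, w.im)) w := by
  refine (hasFDerivAt_partialsCLM_iff fun h => ?_).1 (Complex.ofRealCLM.hasFDerivAt.comp w
    (hg.hasFDerivAt.comp w (Complex.reCLM.hasFDerivAt.prodMk Complex.imCLM.hasFDerivAt)))
  have h1 : ((h.re, h.im) : ℝ × ℝ) = h.re • (1, 0) + h.im • (0, 1) := by simp
  rw [pu_eq_fderiv hg, pv_eq_fderiv hg]
  simp only [ContinuousLinearMap.comp_apply, ContinuousLinearMap.prod_apply, Complex.reCLM_apply,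
    Complex.imCLM_apply, Complex.ofRealCLM_apply]
  rw [h1, map_add, map_smul, map_smul]
  simp

theorem isOpen_unitDisk : IsOpen unitDisk :=
  isOpen_lt (f := fun p : ℝ × ℝ => p.1 ^ 2 + p.2 ^ 2) (by fun_prop) continuous_const

theorem mem_unitDisk_of_mem_ball {w : ℂ} (hw : w ∈ Metric.ball (0 : ℂ) 1) :
    ((w.re, w.im) : ℝ × ℝ) ∈ unitDisk := by
  have h1 := mem_ball_zero_iff.1 hw
  have h2 : ‖w‖ ^ 2 < 1 := by nlinarith [norm_nonneg w]
  rw [← Complex.normSq_eq_norm_sq, Complex.normSq_apply] at h2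
  rw [unitDisk, mem_ofPred_eq]
  nlinarith

theorem IsMinimalGraph.isMinimalGradient {f : ℝ × ℝ → ℝ} (hf : IsMinimalGraph f) :
    IsMinimalGradient (fun z => pu f (z.re, z.im)) (fun z => pv f (z.re, z.im))
      (fun z => pu (pu f) (z.re, z.im)) (fun z => pv (pu f) (z.re, z.im))
      (fun z => pv (pv f) (z.re, z.im)) := by
  have hd : ∀ x ∈ unitDisk, DifferentiableAt ℝ f x := fun x hx =>
    (hf.1.contDiffAt (isOpen_unitDisk.mem_nhds hx)).differentiableAt two_ne_zero
  have hd2 : ∀ x ∈ unitDisk, DifferentiableAt ℝ (fderiv ℝ f) x := fun x hx =>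
    ((hf.1.fderiv_of_isOpen isOpen_unitDisk (m := 1) (by norm_num)).contDiffAt
      (isOpen_unitDisk.mem_nhds hx)).differentiableAt one_ne_zero
  have hpu : ∀ x ∈ unitDisk, HasFDerivAt (pu f)
      ((ContinuousLinearMap.apply ℝ ℝ ((1, 0) : ℝ × ℝ)).comp (fderiv ℝ (fderiv ℝ f) x)) x := by
    intro x hx
    refine ((ContinuousLinearMap.apply ℝ ℝ ((1, 0) : ℝ × ℝ)).hasFDerivAt.comp x
      (hd2 x hx).hasFDerivAt).congr_of_eventuallyEq ?_
    filter_upwards [isOpen_unitDisk.mem_nhds hx] with y hy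
    exact pu_eq_fderiv (hd y hy)
  have hpv : ∀ x ∈ unitDisk, HasFDerivAt (pv f)
      ((ContinuousLinearMap.apply ℝ ℝ ((0, 1) : ℝ × ℝ)).comp (fderiv ℝ (fderiv ℝ f) x)) x := by
    intro x hx
    refine ((ContinuousLinearMap.apply ℝ ℝ ((0, 1) : ℝ × ℝ)).hasFDerivAt.comp x
      (hd2 x hx).hasFDerivAt).congr_of_eventuallyEq ?_
    filter_upwards [isOpen_unitDisk.mem_nhds hx] with y hy
    exact pv_eq_fderiv (hd y hy)
  have hsymm : ∀ x ∈ unitDisk, pu (pv f) x = pv (pu f) x := by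
    intro x hx
    rw [pu_eq_fderiv (hpv x hx).differentiableAt, pv_eq_fderiv (hpu x hx).differentiableAt,
      (hpv x hx).fderiv, (hpu x hx).fderiv]
    exact (hf.1.contDiffAt (isOpen_unitDisk.mem_nhds hx)).isSymmSndFDerivAt (by simp) _ _
  refine ⟨fun w hw => ?_, fun w hw => ?_, fun w hw => hf.2 _ (mem_unitDisk_of_mem_ball hw)⟩
  · exact hasPartials_of_differentiableAt (hpu _ (mem_unitDisk_of_mem_ball hw)).differentiableAt
  · refine (hasPartials_of_differentiableAt
      (hpv _ (mem_unitDisk_of_mem_ball hw)).differentiableAt).congr_partials ?_ rfl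
    rw [hsymm _ (mem_unitDisk_of_mem_ball hw)]

/-- For any minimal graph over the unit disk, at the origin the
scale-invariant curvature quantity `W² |K|` is at most `16π²/27`. -/
theorem hall_curvature_bound (f : ℝ × ℝ → ℝ) (hf : IsMinimalGraph f) :
    |pu (pu f) ((0 : ℝ), (0 : ℝ)) * pv (pv f) ((0 : ℝ), (0 : ℝ))
        - (pv (pu f) ((0 : ℝ), (0 : ℝ))) ^ 2|
      / (1 + (pu f ((0 : ℝ), (0 : ℝ))) ^ 2 + (pv f ((0 : ℝ), (0 : ℝ))) ^ 2)
    ≤ 16 * π ^ 2 / 27 := by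
  have h0 : ∀ r : ℝ, 1 / 2 < r → r < 1 →
      |pu (pu f) ((0 : ℝ), (0 : ℝ)) * pv (pv f) ((0 : ℝ), (0 : ℝ))
        - (pv (pu f) ((0 : ℝ), (0 : ℝ))) ^ 2| * (27 * r ^ 2) ≤
      16 * π ^ 2 * (1 + pu f (0, 0) ^ 2 + pv f (0, 0) ^ 2) := by
    intro r hr hr1
    have h := hf.isMinimalGradient.hessian_bound_of_lt_one hr hr1
    rwa [areaElement_sq] at h
  rw [div_le_iff₀ (by positivity)]
  have hlim : Tendsto (fun r : ℝ => |pu (pu f) ((0 : ℝ), (0 : ℝ)) * pv (pv f) ((0 : ℝ), (0 : ℝ))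
      - (pv (pu f) ((0 : ℝ), (0 : ℝ))) ^ 2| * (27 * r ^ 2)) (𝓝[<] 1)
      (𝓝 (|pu (pu f) ((0 : ℝ), (0 : ℝ)) * pv (pv f) ((0 : ℝ), (0 : ℝ))
      - (pv (pu f) ((0 : ℝ), (0 : ℝ))) ^ 2| * (27 * 1 ^ 2))) :=
    Tendsto.mono_left (Continuous.tendsto (by fun_prop) 1) nhdsWithin_le_nhds
  have h1 := le_of_tendsto hlim (b := 16 * π ^ 2 *
    (1 + pu f (0, 0) ^ 2 + pv f (0, 0) ^ 2)) (by
      filter_upwards [Ioo_mem_nhdsLT (show (1 / 2 : ℝ) < 1 by norm_num)] with r hr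
      exact h0 _ hr.1 hr.2)
  linarith
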